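/- Let G be a finite group of order n. Then α(G) = 2n if and only if one of the following holds: (i) G is a generalised quaternion group Q_{2^r} with r ≥ 3; (ii) G is cyclic of prime order p with p ≥ 7; (iii) G is isomorphic to C₃ × C₃. -/

import Mathlib

/-- `graphAlpha G` is the minimum number of vertices of a finite simple graph whose
automorphism group is isomorphic to `G`. -/
noncomputable def graphAlpha (G : Type*) [Group G] : ℕ :=
  sInf {n : ℕ | ∃ Γ : SimpleGraph (Fin n), Nonempty ((Γ ≃g Γ) ≃* G)}

/-- The cyclic group of order `n`. -/
abbrev Cyc (n : ℕ) := Multiplicative (ZMod n)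

/-- `G` acts faithfully on `V`, and its elements give precisely the automorphisms of `Γ`. -/
structure IsAutAction (G : Type*) [Group G] {V : Type*} [MulAction G V] (Γ : SimpleGraph V) :
    Prop where
  adj : ∀ (g : G) {x y : V}, Γ.Adj x y → Γ.Adj (g • x) (g • y)
  faithful : ∀ g : G, (∀ x : V, g • x = x) → g = 1
  surj : ∀ φ : Γ ≃g Γ, ∃ g : G, ∀ x, φ x = g • x

/-- Some graph on `m` vertices has automorphism group isomorphic to `G`. -/
def Realizable (G : Type*) [Group G] (m : ℕ) : Prop :=
  ∃ Γ : SimpleGraph (Fin m), Nonempty ((Γ ≃g Γ) ≃* G)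

/-- Conjugation by a graph isomorphism. -/
def autConj {V W : Type*} {Γ : SimpleGraph V} {Δ : SimpleGraph W} (e : Γ ≃g Δ) :
    (Γ ≃g Γ) ≃* (Δ ≃g Δ) where
  toFun φ := (e.symm.trans φ).trans e
  invFun φ := (e.trans φ).trans e.symm
  left_inv φ := by ext x; simp
  right_inv φ := by ext x; simp
  map_mul' φ ψ := by ext x; simp [RelIso.mul_apply]

theorem Realizable.of_graph {G : Type*} [Group G] {V : Type*} [Finite V] {Γ : SimpleGraph V}
    (h : Nonempty ((Γ ≃g Γ) ≃* G)) : Realizable G (Nat.card V) := by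
  obtain ⟨e⟩ := h
  let f := Finite.equivFin V
  exact ⟨Γ.map f.toEmbedding, ⟨(autConj (SimpleGraph.Iso.map f Γ)).symm.trans e⟩⟩

theorem Realizable.congr {G H : Type*} [Group G] [Group H] {m : ℕ} (h : Realizable G m)
    (e : G ≃* H) : Realizable H m := by
  obtain ⟨Γ, ⟨f⟩⟩ := h
  exact ⟨Γ, ⟨f.trans e⟩⟩

namespace IsAutAction

variable {G : Type*} [Group G] {V : Type*} [MulAction G V] {Γ : SimpleGraph V}

theorem adj_iff (h : IsAutAction G Γ) (g : G) {x y : V} :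
    Γ.Adj (g • x) (g • y) ↔ Γ.Adj x y :=
  ⟨fun H => by simpa using h.adj g⁻¹ H, h.adj g⟩

theorem nonempty_mulEquiv (h : IsAutAction G Γ) : Nonempty ((Γ ≃g Γ) ≃* G) := by
  let F : G →* (Γ ≃g Γ) :=
    { toFun := fun g => ⟨MulAction.toPerm g, h.adj_iff g⟩
      map_one' := by ext x; exact one_smul G x
      map_mul' := fun a b => by ext x; exact mul_smul a b x }
  have hF : Function.Bijective F := by
    constructor
    · rw [injective_iff_map_eq_one]
      intro g hg
      exact h.faithful g fun x => congrArg (fun φ : Γ ≃g Γ => φ x) hg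
    · intro φ
      obtain ⟨g, hg⟩ := h.surj φ
      exact ⟨g, by ext x; exact (hg x).symm⟩
  exact ⟨(MulEquiv.ofBijective F hF).symm⟩

theorem realizable [Finite V] (h : IsAutAction G Γ) : Realizable G (Nat.card V) :=
  Realizable.of_graph h.nonempty_mulEquiv

/-- An automorphism fixing a point with trivial stabilizer is the identity. -/
theorem eq_of_fixed (h : IsAutAction G Γ) {v : V} (hv : ∀ g : G, g • v = v → g = 1)
    (φ : V → V) (hφ : Function.Involutive φ) (hadj : ∀ x y, Γ.Adj x y → Γ.Adj (φ x) (φ y))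
    (hfix : φ v = v) (x : V) : φ x = x := by
  obtain ⟨g, hg⟩ := h.surj ⟨hφ.toPerm, fun {x y} => ⟨fun H => by
    simpa [hφ x, hφ y] using hadj _ _ H, hadj x y⟩⟩
  replace hg : ∀ x, φ x = g • x := hg
  have : g = 1 := hv g (by rw [← hg, hfix])
  rw [hg, this, one_smul]

end IsAutAction

theorem Realizable.exists_action {G : Type*} [Group G] {m : ℕ} (h : Realizable G m) :
    ∃ (Γ : SimpleGraph (Fin m)) (_ : MulAction G (Fin m)), IsAutAction G Γ := by
  obtain ⟨Γ, ⟨e⟩⟩ := h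
  let act : MulAction G (Fin m) :=
    { smul := fun g x => e.symm g x
      one_smul := fun x => by change e.symm 1 x = x; rw [map_one]; rfl
      mul_smul := fun a b x => by
        change e.symm (a * b) x = e.symm a (e.symm b x)
        rw [map_mul]; rfl }
  refine ⟨Γ, act, ?_, ?_, ?_⟩
  · intro g x y H
    exact (e.symm g).map_rel_iff.2 H
  · intro g hg
    have : e.symm g = 1 := by ext x; exact congrArg Fin.val (hg x)
    simpa using this
  · intro φ
    exact ⟨e φ, fun x => by change _ = e.symm (e φ) x; simp⟩

theorem IsAutAction.compl {G : Type*} [Group G] {V : Type*} [MulAction G V] {Γ : SimpleGraph V}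
    (h : IsAutAction G Γ) : IsAutAction G Γᶜ where
  adj g x y H := by
    rw [SimpleGraph.compl_adj] at H ⊢
    exact ⟨fun e => H.1 (MulAction.injective g e), fun e => H.2 ((h.adj_iff g).1 e)⟩
  faithful := h.faithful
  surj φ := h.surj ⟨φ.toEquiv, fun {x y} => by
    have := φ.map_adj_iff (v := x) (w := y)
    simp only [SimpleGraph.compl_adj] at this
    by_cases e : x = y
    · subst e; simp
    · have e' : φ x ≠ φ y := fun h => e (φ.injective h)
      have : ¬ Γ.Adj (φ x) (φ y) ↔ ¬ Γ.Adj x y := by simpa [e, e'] using this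
      exact not_iff_not.1 this⟩

theorem Realizable.exists_preconnected {G : Type*} [Group G] {m : ℕ} (h : Realizable G m)
    (hm : 0 < m) :
    ∃ (Γ : SimpleGraph (Fin m)) (_ : MulAction G (Fin m)), IsAutAction G Γ ∧ Γ.Preconnected := by
  have : Nonempty (Fin m) := ⟨⟨0, hm⟩⟩
  obtain ⟨Γ, act, hΓ⟩ := h.exists_action
  rcases Γ.connected_or_connected_compl with hc | hc
  · exact ⟨Γ, act, hΓ, hc.preconnected⟩
  · exact ⟨Γᶜ, act, hΓ.compl, hc.preconnected⟩

theorem SimpleGraph.Preconnected.iff_of_adj_iff {V : Type*} {Γ : SimpleGraph V}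
    (h : Γ.Preconnected) {P : V → Prop} (hP : ∀ x y, Γ.Adj x y → (P x ↔ P y)) (x y : V) :
    P x ↔ P y := by
  obtain ⟨p⟩ := h x y
  induction p with
  | nil => rfl
  | cons hxy _ ih => exact (hP _ _ hxy).trans ih

/-- The componentwise action of a product on a disjoint union. -/
abbrev sumAction (A B V W : Type*) [Group A] [Group B] [MulAction A V] [MulAction B W] :
    MulAction (A × B) (V ⊕ W) where
  smul g := Sum.map (g.1 • ·) (g.2 • ·)
  one_smul x := by cases x <;> exact congrArg _ (one_smul _ _)
  mul_smul a b x := by cases x <;> exact congrArg _ (mul_smul _ _ _)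

theorem Realizable.prod {A B : Type*} [Group A] [Group B] {m k : ℕ} (hA : Realizable A m)
    (hB : Realizable B k) (hm : 0 < m) (hk : 0 < k) (hmk : m ≠ k) :
    Realizable (A × B) (m + k) := by
  obtain ⟨Γ, actA, hΓ, cΓ⟩ := hA.exists_preconnected hm
  obtain ⟨Δ, actB, hΔ, cΔ⟩ := hB.exists_preconnected hk
  let _ := sumAction A B (Fin m) (Fin k)
  have hl : ∀ (g : A × B) (x : Fin m), g • (Sum.inl x : Fin m ⊕ Fin k) = Sum.inl (g.1 • x) :=
    fun _ _ => rfl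
  have hr : ∀ (g : A × B) (x : Fin k), g • (Sum.inr x : Fin m ⊕ Fin k) = Sum.inr (g.2 • x) :=
    fun _ _ => rfl
  have side : ∀ φ : Γ ⊕g Δ ≃g Γ ⊕g Δ, ∀ x y, (Γ ⊕g Δ).Adj x y →
      ((φ x).isLeft = true ↔ (φ y).isLeft = true) := by
    intro φ x y H
    have := φ.map_adj_iff.2 H
    revert this
    cases φ x <;> cases φ y <;> simp
  have main : IsAutAction (A × B) (Γ ⊕g Δ) := by
    refine ⟨?_, ?_, ?_⟩
    · rintro g (x | x) (y | y) H
      · exact hΓ.adj g.1 H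
      · simp at H
      · simp at H
      · exact hΔ.adj g.2 H
    · intro g hg
      refine Prod.ext (hΓ.faithful _ fun x => ?_) (hΔ.faithful _ fun x => ?_)
      · exact Sum.inl_injective (hg (Sum.inl x))
      · exact Sum.inr_injective (hg (Sum.inr x))
    · intro φ
      have sl := fun x y => cΓ.iff_of_adj_iff (P := fun x => (φ (Sum.inl x)).isLeft = true)
        (fun x y H => side φ _ _ (by simpa using H)) x y
      have sr := fun x y => cΔ.iff_of_adj_iff (P := fun x => (φ (Sum.inr x)).isLeft = true)
        (fun x y H => side φ _ _ (by simpa using H)) x y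
      have key : (∀ x, (φ (Sum.inl x)).isLeft = true) ∧ ∀ y, ¬ (φ (Sum.inr y)).isLeft = true := by
        by_cases h0 : (φ (Sum.inl ⟨0, hm⟩)).isLeft = true <;>
        by_cases h1 : (φ (Sum.inr ⟨0, hk⟩)).isLeft = true
        · obtain ⟨x | x, hx⟩ := φ.surjective (Sum.inr ⟨0, hk⟩)
          · have := (sl ⟨0, hm⟩ x).1 h0
            simp [hx] at this
          · have := (sr ⟨0, hk⟩ x).1 h1
            simp [hx] at this
        · exact ⟨fun x => (sl _ x).1 h0, fun y hy => h1 ((sr y _).1 hy)⟩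
        · exfalso
          have ha : ∀ x, ∃ y, φ (Sum.inl x) = Sum.inr y := fun x => by
            have := fun h => h0 ((sl x _).1 h)
            cases h : φ (Sum.inl x) <;> simp_all
          have hb : ∀ y, ∃ x, φ (Sum.inr y) = Sum.inl x := fun y => by
            have := (sr _ y).1 h1
            cases h : φ (Sum.inr y) <;> simp_all
          choose f hf using ha
          choose g hg using hb
          have i1 : Function.Injective f := fun x y h => by
            have : φ (Sum.inl x) = φ (Sum.inl y) := by rw [hf, hf, h]
            simpa using this
          have i2 : Function.Injective g := fun x y h => by
            have : φ (Sum.inr x) = φ (Sum.inr y) := by rw [hg, hg, h]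
            simpa using this
          have c1 := Fintype.card_le_of_injective f i1
          have c2 := Fintype.card_le_of_injective g i2
          simp at c1 c2
          omega
        · obtain ⟨x | x, hx⟩ := φ.surjective (Sum.inl ⟨0, hm⟩)
          · exact absurd ((sl x ⟨0, hm⟩).1 (by simp [hx])) h0
          · exact absurd ((sr x ⟨0, hk⟩).1 (by simp [hx])) h1
      have ha : ∀ x, ∃ y, φ (Sum.inl x) = Sum.inl y := fun x => by
        have := key.1 x
        cases h : φ (Sum.inl x) <;> simp_all
      have hb : ∀ y, ∃ x, φ (Sum.inr y) = Sum.inr x := fun y => by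
        have := key.2 y
        cases h : φ (Sum.inr y) <;> simp_all
      choose f hf using ha
      choose g hg using hb
      have i1 : Function.Injective f := fun x y h => by
        have : φ (Sum.inl x) = φ (Sum.inl y) := by rw [hf, hf, h]
        simpa using this
      have i2 : Function.Injective g := fun x y h => by
        have : φ (Sum.inr x) = φ (Sum.inr y) := by rw [hg, hg, h]
        simpa using this
      obtain ⟨a, ha⟩ := hΓ.surj ⟨Equiv.ofBijective f (Finite.injective_iff_bijective.1 i1),
        fun {x y} => by
          have := φ.map_adj_iff (v := Sum.inl x) (w := Sum.inl y)
          simpa [hf] using this⟩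
      obtain ⟨b, hb⟩ := hΔ.surj ⟨Equiv.ofBijective g (Finite.injective_iff_bijective.1 i2),
        fun {x y} => by
          have := φ.map_adj_iff (v := Sum.inr x) (w := Sum.inr y)
          simpa [hg] using this⟩
      refine ⟨(a, b), ?_⟩
      rintro (x | x)
      · rw [hf, hl]; exact congrArg _ (ha x)
      · rw [hg, hr]; exact congrArg _ (hb x)
  have := main.realizable
  simpa using this

theorem realizable_of_subsingleton {A : Type*} [Group A] [Subsingleton A] {m : ℕ} (hm : m ≤ 1) :
    Realizable A m := by
  have : Subsingleton (Fin m) := by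
    rcases Nat.le_one_iff_eq_zero_or_eq_one.1 hm with rfl | rfl <;> infer_instance
  have : Subsingleton ((⊥ : SimpleGraph (Fin m)) ≃g (⊥ : SimpleGraph (Fin m))) :=
    ⟨fun a b => by ext x; exact congrArg _ (Subsingleton.elim _ _)⟩
  refine ⟨⊥, ⟨⟨⟨fun _ => 1, fun _ => 1, fun _ => Subsingleton.elim _ _,
    fun _ => Subsingleton.elim _ _⟩, fun _ _ => Subsingleton.elim _ _⟩⟩⟩

theorem Realizable.succ {A : Type*} [Group A] {m : ℕ} (h : Realizable A m) (hm : 2 ≤ m) :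
    Realizable A (m + 1) :=
  (h.prod (realizable_of_subsingleton (A := Unit) le_rfl) (by omega) one_pos (by omega)).congr
    MulEquiv.prodUnique

section Refinement

variable {X : Type*} [Fintype X] {Γ : SimpleGraph X} {adj : X → X → Bool}

/-- The number of common neighbours of two vertices. -/
def commonNbrs (adj : X → X → Bool) (x y : X) : ℕ :=
  (Finset.univ.filter fun z => (adj x z && adj y z) = true).card

theorem commonNbrs_iso (hΓ : ∀ x y, Γ.Adj x y ↔ adj x y = true) (φ : Γ ≃g Γ) (x y : X) :
    commonNbrs adj (φ x) (φ y) = commonNbrs adj x y := by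
  symm
  refine Finset.card_bij (fun z _ => φ z) ?_ (fun _ _ _ _ h => φ.injective h) ?_
  · intro z hz
    simpa only [Finset.mem_filter, Finset.mem_univ, true_and, Bool.and_eq_true, ← hΓ,
      φ.map_adj_iff] using hz
  · intro z hz
    refine ⟨φ.symm z, ?_, by simp⟩
    have : z = φ (φ.symm z) := by simp
    rw [this] at hz
    simpa only [Finset.mem_filter, Finset.mem_univ, true_and, Bool.and_eq_true, ← hΓ,
      φ.map_adj_iff] using hz

variable [DecidableEq X]

/-- Each vertex of the second list is determined by its degree, its adjacencies and its numbers of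
common neighbours with the earlier vertices and those of the first list. -/
def refines (adj : X → X → Bool) : List X → List X → Bool
  | fixed, [] => decide (∀ v, v ∈ fixed)
  | fixed, v :: vs =>
    decide (∀ w, commonNbrs adj w w = commonNbrs adj v v →
      (∀ u ∈ fixed, adj w u = adj v u ∧ commonNbrs adj w u = commonNbrs adj v u) → w = v) &&
    refines adj (v :: fixed) vs

theorem eq_self_of_refines (hΓ : ∀ x y, Γ.Adj x y ↔ adj x y = true) (φ : Γ ≃g Γ) :
    ∀ l₂ l₁ : List X, refines adj l₁ l₂ = true → (∀ u ∈ l₁, φ u = u) → ∀ x, φ x = x := by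
  intro l₂
  induction l₂ with
  | nil =>
    intro l₁ h hfix x
    simp only [refines, decide_eq_true_eq] at h
    exact hfix x (h x)
  | cons v vs ih =>
    intro l₁ h hfix
    simp only [refines, Bool.and_eq_true, decide_eq_true_eq] at h
    have hv : φ v = v := by
      refine h.1 _ (commonNbrs_iso hΓ φ v v) fun u hu => ⟨?_, ?_⟩
      · have : adj (φ v) (φ u) = adj v u := by
          rw [Bool.eq_iff_iff, ← hΓ, ← hΓ, φ.map_adj_iff]
        rwa [hfix u hu] at this
      · have := commonNbrs_iso hΓ φ v u
        rwa [hfix u hu] at this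
    refine ih (v :: l₁) h.2 fun u hu => ?_
    rcases List.mem_cons.1 hu with rfl | hu
    · exact hv
    · exact hfix u hu

theorem isAutAction_of_refines {G : Type*} [Group G] [MulAction G X]
    (hΓ : ∀ x y, Γ.Adj x y ↔ adj x y = true) (v : X)
    (hadj : ∀ (g : G) x y, adj x y = true → adj (g • x) (g • y) = true)
    (hstab : ∀ g : G, g • v = v → g = 1)
    (horb : ∀ w, commonNbrs adj w w = commonNbrs adj v v → ∃ g : G, g • v = w)
    (l : List X) (hl : refines adj [v] l = true) : IsAutAction G Γ := by
  have hA : ∀ (g : G) {x y : X}, Γ.Adj x y → Γ.Adj (g • x) (g • y) := fun g x y h =>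
    (hΓ _ _).2 (hadj g x y ((hΓ _ _).1 h))
  refine ⟨hA, fun g hg => hstab g (hg v), fun φ => ?_⟩
  obtain ⟨g, hg⟩ := horb (φ v) (commonNbrs_iso hΓ φ v v)
  let ψ : Γ ≃g Γ := ⟨MulAction.toPerm g⁻¹, fun {x y} =>
    ⟨fun h => by simpa using hA g h, hA g⁻¹⟩⟩
  refine ⟨g, fun x => ?_⟩
  have := eq_self_of_refines hΓ (φ.trans ψ) l [v] hl (by
    intro u hu
    rw [List.mem_singleton.1 hu]
    change g⁻¹ • φ v = v
    rw [← hg, inv_smul_smul]) x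
  change g⁻¹ • φ x = x at this
  rw [← this, smul_inv_smul]
  simpa using congrArg φ this

end Refinement

/-- The adjacency relation of a nine-vertex graph with automorphism group `C₃`. -/
def adjThree : ZMod 3 × Fin 3 → ZMod 3 × Fin 3 → Bool
  | (a, 0), (b, 1) => a == b
  | (b, 1), (a, 0) => a == b
  | (a, 0), (c, 2) => a == c
  | (c, 2), (a, 0) => a == c
  | (b, 1), (c, 2) => b == c || b + 1 == c
  | (c, 2), (b, 1) => b == c || b + 1 == c
  | (c, 2), (c', 2) => c != c'
  | _, _ => false

/-- Translation on each layer. -/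
abbrev layerAction (A ι : Type*) [AddGroup A] : MulAction (Multiplicative A) (A × ι) where
  smul g x := (g.toAdd + x.1, x.2)
  one_smul _ := Prod.ext (zero_add _) rfl
  mul_smul _ _ _ := Prod.ext (add_assoc _ _ _) rfl

theorem realizable_three : Realizable (Multiplicative (ZMod 3)) 9 := by
  let _ := layerAction (ZMod 3) (Fin 3)
  let Γ : SimpleGraph (ZMod 3 × Fin 3) :=
    { Adj := fun x y => adjThree x y = true
      symm := ⟨by decide +kernel⟩
      loopless := ⟨by decide +kernel⟩ }
  have : IsAutAction (Multiplicative (ZMod 3)) Γ := by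
    refine isAutAction_of_refines (adj := adjThree) (fun x y => Iff.rfl) (0, 0) ?_ ?_ ?_
      [(0, 1), (1, 0), (2, 0), (1, 1), (2, 1), (0, 2), (1, 2), (2, 2)] ?_
    · change ∀ (g : ZMod 3) (x y : ZMod 3 × Fin 3), adjThree x y = true →
        adjThree (g + x.1, x.2) (g + y.1, y.2) = true
      decide +kernel
    · change ∀ g : ZMod 3, ((g + 0, 0) : ZMod 3 × Fin 3) = (0, 0) → g = 0
      decide +kernel
    · change ∀ w : ZMod 3 × Fin 3, _ → ∃ g : ZMod 3, ((g + 0, 0) : ZMod 3 × Fin 3) = w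
      decide +kernel
    · decide +kernel
  have := this.realizable
  simpa using this

/-- The adjacency relation of an eighteen-vertex graph with automorphism group `C₃ × C₃`. -/
def adjNine : (ZMod 3 × ZMod 3) × Bool → (ZMod 3 × ZMod 3) × Bool → Bool
  | (a, false), (b, false) => a.1 == b.1 && a.2 != b.2
  | (a, true), (b, true) => (a.1 == b.1) != (a.2 == b.2)
  | (a, false), (b, true) => a == b || b == a + (0, 1) || b == a + (1, 0)
  | (b, true), (a, false) => a == b || b == a + (0, 1) || b == a + (1, 0)

theorem realizable_nine : Realizable (Multiplicative (ZMod 3 × ZMod 3)) 18 := by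
  let _ := layerAction (ZMod 3 × ZMod 3) Bool
  let Γ : SimpleGraph ((ZMod 3 × ZMod 3) × Bool) :=
    { Adj := fun x y => adjNine x y = true
      symm := ⟨by decide +kernel⟩
      loopless := ⟨by decide +kernel⟩ }
  have : IsAutAction (Multiplicative (ZMod 3 × ZMod 3)) Γ := by
    refine isAutAction_of_refines (adj := adjNine) (fun x y => Iff.rfl) (0, false) ?_ ?_ ?_
      [((0, 0), true), ((0, 1), false), ((0, 2), false), ((1, 1), false), ((1, 0), false),
        ((1, 2), false), ((2, 0), false), ((2, 1), false), ((2, 2), false), ((0, 1), true),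
        ((0, 2), true), ((1, 0), true), ((1, 1), true), ((1, 2), true), ((2, 0), true),
        ((2, 1), true), ((2, 2), true)] ?_
    · change ∀ (g : ZMod 3 × ZMod 3) (x y : (ZMod 3 × ZMod 3) × Bool), adjNine x y = true →
        adjNine (g + x.1, x.2) (g + y.1, y.2) = true
      decide +kernel
    · change ∀ g : ZMod 3 × ZMod 3, ((g + 0, false) : (ZMod 3 × ZMod 3) × Bool) = (0, false) →
        g = 0
      decide +kernel
    · change ∀ w : (ZMod 3 × ZMod 3) × Bool, _ →
        ∃ g : ZMod 3 × ZMod 3, ((g + 0, false) : (ZMod 3 × ZMod 3) × Bool) = w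
      decide +kernel
    · decide +kernel
  have := this.realizable
  simpa using this

theorem realizable_two : Realizable (Multiplicative (ZMod 2)) 2 := by
  let _ := layerAction (ZMod 2) Unit
  let Γ : SimpleGraph (ZMod 2 × Unit) :=
    { Adj := fun x y => (x.1 != y.1) = true
      symm := ⟨by decide +kernel⟩
      loopless := ⟨by decide +kernel⟩ }
  have : IsAutAction (Multiplicative (ZMod 2)) Γ := by
    refine isAutAction_of_refines (adj := fun x y => x.1 != y.1) (fun x y => Iff.rfl) (0, ()) ?_ ?_
      ?_ [(1, ())] ?_
    · change ∀ (g : ZMod 2) (x y : ZMod 2 × Unit), (x.1 != y.1) = true →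
        (g + x.1 != g + y.1) = true
      decide +kernel
    · change ∀ g : ZMod 2, ((g + 0, ()) : ZMod 2 × Unit) = (0, ()) → g = 0
      decide +kernel
    · change ∀ w : ZMod 2 × Unit, _ → ∃ g : ZMod 2, ((g + 0, ()) : ZMod 2 × Unit) = w
      decide +kernel
    · decide +kernel
  have := this.realizable
  simpa using this

/-- A graph with automorphism group `M`, few vertices and two orbits suitable for attaching
further vertices: one regular, the other with stabilizer `K`. -/
structure IsGoodPair {M : Type*} [Group M] (K : Subgroup M) {X : Type*} [MulAction M X]
    (Γ : SimpleGraph X) (v w : X) : Prop where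
  isAut : IsAutAction M Γ
  stab_v : ∀ g : M, g • v = v → g = 1
  stab_w : ∀ g : M, g • w = w ↔ g ∈ K
  ne_w : ∀ g : M, g • v ≠ w
  card_le : Nat.card X + 2 ≤ 2 * Nat.card M
  nbrs_v : (Γ.neighborSet v).ncard + 4 ≤ Nat.card X
  nbrs_w : (Γ.neighborSet w).ncard + 1 + Nat.card K ≤ Nat.card X

/-- Existence of a good pair on some finite graph. -/
def Good {M : Type*} [Group M] (K : Subgroup M) : Prop :=
  ∃ (n : ℕ) (_ : MulAction M (Fin n)) (Γ : SimpleGraph (Fin n)) (v w : Fin n), IsGoodPair K Γ v w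

theorem IsGoodPair.good {M : Type*} [Group M] {K : Subgroup M} {X : Type*} [Finite X]
    [MulAction M X] {Γ : SimpleGraph X} {v w : X} (h : IsGoodPair K Γ v w) : Good K := by
  let e := Finite.equivFin X
  let _ : MulAction M (Fin (Nat.card X)) := e.symm.mulAction M
  have hs : ∀ (g : M) (x : X), g • e x = e (g • x) := fun g x => by
    change e (g • e.symm (e x)) = _
    rw [e.symm_apply_apply]
  let Δ : SimpleGraph (Fin (Nat.card X)) := Γ.map e.toEmbedding
  let i : Γ ≃g Δ := SimpleGraph.Iso.map e Γ
  have hadj : ∀ x y, Δ.Adj (e x) (e y) ↔ Γ.Adj x y := fun x y => i.map_adj_iff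
  have hn : ∀ x, (Δ.neighborSet (e x)).ncard = (Γ.neighborSet x).ncard := fun x => by
    rw [← Set.ncard_image_of_injective _ e.injective]
    congr 1
    ext y
    obtain ⟨y, rfl⟩ := e.surjective y
    simp [hadj]
  refine ⟨_, inferInstance, Δ, e v, e w, ⟨?_, ?_, ?_⟩, ?_, ?_, ?_, ?_, ?_, ?_⟩
  · intro g x y
    obtain ⟨x, rfl⟩ := e.surjective x
    obtain ⟨y, rfl⟩ := e.surjective y
    rw [hs, hs, hadj, hadj]
    exact h.isAut.adj g
  · intro g hg
    exact h.isAut.faithful g fun x => e.injective (by rw [← hs]; exact hg _)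
  · intro φ
    obtain ⟨g, hg⟩ := h.isAut.surj ((i.trans φ).trans i.symm)
    refine ⟨g, fun x => ?_⟩
    obtain ⟨x, rfl⟩ := e.surjective x
    rw [hs, ← hg]
    exact (i.apply_symm_apply (φ (e x))).symm
  · intro g hg
    exact h.stab_v g (e.injective (by rw [← hs, hg]))
  · intro g
    rw [hs, e.injective.eq_iff, h.stab_w]
  · intro g hg
    exact h.ne_w g (e.injective (by rw [← hs, hg]))
  · simpa using h.card_le
  · simpa [hn] using h.nbrs_v
  · simpa [hn] using h.nbrs_w

theorem Good.congr {M N : Type*} [Group M] [Group N] {K : Subgroup M} (h : Good K) (e : M ≃* N) :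
    Good (K.map e.toMonoidHom) := by
  obtain ⟨n, act, Γ, v, w, h⟩ := h
  let _ : MulAction N (Fin n) := MulAction.compHom _ e.symm.toMonoidHom
  have hs : ∀ (g : N) (x : Fin n), g • x = e.symm g • x := fun _ _ => rfl
  refine ⟨n, inferInstance, Γ, v, w, ⟨?_, ?_, ?_⟩, ?_, ?_, ?_, ?_, ?_, ?_⟩
  · intro g x y
    exact h.isAut.adj (e.symm g)
  · intro g hg
    simpa using h.isAut.faithful (e.symm g) hg
  · intro φ
    obtain ⟨g, hg⟩ := h.isAut.surj φ
    exact ⟨e g, fun x => by rw [hs, e.symm_apply_apply, hg]⟩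
  · intro g hg
    simpa using h.stab_v (e.symm g) hg
  · intro g
    rw [hs, h.stab_w]
    constructor
    · intro hg; exact ⟨_, hg, by simp⟩
    · rintro ⟨k, hk, rfl⟩; simpa using hk
  · intro g
    exact h.ne_w (e.symm g)
  · rw [← Nat.card_congr e.toEquiv]; exact h.card_le
  · exact h.nbrs_v
  · rw [← Nat.card_congr (K.equivMapOfInjective e.toMonoidHom e.injective).toEquiv]
    exact h.nbrs_w

theorem Good.realizable {M : Type*} [Group M] {K : Subgroup M} (h : Good K) :
    ∃ m < 2 * Nat.card M, Realizable M m := by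
  obtain ⟨n, act, Γ, v, w, h⟩ := h
  refine ⟨n, ?_, ?_⟩
  · have := h.card_le
    simp at this
    omega
  · simpa using h.isAut.realizable

section Induced

variable {N G : Type*} [Group N] [Group G] (f : N →* G) (X : Type*) [MulAction N X]

/-- Identification of `(g * f n, x)` with `(g, n • x)`. -/
def inducedSetoid : Setoid (G × Option X) where
  r a b := ∃ n : N, b.1 = a.1 * f n ∧ a.2 = n • b.2
  iseqv :=
    { refl := fun a => ⟨1, by simp, by simp⟩
      symm := fun {a b} ⟨n, h₁, h₂⟩ => ⟨n⁻¹, by simp [h₁], by simp [h₂]⟩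
      trans := fun {a b c} ⟨n, h₁, h₂⟩ ⟨k, h₃, h₄⟩ =>
        ⟨n * k, by simp [h₁, h₃, mul_assoc], by rw [h₂, h₄, mul_smul]⟩ }

/-- The action of `G` induced from that of `N` on `X` with an added fixed point. -/
def Induced : Type _ := Quotient (inducedSetoid f X)

namespace Induced

variable {X}

/-- The point `x` in the copy indexed by `g`. -/
def pt (g : G) (x : Option X) : Induced f X := Quotient.mk (inducedSetoid f X) (g, x)

variable {f}

theorem mk_eq {g h : G} {x y : Option X} :
    pt f g x = pt f h y ↔ ∃ n : N, h = g * f n ∧ x = n • y :=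
  ⟨fun h => Quotient.exact h, fun h => Quotient.sound h⟩

theorem mk_mul (g : G) (n : N) (x : Option X) : pt f (g * f n) x = pt f g (n • x) :=
  mk_eq.2 ⟨n⁻¹, by simp, by simp⟩

theorem exists_mk (y : Induced f X) : ∃ g x, y = pt f g x := by
  obtain ⟨⟨g, x⟩, rfl⟩ := Quotient.exists_rep y
  exact ⟨g, x, rfl⟩

instance : MulAction G (Induced f X) where
  smul g := Quotient.map' (fun a => (g * a.1, a.2)) (by
    rintro a b ⟨n, h₁, h₂⟩
    exact ⟨n, by simp [h₁, mul_assoc], h₂⟩)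
  one_smul y := by
    obtain ⟨g, x, rfl⟩ := exists_mk y
    change pt f (1 * g) x = pt f g x
    rw [one_mul]
  mul_smul a b y := by
    obtain ⟨g, x, rfl⟩ := exists_mk y
    change pt f (a * b * g) x = pt f (a * (b * g)) x
    rw [mul_assoc]

theorem smul_mk (g h : G) (x : Option X) : g • pt f h x = pt f (g * h) x := rfl

theorem mk_inj (hf : Function.Injective f) {g : G} {x y : Option X} :
    pt f g x = pt f g y ↔ x = y := by
  refine ⟨fun h => ?_, fun h => h ▸ rfl⟩
  obtain ⟨n, h₁, h₂⟩ := mk_eq.1 h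
  have : f n = 1 := by simpa using h₁
  rw [(injective_iff_map_eq_one f).1 hf n this, one_smul] at h₂
  exact h₂

theorem mk_none_ne {g h : G} {x : X} : pt f g none ≠ pt f h (some x) := by
  intro H
  obtain ⟨n, -, h₂⟩ := mk_eq.1 H
  simp at h₂

theorem mk_some_eq {g h : G} {x y : X} :
    pt f g (some x) = pt f h (some y) ↔ ∃ n : N, h = g * f n ∧ x = n • y := by
  rw [mk_eq]; simp

theorem mk_none_eq {g h : G} :
    pt f g (none : Option X) = pt f h none ↔ ∃ n : N, h = g * f n := by
  rw [mk_eq]; simp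

instance [Finite G] [Finite X] : Finite (Induced f X) :=
  inferInstanceAs (Finite (Quotient (inducedSetoid f X)))

end Induced

end Induced

namespace Induced

variable {N G : Type*} [Group N] [Group G] {f : N →* G} {X : Type*} [MulAction N X]

/-- The edges joining different copies. -/
def CrossRel (v w : X) (t : G) (y z : Induced f X) : Prop :=
  ∃ h : G, y = pt f h (some v) ∧ (z = pt f (h * t) (some v) ∨ z = pt f (h * t) (some w))

/-- Copies of `Γ` indexed by cosets, each with a node joined to its points, the nodes forming a
clique, and with the points of the copies joined according to `t`. -/
def LinkRel (Γ : SimpleGraph X) (v w : X) (t : G) (y z : Induced f X) : Prop :=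
  (∃ g x x', Γ.Adj x x' ∧ y = pt f g (some x) ∧ z = pt f g (some x')) ∨
  (∃ g x, y = pt f g none ∧ z = pt f g (some x)) ∨
  (∃ g h, y = pt f g none ∧ z = pt f h none) ∨ CrossRel v w t y z

/-- The graph of the relation `LinkRel`. -/
def linkGraph (f : N →* G) (Γ : SimpleGraph X) (v w : X) (t : G) : SimpleGraph (Induced f X) :=
  SimpleGraph.fromRel (LinkRel Γ v w t)

variable {Γ : SimpleGraph X} {v w : X} {t : G}

theorem CrossRel.smul {y z : Induced f X} (h : CrossRel v w t y z) (g : G) :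
    CrossRel v w t (g • y) (g • z) := by
  obtain ⟨a, rfl, h | h⟩ := h
  · exact ⟨g * a, by rw [smul_mk], Or.inl (by rw [h, smul_mk, mul_assoc])⟩
  · exact ⟨g * a, by rw [smul_mk], Or.inr (by rw [h, smul_mk, mul_assoc])⟩

theorem LinkRel.smul {y z : Induced f X} (h : LinkRel Γ v w t y z) (g : G) :
    LinkRel Γ v w t (g • y) (g • z) := by
  rcases h with ⟨a, x, x', h, rfl, rfl⟩ | ⟨a, x, rfl, rfl⟩ | ⟨a, b, rfl, rfl⟩ | h
  · exact Or.inl ⟨g * a, x, x', h, rfl, rfl⟩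
  · exact Or.inr (Or.inl ⟨g * a, x, rfl, rfl⟩)
  · exact Or.inr (Or.inr (Or.inl ⟨g * a, g * b, rfl, rfl⟩))
  · exact Or.inr (Or.inr (Or.inr (h.smul g)))

theorem linkGraph_smul {y z : Induced f X} (h : (linkGraph f Γ v w t).Adj y z) (g : G) :
    (linkGraph f Γ v w t).Adj (g • y) (g • z) := by
  rw [linkGraph, SimpleGraph.fromRel_adj] at h ⊢
  refine ⟨fun e => h.1 (MulAction.injective g e), h.2.imp (·.smul g) (·.smul g)⟩

theorem adj_none_none {g h : G} : (linkGraph f Γ v w t).Adj (pt f g none) (pt f h none) ↔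
    pt f g (none : Option X) ≠ pt f h none := by
  rw [linkGraph, SimpleGraph.fromRel_adj]
  exact ⟨fun h => h.1, fun e => ⟨e, Or.inl (Or.inr (Or.inr (Or.inl ⟨g, h, rfl, rfl⟩)))⟩⟩

theorem adj_none_some {g h : G} {x : X} :
    (linkGraph f Γ v w t).Adj (pt f g none) (pt f h (some x)) ↔
      pt f g (none : Option X) = pt f h none := by
  rw [linkGraph, SimpleGraph.fromRel_adj]
  constructor
  · rintro ⟨-, H | H⟩
    · rcases H with ⟨a, y, y', -, h₁, -⟩ | ⟨a, y, h₁, h₂⟩ | ⟨a, b, h₁, h₂⟩ | ⟨a, h₁, -⟩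
      · exact absurd h₁ mk_none_ne
      · obtain ⟨n, h₃, -⟩ := mk_some_eq.1 h₂
        rw [h₁, h₃, mk_none_eq]
        exact ⟨n⁻¹, by simp⟩
      · exact absurd h₂.symm mk_none_ne
      · exact absurd h₁ mk_none_ne
    · rcases H with ⟨a, y, y', -, -, h₁⟩ | ⟨a, y, -, h₁⟩ | ⟨a, b, h₁, -⟩ | ⟨a, -, h₁ | h₁⟩
      · exact absurd h₁ mk_none_ne
      · exact absurd h₁ mk_none_ne
      · exact absurd h₁.symm mk_none_ne
      · exact absurd h₁ mk_none_ne
      · exact absurd h₁ mk_none_ne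
  · intro e
    refine ⟨mk_none_ne, Or.inl (Or.inr (Or.inl ?_))⟩
    obtain ⟨n, rfl⟩ := mk_none_eq.1 e
    exact ⟨g, n • x, rfl, by rw [mk_mul, Option.smul_some]⟩

variable (hf : Function.Injective f) (ht : t ∉ f.range)

include ht in
theorem mk_ne_mk_mul (g : G) (x y : X) : pt f g (some x) ≠ pt f (g * t) (some y) := by
  intro e
  obtain ⟨n, h, -⟩ := mk_some_eq.1 e
  exact ht ⟨n, (mul_left_cancel h).symm⟩

include ht in
theorem CrossRel.ne {y z : Induced f X} (h : CrossRel v w t y z) : y ≠ z := by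
  obtain ⟨a, rfl, rfl | rfl⟩ := h <;> exact mk_ne_mk_mul ht _ _ _

include hf ht in
theorem adj_some_some (hΓ : IsAutAction N Γ) {g h : G} {x y : X} :
    (linkGraph f Γ v w t).Adj (pt f g (some x)) (pt f h (some y)) ↔
      (∃ n : N, h = g * f n ∧ Γ.Adj x (n • y)) ∨
      CrossRel v w t (pt f g (some x)) (pt f h (some y)) ∨
      CrossRel v w t (pt f h (some y)) (pt f g (some x)) := by
  have key : ∀ {g h : G} {x y : X}, LinkRel Γ v w t (pt f g (some x)) (pt f h (some y)) →
      (∃ n : N, h = g * f n ∧ Γ.Adj x (n • y)) ∨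
      CrossRel v w t (pt f g (some x)) (pt f h (some y)) := by
    rintro g h x y (⟨a, x', y', H, h₁, h₂⟩ | ⟨a, y', h₁, -⟩ | ⟨a, b, h₁, -⟩ | H)
    · obtain ⟨n, rfl, rfl⟩ := mk_some_eq.1 h₁
      obtain ⟨m, h₃, rfl⟩ := mk_some_eq.1 h₂
      left
      refine ⟨n * m⁻¹, ?_, ?_⟩
      · rw [map_mul, ← mul_assoc, h₃, map_inv, mul_inv_cancel_right]
      · rw [mul_smul, inv_smul_smul]
        exact hΓ.adj n H
    · exact absurd h₁.symm mk_none_ne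
    · exact absurd h₁.symm mk_none_ne
    · exact Or.inr H
  rw [linkGraph, SimpleGraph.fromRel_adj]
  constructor
  · rintro ⟨-, H | H⟩
    · exact (key H).imp_right Or.inl
    · rcases key H with ⟨n, rfl, H'⟩ | H
      · left
        refine ⟨n⁻¹, by simp, ?_⟩
        have := hΓ.adj n⁻¹ H'
        rw [inv_smul_smul] at this
        exact this.symm
      · exact Or.inr (Or.inr H)
  · rintro (⟨n, rfl, H⟩ | H | H)
    · rw [mk_mul, Option.smul_some]
      refine ⟨fun e => H.ne ?_, Or.inl (Or.inl ⟨g, x, _, H, rfl, rfl⟩)⟩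
      simpa using (mk_inj hf).1 e
    · exact ⟨H.ne ht, Or.inl (Or.inr (Or.inr (Or.inr H)))⟩
    · exact ⟨(H.ne ht).symm, Or.inr (Or.inr (Or.inr (Or.inr H)))⟩

include hf ht in
theorem neighborSet_subset (hΓ : IsAutAction N Γ) (g : G) (x : X) :
    (linkGraph f Γ v w t).neighborSet (pt f g (some x)) ⊆
      (insert (pt f g none) ((fun y => pt f g (some y)) '' Γ.neighborSet x)) ∪
      {z | CrossRel v w t (pt f g (some x)) z ∨ CrossRel v w t z (pt f g (some x))} := by
  intro z hz
  rw [SimpleGraph.mem_neighborSet] at hz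
  obtain ⟨h, y, rfl⟩ := exists_mk z
  cases y with
  | none => exact Or.inl (Or.inl (adj_none_some.1 hz.symm))
  | some y =>
    rcases (adj_some_some hf ht hΓ).1 hz with ⟨n, rfl, H⟩ | H
    · refine Or.inl (Or.inr ⟨n • y, H, ?_⟩)
      rw [mk_mul, Option.smul_some]
    · exact Or.inr H

include hf ht in
theorem ncard_neighborSet_le [Finite X] [Finite G] (hΓ : IsAutAction N Γ) (g : G) (x : X) (k : ℕ)
    (S : Set (Induced f X)) (hS : S.ncard + ((Γ.neighborSet x).ncard + 1) ≤ k)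
    (hsub : ∀ z, CrossRel v w t (pt f g (some x)) z ∨ CrossRel v w t z (pt f g (some x)) →
      z ∈ S) :
    ((linkGraph f Γ v w t).neighborSet (pt f g (some x))).ncard ≤ k := by
  refine (Set.ncard_le_ncard (neighborSet_subset hf ht hΓ g x)).trans ?_
  refine (Set.ncard_union_le _ _).trans ?_
  have h₁ := Set.ncard_insert_le (pt f g none) ((fun y => pt f g (some y)) '' Γ.neighborSet x)
  have h₂ := Set.ncard_image_le (f := fun y => pt f g (some y)) (Γ.neighborSet x).toFinite
  have h₃ := Set.ncard_le_ncard (s := {z | CrossRel v w t (pt f g (some x)) z ∨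
    CrossRel v w t z (pt f g (some x))}) (t := S) hsub
  omega

end Induced

open Induced

namespace IsGoodPair

variable {N G : Type*} [Group N] [Group G] {f : N →* G} {X : Type*} [MulAction N X]
  {K : Subgroup N} {Γ : SimpleGraph X} {v w : X} {t : G} (H : IsGoodPair K Γ v w)
  (hf : Function.Injective f) (ht : t ∉ f.range)

include H in
theorem mk_v_inj {g h : G} : pt f g (some v) = pt f h (some v) ↔ g = h := by
  refine ⟨fun e => ?_, fun e => e ▸ rfl⟩
  obtain ⟨n, rfl, h₂⟩ := mk_some_eq.1 e
  rw [H.stab_v n h₂.symm, map_one, mul_one]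

include H in
theorem mk_v_ne_w {g h : G} : pt f g (some v) ≠ pt f h (some w) := by
  intro e
  obtain ⟨n, -, h₂⟩ := mk_some_eq.1 e.symm
  exact H.ne_w n h₂.symm

include H in
theorem mk_w_eq {g h : G} : pt f g (some w) = pt f h (some w) ↔ ∃ n ∈ K, h = g * f n := by
  rw [mk_some_eq]
  exact exists_congr fun n => ⟨fun h => ⟨(H.stab_w n).1 h.2.symm, h.1⟩,
    fun h => ⟨h.2, ((H.stab_w n).2 h.1).symm⟩⟩

variable [Finite G] [Finite X]

include H hf ht in
theorem degree_v (g : G) :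
    ((linkGraph f Γ v w t).neighborSet (pt f g (some v))).ncard ≤ Nat.card X := by
  refine ncard_neighborSet_le hf ht H.isAut g v _
    {pt f (g * t) (some v), pt f (g * t⁻¹) (some v), pt f (g * t) (some w)} ?_ ?_
  · have h₁ := H.nbrs_v
    have h₂ := Set.ncard_insert_le (pt f (g * t) (some v))
      {pt f (g * t⁻¹) (some v), pt f (g * t) (some w)}
    have h₃ := Set.ncard_insert_le (pt f (g * t⁻¹) (some v)) {pt f (g * t) (some w)}
    have h₄ := Set.ncard_singleton (pt f (g * t) (some w))
    omega
  · rintro z (⟨a, h₁, h₂⟩ | ⟨a, rfl, h₂⟩)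
    · obtain rfl := H.mk_v_inj.1 h₁
      rcases h₂ with rfl | rfl <;> simp
    · rcases h₂ with h₂ | h₂
      · rw [H.mk_v_inj.1 h₂]
        simp
      · exact absurd h₂ H.mk_v_ne_w

include H hf ht in
theorem degree_w [Finite N] (g : G) :
    ((linkGraph f Γ v w t).neighborSet (pt f g (some w))).ncard ≤ Nat.card X := by
  refine ncard_neighborSet_le hf ht H.isAut g w _
    ((fun n => pt f (g * f n * t⁻¹) (some v)) '' (K : Set N)) ?_ ?_
  · have h₁ := H.nbrs_w
    have h₂ := Set.ncard_image_le (f := fun n => pt f (g * f n * t⁻¹) (some v))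
      (K : Set N).toFinite
    have h₃ : (K : Set N).ncard = Nat.card K := rfl
    omega
  · rintro z (⟨a, h₁, h₂⟩ | ⟨a, rfl, h₂⟩)
    · exact absurd h₁.symm H.mk_v_ne_w
    · rcases h₂ with h₂ | h₂
      · exact absurd h₂.symm H.mk_v_ne_w
      · obtain ⟨n, hn, h⟩ := H.mk_w_eq.1 h₂
        exact ⟨n, hn, by simp [← h]⟩

include H hf ht in
theorem degree_some [Finite N] (g : G) (x : X) :
    ((linkGraph f Γ v w t).neighborSet (pt f g (some x))).ncard ≤ Nat.card X := by
  by_cases hv : ∃ n : N, n • v = x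
  · obtain ⟨n, rfl⟩ := hv
    have := H.degree_v hf ht (g * f n)
    rwa [mk_mul, Option.smul_some] at this
  by_cases hw : ∃ n : N, n • w = x
  · obtain ⟨n, rfl⟩ := hw
    have := H.degree_w hf ht (g * f n)
    rwa [mk_mul, Option.smul_some] at this
  refine ncard_neighborSet_le hf ht H.isAut g x _ ∅ ?_ ?_
  · have : (Γ.neighborSet x).ncard < Nat.card X := by
      refine Set.ncard_lt_card fun e => ?_
      have : x ∈ Γ.neighborSet x := by rw [e]; trivial
      exact Γ.loopless.irrefl x this
    simp
    omega
  · rintro z (⟨a, h₁, h₂⟩ | ⟨a, rfl, h₂ | h₂⟩)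
    · obtain ⟨n, -, h₃⟩ := mk_some_eq.1 h₁
      exact hv ⟨n, h₃.symm⟩
    · obtain ⟨n, -, h₃⟩ := mk_some_eq.1 h₂
      exact hv ⟨n, h₃.symm⟩
    · obtain ⟨n, -, h₃⟩ := mk_some_eq.1 h₂
      exact hw ⟨n, h₃.symm⟩

include hf ht in
omit H in
theorem degree_none (g : G) :
    Nat.card X < ((linkGraph f Γ v w t).neighborSet (pt f g none)).ncard := by
  have hsub : insert (pt f (g * t) none) (Set.range fun x : X => pt f g (some x)) ⊆
      (linkGraph f Γ v w t).neighborSet (pt f g none) := by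
    rintro z (rfl | ⟨x, rfl⟩)
    · refine adj_none_none.2 fun e => ?_
      obtain ⟨n, hn⟩ := mk_none_eq.1 e
      exact ht ⟨n, (mul_left_cancel hn).symm⟩
    · exact adj_none_some.2 rfl
  refine lt_of_lt_of_le ?_ (Set.ncard_le_ncard hsub)
  rw [Set.ncard_insert_of_notMem]
  · rw [← Set.image_univ, Set.ncard_image_of_injective, Set.ncard_univ]
    · exact Nat.lt_succ_self _
    · intro x y e
      simpa using (mk_inj hf).1 e
  · rintro ⟨x, hx⟩
    exact mk_none_ne hx.symm

end IsGoodPair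

open Induced

namespace IsGoodPair

variable {N G : Type*} [Group N] [Group G] {f : N →* G} {X : Type*} [MulAction N X]
  {K : Subgroup N} {Γ : SimpleGraph X} {v w : X} {t : G} (H : IsGoodPair K Γ v w)
  (hf : Function.Injective f) (ht : t ∉ f.range) [Finite G] [Finite X] [Finite N]

include H hf ht in
theorem exists_copy (φ : linkGraph f Γ v w t ≃g linkGraph f Γ v w t) (g : G) :
    ∃ g' : G, ∀ x, φ (pt f g x) = pt f g' x := by
  have hdeg : ∀ y, ((linkGraph f Γ v w t).neighborSet (φ y)).ncard =
      ((linkGraph f Γ v w t).neighborSet y).ncard := fun y => by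
    rw [← Set.ncard_image_of_injective ((linkGraph f Γ v w t).neighborSet y) φ.injective]
    congr 1
    ext z
    obtain ⟨z, rfl⟩ := φ.surjective z
    rw [SimpleGraph.mem_neighborSet, φ.map_adj_iff]
    exact ⟨fun h => ⟨z, h, rfl⟩, fun ⟨z', h, e⟩ => φ.injective e ▸ h⟩
  obtain ⟨h, x₀, hx₀⟩ := exists_mk (φ (pt f g none))
  have hnone : φ (pt f g none) = pt f h none := by
    cases x₀ with
    | none => exact hx₀
    | some x =>
      have h₁ := H.degree_some hf ht h x
      have h₂ := degree_none (Γ := Γ) (v := v) (w := w) hf ht g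
      rw [← hdeg, hx₀] at h₂
      omega
  have hsome : ∀ x : X, ∃ y : X, φ (pt f g (some x)) = pt f h (some y) := by
    intro x
    have hadj : (linkGraph f Γ v w t).Adj (pt f h none) (φ (pt f g (some x))) := by
      rw [← hnone, φ.map_adj_iff]
      exact adj_none_some.2 rfl
    obtain ⟨a, y, hy⟩ := exists_mk (φ (pt f g (some x)))
    cases y with
    | none =>
      have h₁ := H.degree_some hf ht g x
      have h₂ := degree_none (Γ := Γ) (v := v) (w := w) hf ht a
      rw [← hdeg, hy] at h₁
      omega
    | some y =>
      rw [hy] at hadj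
      obtain ⟨n, rfl⟩ := mk_none_eq.1 (adj_none_some.1 hadj)
      exact ⟨n • y, by rw [hy, mk_mul, Option.smul_some]⟩
  choose σ hσ using hsome
  have hinj : Function.Injective σ := fun x y e => by
    have : φ (pt f g (some x)) = φ (pt f g (some y)) := by rw [hσ, hσ, e]
    simpa using (mk_inj hf).1 (φ.injective this)
  have hcopy : ∀ (a : G) (x y : X),
      (linkGraph f Γ v w t).Adj (pt f a (some x)) (pt f a (some y)) ↔ Γ.Adj x y := by
    intro a x y
    rw [adj_some_some hf ht H.isAut]
    have hno : ∀ x y, ¬ CrossRel v w t (pt f a (some x)) (pt f a (some y)) := by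
      rintro x y ⟨b, h₁, h₂⟩
      obtain ⟨n, rfl, -⟩ := mk_some_eq.1 h₁
      rcases h₂ with h₂ | h₂ <;>
      · obtain ⟨m, h₃, -⟩ := mk_some_eq.1 h₂
        rw [mul_assoc] at h₃
        refine ht ⟨n⁻¹ * m, ?_⟩
        rw [map_mul, map_inv, ← mul_left_cancel h₃, inv_mul_cancel_left]
    constructor
    · rintro (⟨n, h₁, h₂⟩ | h | h)
      · have : f n = 1 := by simpa using h₁
        rw [(injective_iff_map_eq_one f).1 hf n this, one_smul] at h₂
        exact h₂
      · exact absurd h (hno _ _)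
      · exact absurd h (hno _ _)
    · intro h
      exact Or.inl ⟨1, by simp, by simpa using h⟩
  obtain ⟨n, hn⟩ := H.isAut.surj ⟨Equiv.ofBijective σ (Finite.injective_iff_bijective.1 hinj),
    fun {x y} => by
      change Γ.Adj (σ x) (σ y) ↔ _
      rw [← hcopy h, ← hσ, ← hσ, φ.map_adj_iff, hcopy]⟩
  replace hn : ∀ x, σ x = n • x := hn
  refine ⟨h * f n, fun x => ?_⟩
  rw [mk_mul]
  cases x with
  | none => rw [hnone, Option.smul_none]
  | some x => rw [hσ, hn, Option.smul_some]

include H hf ht in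
theorem isAutAction_linkGraph (hgen : f.range ⊔ Subgroup.zpowers t = ⊤)
    (hK : t * t ∈ K.map f → t * t = 1) : IsAutAction G (linkGraph f Γ v w t) := by
  refine ⟨fun g x y h => linkGraph_smul h g, fun g hg => ?_, fun φ => ?_⟩
  · have := hg (pt f 1 (some v))
    rw [smul_mk, H.mk_v_inj] at this
    simpa using this
  choose F hF using H.exists_copy hf ht φ
  have hFinj : Function.Injective F := fun a b e => by
    have : φ (pt f a (some v)) = φ (pt f b (some v)) := by rw [hF, hF, e]
    exact H.mk_v_inj.1 (φ.injective this)
  have hFN : ∀ g n, F (g * f n) = F g * f n := by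
    intro g n
    rw [← H.mk_v_inj (f := f), ← hF, mk_mul, hF, mk_mul]
  have hFt : ∀ g, F (g * t) = F g * t := by
    intro g
    have hnr : ∀ n, F (g * t) ≠ F g * f n := fun n e => by
      rw [← hFN] at e
      exact ht ⟨n, (mul_left_cancel (hFinj e)).symm⟩
    have hw : (linkGraph f Γ v w t).Adj (pt f (F g) (some v)) (pt f (F (g * t)) (some w)) := by
      rw [← hF, ← hF, φ.map_adj_iff, adj_some_some hf ht H.isAut]
      exact Or.inr (Or.inl ⟨g, rfl, Or.inr rfl⟩)
    have hv : (linkGraph f Γ v w t).Adj (pt f (F g) (some v)) (pt f (F (g * t)) (some v)) := by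
      rw [← hF, ← hF, φ.map_adj_iff, adj_some_some hf ht H.isAut]
      exact Or.inr (Or.inl ⟨g, rfl, Or.inl rfl⟩)
    rw [adj_some_some hf ht H.isAut] at hw hv
    obtain ⟨k, hk, h₁⟩ : ∃ k ∈ K, F g * t = F (g * t) * f k := by
      rcases hw with ⟨n, h₁, -⟩ | ⟨a, h₁, h₂⟩ | ⟨a, h₁, -⟩
      · exact absurd h₁ (hnr n)
      · obtain rfl := H.mk_v_inj.1 h₁
        rcases h₂ with h₂ | h₂
        · exact absurd h₂.symm H.mk_v_ne_w
        · exact H.mk_w_eq.1 h₂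
      · exact absurd h₁.symm H.mk_v_ne_w
    rcases hv with ⟨n, h₂, -⟩ | ⟨a, h₂, h₃⟩ | ⟨a, h₂, h₃⟩
    · exact absurd h₂ (hnr n)
    · obtain rfl := H.mk_v_inj.1 h₂
      rcases h₃ with h₃ | h₃
      · exact H.mk_v_inj.1 h₃
      · exact absurd h₃ H.mk_v_ne_w
    · obtain rfl := H.mk_v_inj.1 h₂
      rcases h₃ with h₃ | h₃
      · have h₄ := H.mk_v_inj.1 h₃
        rw [h₄, mul_assoc] at h₁
        have h₅ : t * t = f k := mul_left_cancel h₁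
        have h₆ := hK ⟨k, hk, h₅.symm⟩
        rw [h₄, mul_assoc, h₆, mul_one]
      · exact absurd h₃ H.mk_v_ne_w
  let S : Subgroup G :=
    { carrier := {h | ∀ g, F (g * h) = F g * h}
      one_mem' := fun g => by simp
      mul_mem' := fun {a b} ha hb g => by
        rw [← mul_assoc, hb, ha, mul_assoc]
      inv_mem' := fun {a} ha g => by
        have := ha (g * a⁻¹)
        rw [inv_mul_cancel_right] at this
        rw [this, mul_inv_cancel_right] }
  have hS : S = ⊤ := by
    rw [eq_top_iff, ← hgen, sup_le_iff, Subgroup.zpowers_le]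
    refine ⟨?_, hFt⟩
    rintro _ ⟨n, rfl⟩ g
    exact hFN g n
  have hF1 : ∀ h, F h = F 1 * h := fun h => by
    have : h ∈ S := by rw [hS]; trivial
    simpa using this 1
  refine ⟨F 1, fun y => ?_⟩
  obtain ⟨g, x, rfl⟩ := exists_mk y
  rw [hF, hF1, smul_mk]

include H hf ht in
theorem isGoodPair_linkGraph (hgen : f.range ⊔ Subgroup.zpowers t = ⊤)
    (hK : t * t ∈ K.map f → t * t = 1) :
    IsGoodPair (K.map f) (linkGraph f Γ v w t) (pt f 1 (some v)) (pt f 1 (some w)) := by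
  have hlow : 2 * (Nat.card X + 1) ≤ Nat.card (Induced f X) := by
    let j : Bool × Option X → Induced f X := fun a => pt f (if a.1 then t else 1) a.2
    have hj : Function.Injective j := by
      rintro ⟨a, x⟩ ⟨b, y⟩ e
      obtain ⟨n, h, -⟩ := mk_eq.1 e
      have hab : a = b := by
        cases a <;> cases b <;> simp at h ⊢
        · exact ht ⟨n, h.symm⟩
        · refine ht ⟨n⁻¹, ?_⟩
          rw [map_inv, eq_comm]
          exact eq_inv_of_mul_eq_one_left h.symm
      subst hab
      exact congrArg _ ((mk_inj hf).1 e)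
    have := Nat.card_le_card_of_injective j hj
    rw [Nat.card_prod, Finite.card_option] at this
    simpa using this
  have hup : Nat.card (Induced f X) ≤ f.range.index * (Nat.card X + 1) := by
    let j : (G ⧸ f.range) × Option X → Induced f X := fun a => pt f a.1.out a.2
    have hj : Function.Surjective j := by
      intro y
      obtain ⟨g, x, rfl⟩ := exists_mk y
      obtain ⟨⟨_, n, rfl⟩, hn⟩ := QuotientGroup.mk_out_eq_mul f.range g
      refine ⟨(g, n⁻¹ • x), ?_⟩
      change pt f _ _ = _
      rw [hn, mk_mul, smul_inv_smul]
    have := Nat.card_le_card_of_surjective j hj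
    rwa [Nat.card_prod, Finite.card_option] at this
  have hcard : f.range.index * Nat.card N = Nat.card G := by
    rw [← f.range.card_mul_index, mul_comm]
    congr 1
    exact Nat.card_congr (MonoidHom.ofInjective hf).toEquiv
  have hindex : 2 ≤ f.range.index := by
    have h0 : f.range.index ≠ 0 := Subgroup.index_ne_zero_of_finite
    have h1 : f.range.index ≠ 1 := fun h => ht (by
      rw [Subgroup.index_eq_one.1 h]; trivial)
    omega
  have hv := H.nbrs_v
  have hw := H.nbrs_w
  refine ⟨H.isAutAction_linkGraph hf ht hgen hK, fun g hg => ?_, fun g => ?_, fun g => ?_, ?_, ?_,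
    ?_⟩
  · rw [smul_mk, H.mk_v_inj] at hg
    simpa using hg
  · rw [smul_mk, eq_comm, H.mk_w_eq]
    simp [eq_comm]
  · rw [smul_mk]
    exact H.mk_v_ne_w
  · have := H.card_le
    nlinarith
  · have := H.degree_v hf ht 1
    omega
  · have := H.degree_w hf ht 1
    have hk : Nat.card (K.map f) = Nat.card K :=
      (Nat.card_congr (K.equivMapOfInjective f hf).toEquiv).symm
    omega

end IsGoodPair

theorem Good.extend {N G : Type*} [Group N] [Group G] [Finite G] {f : N →* G}
    {K : Subgroup N} (H : Good K) (hf : Function.Injective f) {t : G} (ht : t ∉ f.range)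
    (hgen : f.range ⊔ Subgroup.zpowers t = ⊤) (hK : t * t ∈ K.map f → t * t = 1) :
    Good (K.map f) := by
  obtain ⟨n, act, Γ, v, w, h⟩ := H
  have := Finite.of_injective f hf
  exact (h.isGoodPair_linkGraph hf ht hgen hK).good

theorem Good.realizable_of_chain {G : Type*} [Group G] [Finite G] {K : Subgroup G}
    (hstep : ∀ M : Subgroup G, K ≤ M → M ≠ ⊤ → ∃ t ∉ M, t * t ∈ K → t * t = 1)
    (M : Subgroup G) (hKM : K ≤ M) (hM : Good (K.subgroupOf M)) :
    ∃ m < 2 * Nat.card G, Realizable G m := by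
  induction M using WellFoundedGT.induction with
  | ind M ih =>
  by_cases htop : M = ⊤
  · subst htop
    obtain ⟨m, hm, h⟩ := hM.realizable
    refine ⟨m, ?_, h.congr Subgroup.topEquiv⟩
    rwa [Nat.card_congr Subgroup.topEquiv.toEquiv] at hm
  · obtain ⟨t, ht, htK⟩ := hstep M hKM htop
    have hle : M ≤ M ⊔ Subgroup.zpowers t := le_sup_left
    have htm : t ∈ M ⊔ Subgroup.zpowers t :=
      (le_sup_right : _ ≤ M ⊔ Subgroup.zpowers t) (Subgroup.mem_zpowers t)
    have hmap : (K.subgroupOf M).map (Subgroup.inclusion hle) =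
        K.subgroupOf (M ⊔ Subgroup.zpowers t) := by
      ext ⟨x, hx⟩
      constructor
      · rintro ⟨y, hy, h⟩
        rw [← h]
        exact hy
      · intro h
        exact ⟨⟨x, hKM h⟩, h, rfl⟩
    refine ih (M ⊔ Subgroup.zpowers t) (lt_of_le_of_ne hle fun e => ht (e ▸ htm))
      (hKM.trans hle) ?_
    rw [← hmap]
    refine hM.extend (t := ⟨t, htm⟩) (Subgroup.inclusion_injective hle) ?_ ?_ ?_
    · rintro ⟨y, hy⟩
      have hy : (y : G) = t := congrArg Subtype.val hy
      exact ht (hy ▸ y.2)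
    · rw [eq_top_iff]
      intro x _
      have h : M ⊔ Subgroup.zpowers t ≤ (Subgroup.map (Subgroup.subtype _)
          ((Subgroup.inclusion hle).range ⊔ Subgroup.zpowers ⟨t, htm⟩)) := by
        refine sup_le (fun y hy => ?_) ((Subgroup.zpowers_le).2 ?_)
        · exact ⟨⟨y, hle hy⟩, Subgroup.mem_sup_left ⟨⟨y, hy⟩, rfl⟩, rfl⟩
        · exact ⟨⟨t, htm⟩, Subgroup.mem_sup_right (Subgroup.mem_zpowers _), rfl⟩
      obtain ⟨y, hy, e⟩ := h x.2
      rwa [← Subtype.ext e]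
    · rw [hmap]
      intro h
      exact Subtype.ext (htK h)

theorem Good.realizable_of_odd {G : Type*} [Group G] [Finite G] {K : Subgroup G}
    (hK : Odd (Nat.card K)) (M : Subgroup G) (hKM : K ≤ M) (hM : Good (K.subgroupOf M)) :
    ∃ m < 2 * Nat.card G, Realizable G m := by
  refine hM.realizable_of_chain (fun M' hM' htop => ?_) M hKM
  obtain ⟨t, ht⟩ : ∃ t, t ∉ M' := by
    by_contra! h
    exact htop (Subgroup.ext fun x => by simp [h x])
  by_cases htK : t * t ∈ K
  · obtain ⟨j, hj⟩ := hK
    have hpow : (t * t) ^ Nat.card K = 1 := by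
      have := pow_card_eq_one' (x := (⟨t * t, htK⟩ : K))
      exact congrArg Subtype.val this
    refine ⟨t ^ Nat.card K, fun h => ht ?_, fun _ => ?_⟩
    · rw [hj, pow_succ, pow_mul, pow_two] at h
      exact (Subgroup.mul_mem_cancel_left M' (M'.pow_mem (hM' htK) j)).1 h
    · rw [← hpow, ← pow_add, ← two_mul, pow_mul, pow_two]
  · exact ⟨t, ht, fun h => absurd h htK⟩

theorem Good.realizable_of_involution {G : Type*} [Group G] [Finite G] {s : G} (hs : s * s = 1)
    (hE : Subgroup.closure {t : G | t * t ≠ s} = ⊤) (M : Subgroup G) (hKM : s ∈ M)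
    (hM : Good ((Subgroup.zpowers s).subgroupOf M)) :
    ∃ m < 2 * Nat.card G, Realizable G m := by
  refine hM.realizable_of_chain (fun M' hM' htop => ?_) M ((Subgroup.zpowers_le).2 hKM)
  by_contra! h
  refine htop (eq_top_iff.2 (hE ▸ (Subgroup.closure_le _).2 fun t ht => ?_))
  by_contra htM
  obtain ⟨⟨k, hk⟩, h1⟩ := h t htM
  have hk : s ^ k = t * t := hk
  rcases Int.even_or_odd' k with ⟨j, rfl | rfl⟩
  · rw [zpow_mul, zpow_two, hs, one_zpow] at hk
    exact h1 hk.symm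
  · rw [zpow_add, zpow_mul, zpow_two, hs, one_zpow, one_mul, zpow_one] at hk
    exact ht hk.symm

section ThreeLayer

variable {M : Type*} [Group M] (K : Subgroup M) (t w : M)

/-- Adjacency of the three-layer graph on `M` and two copies of `M ⧸ K`. -/
def threeLayerAdj : M ⊕ (M ⧸ K) ⊕ (M ⧸ K) → M ⊕ (M ⧸ K) ⊕ (M ⧸ K) → Prop
  | .inl a, .inl b => a ≠ b ∧ (a * t = b ∨ b * t = a)
  | .inl a, .inr (.inl q) => (a : M ⧸ K) = q
  | .inl a, .inr (.inr q) => ((a * w : M) : M ⧸ K) = q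
  | .inr (.inl q), .inl a => (a : M ⧸ K) = q
  | .inr (.inr q), .inl a => ((a * w : M) : M ⧸ K) = q
  | .inr (.inl q), .inr (.inl q') => q ≠ q'
  | .inr (.inl q), .inr (.inr q') => q ≠ q'
  | .inr (.inr q), .inr (.inl q') => q ≠ q'
  | .inr (.inr _), .inr (.inr _) => False

/-- The three-layer graph: a Cayley graph of `M`, a complete graph on `M ⧸ K`, and an independent
set `M ⧸ K`. -/
def threeLayer : SimpleGraph (M ⊕ (M ⧸ K) ⊕ (M ⧸ K)) where
  Adj := threeLayerAdj K t w
  symm := ⟨by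
    rintro (a | q | q) (b | q' | q') <;> simp only [threeLayerAdj] <;> tauto⟩
  loopless := ⟨by rintro (a | q | q) <;> simp [threeLayerAdj]⟩

/-- A coset-preserving map compatible with right multiplication by `w` (modulo `K`) and by `t`
(up to inversion) is a left translation. -/
def IsRigid : Prop :=
  ∀ f : M → M, Function.Injective f → (∀ x, ∀ k ∈ K, (f x)⁻¹ * f (x * k) ∈ K) →
    (∀ x, (f x * w)⁻¹ * f (x * w) ∈ K) → (∀ x, f x * t = f (x * t) ∨ f (x * t) * t = f x) →
    ∀ a, f a = f 1 * a

variable {K t w}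

theorem ncard_layer_union [Finite M] (g u : M) (q : M ⧸ K)
    (h : M ⧸ K → (M ⧸ K) ⊕ (M ⧸ K)) (hh : Function.Injective h) :
    (((fun k => (Sum.inl (g * k * u) : M ⊕ (M ⧸ K) ⊕ (M ⧸ K))) '' (K : Set M)) ∪
      ((fun q' => (Sum.inr (h q') : M ⊕ (M ⧸ K) ⊕ (M ⧸ K))) '' {q}ᶜ)).ncard =
      Nat.card K + (K.index - 1) := by
  rw [Set.ncard_union_eq, Set.ncard_image_of_injective, Set.ncard_image_of_injective,
    Set.ncard_compl, Set.ncard_singleton]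
  · rfl
  · exact Sum.inr_injective.comp hh
  · intro a b e
    simpa using e
  · rw [Set.disjoint_left]
    rintro _ ⟨k, -, rfl⟩ ⟨q', -, e⟩
    simp at e

theorem neighborSet_inl_subset (a : M) : (threeLayer K t w).neighborSet (.inl a) ⊆
    {.inl (a * t), .inl (a * t⁻¹), .inr (.inl (a : M ⧸ K)), .inr (.inr ((a * w : M) : M ⧸ K))} := by
  rintro (b | q | q) h
  · rcases h with ⟨-, rfl | rfl⟩ <;> simp
  · rw [← show (a : M ⧸ K) = q from h]; simp
  · rw [← show ((a * w : M) : M ⧸ K) = q from h]; simp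

theorem ncard_neighborSet_inl [Finite M] (a : M) :
    ((threeLayer K t w).neighborSet (.inl a)).ncard ≤ 4 := by
  refine (Set.ncard_le_ncard (neighborSet_inl_subset a)).trans ?_
  refine (Set.ncard_insert_le _ _).trans (Nat.succ_le_succ ?_)
  refine (Set.ncard_insert_le _ _).trans (Nat.succ_le_succ ?_)
  refine (Set.ncard_insert_le _ _).trans (Nat.succ_le_succ ?_)
  exact (Set.ncard_singleton _).le

theorem ncard_neighborSet_inr_inl [Finite M] (q : M ⧸ K) :
    Nat.card K + (K.index - 1) ≤ ((threeLayer K t w).neighborSet (.inr (.inl q))).ncard := by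
  obtain ⟨g, rfl⟩ := QuotientGroup.mk_surjective q
  rw [← ncard_layer_union g 1 (g : M ⧸ K) Sum.inl Sum.inl_injective]
  refine Set.ncard_le_ncard ?_
  rintro _ (⟨k, hk, rfl⟩ | ⟨q', hq', rfl⟩)
  · change ((g * k * 1 : M) : M ⧸ K) = g
    rw [mul_one, QuotientGroup.mk_mul_of_mem g hk]
  · exact Ne.symm hq'

theorem neighborSet_inr_inr [Finite M] (g : M) :
    (threeLayer K t w).neighborSet (.inr (.inr (g : M ⧸ K))) =
    ((fun k => (Sum.inl (g * k * w⁻¹) : M ⊕ (M ⧸ K) ⊕ (M ⧸ K))) '' (K : Set M)) ∪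
      ((fun q' => (Sum.inr (Sum.inl q') : M ⊕ (M ⧸ K) ⊕ (M ⧸ K))) '' {(g : M ⧸ K)}ᶜ) := by
  ext (a | q | q)
  · change ((a * w : M) : M ⧸ K) = g ↔ _
    rw [eq_comm, QuotientGroup.eq]
    constructor
    · intro h
      exact Or.inl ⟨_, h, by simp⟩
    · rintro (⟨k, hk, e⟩ | ⟨q', -, e⟩)
      · rw [← Sum.inl_injective e]
        simpa using hk
      · simp at e
  · change (g : M ⧸ K) ≠ q ↔ _
    simp [eq_comm]
  · change False ↔ _
    simp

theorem ncard_neighborSet_inr_inr [Finite M] (q : M ⧸ K) :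
    ((threeLayer K t w).neighborSet (.inr (.inr q))).ncard = Nat.card K + (K.index - 1) := by
  obtain ⟨g, rfl⟩ := QuotientGroup.mk_surjective q
  rw [neighborSet_inr_inr, ncard_layer_union g w⁻¹ (g : M ⧸ K) Sum.inl Sum.inl_injective]

theorem SimpleGraph.Iso.ncard_neighborSet {V : Type*} {Γ : SimpleGraph V} (φ : Γ ≃g Γ) (y : V) :
    (Γ.neighborSet (φ y)).ncard = (Γ.neighborSet y).ncard := by
  rw [← Set.ncard_image_of_injective (Γ.neighborSet y) φ.injective]
  congr 1
  ext z
  obtain ⟨z, rfl⟩ := φ.surjective z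
  rw [SimpleGraph.mem_neighborSet, φ.map_adj_iff]
  exact ⟨fun h => ⟨z, h, rfl⟩, fun ⟨z', h, e⟩ => φ.injective e ▸ h⟩

theorem isAutAction_threeLayer [Finite M] (hrig : IsRigid K t w) (ht : t ≠ 1)
    (hindex : 2 ≤ K.index) (hcard : 6 ≤ Nat.card K + K.index) :
    IsAutAction M (threeLayer K t w) := by
  refine ⟨?_, ?_, fun φ => ?_⟩
  · rintro g (a | q | q) (b | q' | q') h
    · refine ⟨fun e => h.1 (mul_left_cancel e), h.2.imp (fun e => ?_) (fun e => ?_)⟩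
      · rw [← e]; exact mul_assoc _ _ _
      · rw [← e]; exact mul_assoc _ _ _
    · rw [← show (a : M ⧸ K) = q' from h]; rfl
    · rw [← show ((a * w : M) : M ⧸ K) = q' from h]
      exact congrArg _ (mul_assoc _ _ _)
    · rw [← show (b : M ⧸ K) = q from h]; rfl
    · exact fun e => h (MulAction.injective g e)
    · exact fun e => h (MulAction.injective g e)
    · rw [← show ((b * w : M) : M ⧸ K) = q from h]
      exact congrArg _ (mul_assoc _ _ _)
    · exact fun e => h (MulAction.injective g e)
    · exact h
  · intro g hg
    have := hg (.inl 1)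
    simpa using this
  have hA : ∀ a, ∃ b, φ (.inl a) = .inl b := by
    intro a
    have h₁ := ncard_neighborSet_inl (K := K) (t := t) (w := w) a
    rw [← φ.ncard_neighborSet] at h₁
    rcases h : φ (.inl a) with b | q | q
    · exact ⟨b, rfl⟩
    · have := ncard_neighborSet_inr_inl (K := K) (t := t) (w := w) q
      rw [h] at h₁
      omega
    · have := ncard_neighborSet_inr_inr (K := K) (t := t) (w := w) q
      rw [h] at h₁
      omega
  have hr : ∀ y, ∃ z, φ (.inr y) = .inr z := by
    intro y
    have h₁ : Nat.card K + (K.index - 1) ≤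
        ((threeLayer K t w).neighborSet (.inr y)).ncard := by
      rcases y with q | q
      · exact ncard_neighborSet_inr_inl q
      · exact (ncard_neighborSet_inr_inr q).ge
    rcases h : φ (.inr y) with b | z
    · have h₂ := ncard_neighborSet_inl (K := K) (t := t) (w := w) b
      rw [← h, φ.ncard_neighborSet] at h₂
      omega
    · exact ⟨z, rfl⟩
  choose f hf using hA
  choose ρ hρ using hr
  have hfinj : Function.Injective f := fun a b e => by
    have : φ (.inl a) = φ (.inl b) := by rw [hf, hf, e]
    simpa using this
  have hρinj : Function.Injective ρ := fun a b e => by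
    have : φ (.inr a) = φ (.inr b) := by rw [hρ, hρ, e]
    simpa using this
  have hρsurj : Function.Surjective ρ := Finite.surjective_of_injective hρinj
  have hρadj : ∀ y z, (threeLayer K t w).Adj (.inr (ρ y)) (.inr (ρ z)) ↔
      (threeLayer K t w).Adj (.inr y) (.inr z) := fun y z => by
    rw [← hρ, ← hρ, φ.map_adj_iff]
  let P (y : (M ⧸ K) ⊕ (M ⧸ K)) : Prop := ∀ z z', (threeLayer K t w).Adj (.inr y) (.inr z) →
    (threeLayer K t w).Adj (.inr y) (.inr z') → z ≠ z' →
      (threeLayer K t w).Adj (.inr z) (.inr z')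
  have hPρ : ∀ y, P (ρ y) ↔ P y := by
    intro y
    constructor
    · intro h z z' h₁ h₂ h₃
      exact (hρadj _ _).1 (h _ _ ((hρadj _ _).2 h₁) ((hρadj _ _).2 h₂) (hρinj.ne h₃))
    · intro h z z' h₁ h₂ h₃
      obtain ⟨z, rfl⟩ := hρsurj z
      obtain ⟨z', rfl⟩ := hρsurj z'
      exact (hρadj _ _).2 (h _ _ ((hρadj _ _).1 h₁) ((hρadj _ _).1 h₂) (fun e => h₃ (e ▸ rfl)))
  have hPC : ∀ q, P (.inr q) := by
    rintro q (z | z) (z' | z') h₁ h₂ h₃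
    · exact fun e => h₃ (e ▸ rfl)
    · exact absurd h₂ id
    · exact absurd h₁ id
    · exact absurd h₁ id
  have hPB : ∀ q, ¬ P (.inl q) := by
    intro q h
    have : Nontrivial (M ⧸ K) := Finite.one_lt_card_iff_nontrivial.1 hindex
    obtain ⟨q', hq'⟩ := exists_ne q
    exact h (.inl q') (.inr q') hq'.symm hq'.symm (by simp) rfl
  have hB : ∀ q, ∃ q', φ (.inr (.inl q)) = .inr (.inl q') := by
    intro q
    rcases h : ρ (.inl q) with q' | q'
    · exact ⟨q', by rw [hρ, h]⟩
    · exact absurd ((hPρ _).1 (h ▸ hPC q')) (hPB q)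
  have hC : ∀ q, ∃ q', φ (.inr (.inr q)) = .inr (.inr q') := by
    intro q
    rcases h : ρ (.inr q) with q' | q'
    · exact absurd (h ▸ (hPρ _).2 (hPC q)) (hPB q')
    · exact ⟨q', by rw [hρ, h]⟩
  choose fB hfB using hB
  choose fC hfC using hC
  have hBC : ∀ q, fC q = fB q := by
    intro q
    by_contra hne
    have h : (threeLayer K t w).Adj (φ (.inr (.inr q))) (φ (.inr (.inl q))) := by
      rw [hfC, hfB]; exact hne
    rw [φ.map_adj_iff] at h
    exact h rfl
  have hfB' : ∀ a : M, fB a = f a := by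
    intro a
    have h : (threeLayer K t w).Adj (φ (.inl a)) (φ (.inr (.inl (a : M ⧸ K)))) :=
      φ.map_adj_iff.2 rfl
    rw [hf, hfB] at h
    exact (show (f a : M ⧸ K) = _ from h).symm
  have hfC' : ∀ a : M, fC (a * w : M) = (f a * w : M) := by
    intro a
    have h : (threeLayer K t w).Adj (φ (.inl a)) (φ (.inr (.inr ((a * w : M) : M ⧸ K)))) :=
      φ.map_adj_iff.2 rfl
    rw [hf, hfC] at h
    exact (show ((f a * w : M) : M ⧸ K) = _ from h).symm
  have hmain := hrig f hfinj
    (fun x k hk => by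
      rw [← QuotientGroup.eq, ← hfB', ← hfB', QuotientGroup.mk_mul_of_mem x hk])
    (fun x => by rw [← QuotientGroup.eq, ← hfC', ← hfB', hBC])
    (fun x => by
      have h : (threeLayer K t w).Adj (φ (.inl x)) (φ (.inl (x * t))) :=
        φ.map_adj_iff.2 ⟨by simpa using ht, Or.inl rfl⟩
      rw [hf, hf] at h
      exact h.2)
  refine ⟨f 1, ?_⟩
  rintro (a | q | q)
  · rw [hf, hmain]; rfl
  · obtain ⟨a, rfl⟩ := QuotientGroup.mk_surjective q
    rw [hfB, hfB', hmain]; rfl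
  · obtain ⟨a, rfl⟩ := QuotientGroup.mk_surjective q
    rw [hfC, hBC, hfB', hmain]; rfl

theorem card_threeLayer [Finite M] :
    Nat.card (M ⊕ (M ⧸ K) ⊕ (M ⧸ K)) = Nat.card M + 2 * K.index := by
  rw [Nat.card_sum, Nat.card_sum, two_mul]
  rfl

theorem good_of_isRigid [Finite M] (hrig : IsRigid K t w) (ht : t ≠ 1)
    (hindex : 3 ≤ K.index) (hK : 3 ≤ Nat.card K) : Good K := by
  have hmul := K.card_mul_index
  refine IsGoodPair.good (Γ := threeLayer K t w) (v := .inl 1) (w := .inr (.inr (1 : M)))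
    ⟨isAutAction_threeLayer hrig ht (by omega) (by omega), ?_, ?_, ?_, ?_, ?_, ?_⟩
  · intro g hg
    simpa using hg
  · intro g
    have : g • (.inr (.inr (1 : M)) : M ⊕ (M ⧸ K) ⊕ (M ⧸ K)) =
        .inr (.inr ((g * 1 : M) : M ⧸ K)) := rfl
    rw [this, mul_one, Sum.inr.injEq, Sum.inr.injEq, eq_comm, QuotientGroup.eq]
    simp
  · intro g hg
    simp at hg
  · rw [card_threeLayer]
    nlinarith
  · rw [card_threeLayer]
    have := ncard_neighborSet_inl (K := K) (t := t) (w := w) 1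
    nlinarith
  · rw [card_threeLayer, ncard_neighborSet_inr_inr]
    have : K.index - 1 + 1 = K.index := by omega
    nlinarith

theorem realizable_of_isRigid [Finite M] (hrig : IsRigid K t w) (ht : t ≠ 1)
    (hindex : 2 ≤ K.index) (hcard : 6 ≤ Nat.card K + K.index) :
    Realizable M (Nat.card M + 2 * K.index) := by
  rw [← card_threeLayer]
  exact (isAutAction_threeLayer hrig ht hindex hcard).realizable

end ThreeLayer

theorem map_eq_mul_of_closure {M : Type*} [Group M] {S : Set M} (hS : Subgroup.closure S = ⊤)
    (f : M → M) (h : ∀ s ∈ S, ∀ x, f (x * s) = f x * s) (a : M) : f a = f 1 * a := by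
  let T : Subgroup M :=
    { carrier := {h | ∀ g, f (g * h) = f g * h}
      one_mem' := fun g => by simp
      mul_mem' := fun {a b} ha hb g => by
        rw [← mul_assoc, hb, ha, mul_assoc]
      inv_mem' := fun {a} ha g => by
        have := ha (g * a⁻¹)
        rw [inv_mul_cancel_right] at this
        rw [this, mul_inv_cancel_right] }
  have hT : T = ⊤ := by
    rw [eq_top_iff, ← hS, Subgroup.closure_le]
    exact h
  have : a ∈ T := by rw [hT]; trivial
  simpa using this 1

theorem isRigid_of_zpowers_eq_top {M : Type*} [Group M] {K : Subgroup M} {t : M}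
    (hgen : Subgroup.zpowers t = ⊤) (hK : t * t ∈ K → t * t = 1) : IsRigid K t t := by
  intro f _ _ hw ht
  refine map_eq_mul_of_closure (S := {t}) (by rw [← Subgroup.zpowers_eq_closure, hgen]) f ?_
  rintro s rfl x
  rcases ht x with h | h
  · exact h.symm
  · have h₁ := hw x
    rw [← h, mul_inv_rev, mul_inv_rev, mul_assoc, mul_assoc, inv_mul_cancel, mul_one,
      ← mul_inv_rev, inv_mem_iff] at h₁
    rw [← h, mul_assoc, hK h₁, mul_one]

theorem good_of_cyclic {M : Type*} [Group M] [Finite M] {t : M} (hgen : Subgroup.zpowers t = ⊤)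
    (K : Subgroup M) (hK : 3 ≤ Nat.card K) (hindex : 3 ≤ K.index) : Good K := by
  have hcard : orderOf t = Nat.card K * K.index := by
    rw [K.card_mul_index, ← Nat.card_zpowers, hgen, Subgroup.card_top]
  refine good_of_isRigid (isRigid_of_zpowers_eq_top hgen fun h => ?_) ?_ hindex hK
  · exfalso
    have hpow : (t * t) ^ Nat.card K = 1 :=
      congrArg Subtype.val (pow_card_eq_one' (x := (⟨t * t, h⟩ : K)))
    rw [← pow_two, ← pow_mul, mul_comm] at hpow
    have := orderOf_dvd_of_pow_eq_one hpow
    rw [hcard] at this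
    have := Nat.le_of_dvd two_pos (Nat.dvd_of_mul_dvd_mul_left (by omega) this)
    omega
  · rintro rfl
    rw [orderOf_one] at hcard
    nlinarith

theorem realizable_of_isCyclic {M : Type*} [Group M] [Finite M] [IsCyclic M]
    (h : 5 ≤ Nat.card M) : Realizable M (3 * Nat.card M) := by
  obtain ⟨t, ht⟩ := IsCyclic.exists_generator (α := M)
  have hgen : Subgroup.zpowers t = ⊤ := by
    rw [eq_top_iff]; exact fun x _ => ht x
  have hrig : IsRigid (⊥ : Subgroup M) t t :=
    isRigid_of_zpowers_eq_top hgen fun h => by simpa using h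
  have := realizable_of_isRigid hrig ?_ (by rw [Subgroup.index_bot]; omega)
    (by rw [Subgroup.index_bot, Subgroup.card_bot]; omega)
  · rw [Subgroup.index_bot] at this
    convert this using 1
    ring
  · rintro rfl
    rw [← Subgroup.card_top (G := M), ← hgen] at h
    simp at h

section Nonnormal

variable {M : Type*} [Group M] {K : Subgroup M} {t : M}

theorem mem_of_prime_card (hp : (Nat.card K).Prime) {L : Subgroup M} {x : M} (hx : x ∈ K)
    (hx1 : x ≠ 1) (hxL : x ∈ L) : K ≤ L := by
  have := Fact.mk hp
  have h2 : Subgroup.zpowers x = K := by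
    have : Finite K := Nat.finite_of_card_ne_zero hp.ne_zero
    refine Subgroup.eq_of_le_of_card_ge (Subgroup.zpowers_le.2 hx) ?_
    rw [Nat.card_zpowers, orderOf_eq_prime (p := Nat.card K) ?_ hx1]
    exact congrArg Subtype.val (pow_card_eq_one' (x := (⟨x, hx⟩ : K)))
  rw [← h2, Subgroup.zpowers_le]
  exact hxL

theorem eq_one_of_conj_mem (hp : (Nat.card K).Prime) (ht : ∃ y ∈ K, t⁻¹ * y * t ∉ K) {x : M}
    (hx : x ∈ K) (hxt : t⁻¹ * x * t ∈ K) : x = 1 := by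
  by_contra hx1
  have h : K ≤ K.map (MulAut.conj t).toMonoidHom :=
    mem_of_prime_card hp hx hx1 ⟨_, hxt, by simp [mul_assoc]⟩
  obtain ⟨y, hy, hyt⟩ := ht
  obtain ⟨z, hz, rfl⟩ := h hy
  exact hyt (by simpa [mul_assoc] using hz)

theorem exists_isRigid_of_conj_notMem (hp : (Nat.card K).Prime) (ht : ∃ y ∈ K, t⁻¹ * y * t ∉ K)
    (hgen : K ⊔ Subgroup.zpowers t = ⊤) : ∃ w, IsRigid K t w := by
  have : Finite K := Nat.finite_of_card_ne_zero hp.ne_zero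
  obtain ⟨κ, hκ, hκ1, hchoice⟩ : ∃ κ ∈ K, κ ≠ 1 ∧
      (t * t = 1 ∨ ∀ x ∈ K, (x * t)⁻¹ * t⁻¹ ∈ K → x = κ) := by
    obtain ⟨s, hs⟩ := (Subgroup.nontrivial_iff_exists_ne_one K).1
      (Finite.one_lt_card_iff_nontrivial.1 hp.one_lt)
    by_cases htt : t * t = 1
    · exact ⟨s, hs.1, hs.2, Or.inl htt⟩
    by_cases hex : ∃ x ∈ K, (x * t)⁻¹ * t⁻¹ ∈ K
    · obtain ⟨κ, hκ, h⟩ := hex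
      refine ⟨κ, hκ, ?_, Or.inr fun x hx hx' => ?_⟩
      · rintro rfl
        have htt' : t * t ∈ K := by
          rw [← inv_mem_iff]; simpa using h
        refine htt (eq_one_of_conj_mem hp ht htt' ?_)
        simpa [mul_assoc] using htt'
      · have h3 : x⁻¹ * κ = 1 := by
          refine eq_one_of_conj_mem hp ht (K.mul_mem (K.inv_mem hx) hκ) ?_
          have := K.mul_mem hx' (K.inv_mem h)
          convert this using 1
          group
        exact (inv_mul_eq_one.1 h3)
    · exact ⟨s, hs.1, hs.2, Or.inr fun x hx hx' => absurd ⟨x, hx, hx'⟩ hex⟩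
  refine ⟨κ * t, fun f hinj hK hw hft => ?_⟩
  have key : ∀ x, f (x * t) = f x * t ∧ f (x * κ⁻¹) = f x * κ⁻¹ := by
    intro x
    have h₁ := hK x κ⁻¹ (K.inv_mem hκ)
    have h₂ := hw (x * κ⁻¹)
    rw [mul_assoc, inv_mul_cancel_left] at h₂
    obtain ⟨k, hk, hk'⟩ : ∃ k ∈ K, f (x * κ⁻¹) = f x * k := ⟨_, h₁, by simp⟩
    rw [hk'] at h₂
    have good : f (x * t) = f x * t → f (x * t) = f x * t ∧ f (x * κ⁻¹) = f x * κ⁻¹ := by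
      intro h
      refine ⟨h, ?_⟩
      rw [h] at h₂
      have h3 : k * κ = 1 := by
        refine eq_one_of_conj_mem hp ht (K.mul_mem hk hκ) ?_
        rw [← inv_mem_iff]
        convert h₂ using 1
        group
      rw [hk', eq_inv_of_mul_eq_one_left h3]
    rcases hft x with h | h
    · exact good h.symm
    · rcases hchoice with htt | hc
      · refine good ?_
        rw [← h, mul_assoc, htt, mul_one]
      · exfalso
        have h3 : k * κ = κ := by
          refine hc _ (K.mul_mem hk hκ) ?_
          rw [← h] at h₂
          convert h₂ using 1
          group
        have h4 : k = 1 := by simpa using h3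
        rw [h4, mul_one] at hk'
        exact hκ1 (by simpa using hinj hk')
  refine map_eq_mul_of_closure (S := {κ⁻¹, t}) ?_ f ?_
  · rw [eq_top_iff, ← hgen, sup_le_iff, Subgroup.zpowers_le]
    refine ⟨mem_of_prime_card hp (K.inv_mem hκ) (by simpa using hκ1) ?_, ?_⟩ <;>
    exact Subgroup.subset_closure (by simp)
  · rintro s (rfl | rfl) x
    · exact (key x).2
    · exact (key x).1

theorem good_of_conj_notMem [Finite M] (hp : (Nat.card K).Prime) (h3 : 3 ≤ Nat.card K)
    (ht : ∃ y ∈ K, t⁻¹ * y * t ∉ K) (hgen : K ⊔ Subgroup.zpowers t = ⊤) : Good K := by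
  obtain ⟨w, hw⟩ := exists_isRigid_of_conj_notMem hp ht hgen
  refine good_of_isRigid hw ?_ (h3.trans ?_) h3
  · rintro rfl
    obtain ⟨y, hy, h⟩ := ht
    exact h (by simpa using hy)
  refine Nat.card_le_card_of_injective (fun κ : K => ((κ * t : M) : M ⧸ K)) fun a b e => ?_
  have h := QuotientGroup.eq.1 e
  have : (a : M)⁻¹ * b = 1 := by
    refine eq_one_of_conj_mem hp ht (K.mul_mem (K.inv_mem a.2) b.2) ?_
    convert h using 1
    group
  exact Subtype.ext (inv_mul_eq_one.1 this)

end Nonnormal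

section TwoLayer

variable {M : Type*} [Group M] (K : Subgroup M) (t : M)

/-- Adjacency of the two-layer graph on `M` and `M ⧸ K`. -/
def twoLayerAdj : M ⊕ (M ⧸ K) → M ⊕ (M ⧸ K) → Prop
  | .inl a, .inl b => a ≠ b ∧ (a * t = b ∨ b * t = a)
  | .inl a, .inr q => (a : M ⧸ K) = q
  | .inr q, .inl a => (a : M ⧸ K) = q
  | .inr q, .inr q' => q ≠ q'

/-- The two-layer graph: a Cayley graph of `M` and a complete graph on `M ⧸ K`. -/
def twoLayer : SimpleGraph (M ⊕ (M ⧸ K)) where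
  Adj := twoLayerAdj K t
  symm := ⟨by
    rintro (a | q) (b | q') <;> simp only [twoLayerAdj] <;> tauto⟩
  loopless := ⟨by rintro (a | q) <;> simp [twoLayerAdj]⟩

variable {K t}

theorem twoLayer_ncard_inl [Finite M] (htt : t * t = 1) (a : M) :
    ((twoLayer K t).neighborSet (.inl a)).ncard ≤ 2 := by
  have hsub : (twoLayer K t).neighborSet (.inl a) ⊆ {.inl (a * t), .inr (a : M ⧸ K)} := by
    rintro (b | q) h
    · rcases h with ⟨-, rfl | rfl⟩
      · simp
      · simp [mul_assoc, htt]
    · rw [← show (a : M ⧸ K) = q from h]; simp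
  refine (Set.ncard_le_ncard hsub).trans ((Set.ncard_insert_le _ _).trans (Nat.succ_le_succ ?_))
  exact (Set.ncard_singleton _).le

theorem twoLayer_ncard_inr [Finite M] (q : M ⧸ K) :
    ((twoLayer K t).neighborSet (.inr q)).ncard = Nat.card K + (K.index - 1) := by
  obtain ⟨g, rfl⟩ := QuotientGroup.mk_surjective q
  have : (twoLayer K t).neighborSet (.inr (g : M ⧸ K)) =
      ((fun k => (Sum.inl (g * k) : M ⊕ (M ⧸ K))) '' (K : Set M)) ∪ (Sum.inr '' {(g : M ⧸ K)}ᶜ) := by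
    ext (a | q)
    · change ((a : M ⧸ K)) = g ↔ _
      rw [eq_comm, QuotientGroup.eq]
      constructor
      · intro h
        exact Or.inl ⟨_, h, by simp⟩
      · rintro (⟨k, hk, e⟩ | ⟨q', -, e⟩)
        · rw [← Sum.inl_injective e]
          simpa using hk
        · simp at e
    · change (g : M ⧸ K) ≠ q ↔ _
      simp [eq_comm]
  rw [this, Set.ncard_union_eq, Set.ncard_image_of_injective, Set.ncard_image_of_injective,
    Set.ncard_compl, Set.ncard_singleton]
  · rfl
  · exact Sum.inr_injective
  · intro a b e
    simpa using e
  · rw [Set.disjoint_left]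
    rintro _ ⟨k, -, rfl⟩ ⟨q', -, e⟩
    simp at e

variable [Finite M] {s : M}

theorem isAutAction_twoLayer (hK : ∀ x, x ∈ K ↔ x = 1 ∨ x = s) (hs : s ≠ 1)
    (ht : t ≠ 1) (htt : t * t = 1) (hgen : Subgroup.closure {s, t} = ⊤) (hcard : Nat.card K = 2)
    (hindex : 2 ≤ K.index) : IsAutAction M (twoLayer K t) := by
  refine ⟨?_, ?_, fun φ => ?_⟩
  · rintro g (a | q) (b | q') h
    · refine ⟨fun e => h.1 (mul_left_cancel e), h.2.imp (fun e => ?_) (fun e => ?_)⟩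
      · rw [← e]; exact mul_assoc _ _ _
      · rw [← e]; exact mul_assoc _ _ _
    · rw [← show (a : M ⧸ K) = q' from h]; rfl
    · rw [← show (b : M ⧸ K) = q from h]; rfl
    · exact fun e => h (MulAction.injective g e)
  · intro g hg
    have := hg (.inl 1)
    simpa using this
  have hA : ∀ a, ∃ b, φ (.inl a) = .inl b := by
    intro a
    have h₁ := twoLayer_ncard_inl (K := K) htt a
    rw [← φ.ncard_neighborSet] at h₁
    rcases h : φ (.inl a) with b | q
    · exact ⟨b, rfl⟩
    · have := twoLayer_ncard_inr (t := t) q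
      rw [h] at h₁
      omega
  have hB : ∀ q, ∃ q', φ (.inr q) = .inr q' := by
    intro q
    have h₁ := twoLayer_ncard_inr (t := t) q
    rcases h : φ (.inr q) with b | z
    · have h₂ := twoLayer_ncard_inl (K := K) htt b
      rw [← h, φ.ncard_neighborSet] at h₂
      omega
    · exact ⟨z, rfl⟩
  choose f hf using hA
  choose fB hfB using hB
  have hfinj : Function.Injective f := fun a b e => by
    have : φ (.inl a) = φ (.inl b) := by rw [hf, hf, e]
    simpa using this
  have hfB' : ∀ a : M, fB a = f a := by
    intro a
    have h : (twoLayer K t).Adj (φ (.inl a)) (φ (.inr (a : M ⧸ K))) := φ.map_adj_iff.2 rfl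
    rw [hf, hfB] at h
    exact (show (f a : M ⧸ K) = _ from h).symm
  have hmain := map_eq_mul_of_closure hgen f (by
    rintro y (rfl | rfl) x
    · have h : (f x)⁻¹ * f (x * y) ∈ K := by
        rw [← QuotientGroup.eq, ← hfB', ← hfB', QuotientGroup.mk_mul_of_mem x
          ((hK y).2 (Or.inr rfl))]
      rcases (hK _).1 h with h | h
      · exact absurd (hfinj (inv_mul_eq_one.1 h)) (by simpa using hs)
      · exact inv_mul_eq_iff_eq_mul.1 h
    · have h : (twoLayer K y).Adj (φ (.inl x)) (φ (.inl (x * y))) :=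
        φ.map_adj_iff.2 ⟨by simpa using ht, Or.inl rfl⟩
      rw [hf, hf] at h
      rcases h.2 with h | h
      · exact h.symm
      · rw [← h, mul_assoc, htt, mul_one])
  refine ⟨f 1, ?_⟩
  rintro (a | q)
  · rw [hf, hmain]; rfl
  · obtain ⟨a, rfl⟩ := QuotientGroup.mk_surjective q
    rw [hfB, hfB', hmain]; rfl

theorem good_of_involutions (hK : ∀ x, x ∈ K ↔ x = 1 ∨ x = s) (hs : s ≠ 1)
    (ht : t ≠ 1) (htt : t * t = 1) (hst : s ≠ t) (hgen : Subgroup.closure {s, t} = ⊤) :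
    Good K := by
  have hcard : Nat.card K = 2 := by
    have : (K : Set M) = {1, s} := Set.ext hK
    change (K : Set M).ncard = 2
    rw [this, Set.ncard_pair hs.symm]
  have hindex : 2 ≤ K.index := by
    have h0 : K.index ≠ 0 := Subgroup.index_ne_zero_of_finite
    have h1 : K.index ≠ 1 := fun h => by
      have : t ∈ K := by rw [Subgroup.index_eq_one.1 h]; trivial
      rcases (hK t).1 this with h | h
      · exact ht h
      · exact hst h.symm
    omega
  have hmul := K.card_mul_index
  have hc : Nat.card (M ⊕ (M ⧸ K)) = Nat.card M + K.index := Nat.card_sum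
  refine IsGoodPair.good (Γ := twoLayer K t) (v := .inl 1) (w := .inr (1 : M))
    ⟨isAutAction_twoLayer hK hs ht htt hgen hcard hindex, ?_, ?_, ?_, ?_, ?_, ?_⟩
  · intro g hg
    simpa using hg
  · intro g
    have : g • (.inr (1 : M) : M ⊕ (M ⧸ K)) = .inr ((g * 1 : M) : M ⧸ K) := rfl
    rw [this, mul_one, Sum.inr.injEq, eq_comm, QuotientGroup.eq]
    simp
  · intro g hg
    simp at hg
  · rw [hc]
    nlinarith
  · rw [hc]
    have := twoLayer_ncard_inl (K := K) htt 1
    nlinarith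
  · rw [hc, twoLayer_ncard_inr]
    have : K.index - 1 + 1 = K.index := by omega
    nlinarith

end TwoLayer

/-- The adjacency relation of a fourteen-vertex graph with automorphism group `C₈`. -/
def adjEight : ZMod 8 ⊕ ZMod 4 ⊕ ZMod 2 → ZMod 8 ⊕ ZMod 4 ⊕ ZMod 2 → Bool
  | .inl a, .inl b => a == b + 1 || b == a + 1
  | .inl a, .inr (.inl b) => b == a.cast || b == a.cast + 1
  | .inr (.inl b), .inl a => b == a.cast || b == a.cast + 1
  | .inl a, .inr (.inr c) => c == a.cast
  | .inr (.inr c), .inl a => c == a.cast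
  | .inr (.inl b), .inr (.inl b') => b != b'
  | .inr (.inl b), .inr (.inr c) => c == b.cast
  | .inr (.inr c), .inr (.inl b) => c == b.cast
  | .inr (.inr _), .inr (.inr _) => false

/-- Translation on each of the three layers. -/
abbrev actionEight : MulAction (Multiplicative (ZMod 8)) (ZMod 8 ⊕ ZMod 4 ⊕ ZMod 2) where
  smul g := Sum.map (g.toAdd + ·) (Sum.map ((g.toAdd.cast : ZMod 4) + ·)
    ((g.toAdd.cast : ZMod 2) + ·))
  one_smul := by
    change ∀ x : ZMod 8 ⊕ ZMod 4 ⊕ ZMod 2, Sum.map ((0 : ZMod 8) + ·)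
      (Sum.map (((0 : ZMod 8).cast : ZMod 4) + ·) (((0 : ZMod 8).cast : ZMod 2) + ·)) x = x
    decide +kernel
  mul_smul := by
    change ∀ (g h : ZMod 8) (x : ZMod 8 ⊕ ZMod 4 ⊕ ZMod 2), Sum.map (g + h + ·)
      (Sum.map (((g + h).cast : ZMod 4) + ·) (((g + h).cast : ZMod 2) + ·)) x =
      Sum.map (g + ·) (Sum.map ((g.cast : ZMod 4) + ·) ((g.cast : ZMod 2) + ·))
        (Sum.map (h + ·) (Sum.map ((h.cast : ZMod 4) + ·) ((h.cast : ZMod 2) + ·)) x)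
    decide +kernel

theorem good_eight :
    Good (Subgroup.zpowers (Multiplicative.ofAdd (4 : ZMod 8))) := by
  let _ := actionEight
  let Γ : SimpleGraph (ZMod 8 ⊕ ZMod 4 ⊕ ZMod 2) :=
    { Adj := fun x y => adjEight x y = true
      symm := ⟨by decide +kernel⟩
      loopless := ⟨by decide +kernel⟩ }
  have hnc : ∀ x, (Γ.neighborSet x).ncard = commonNbrs adjEight x x := by
    intro x
    rw [commonNbrs, ← Set.ncard_coe_finset]
    congr 1
    ext y
    simp [Γ]
  have hstab : ∀ g : Multiplicative (ZMod 8),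
      g • (Sum.inl 0 : ZMod 8 ⊕ ZMod 4 ⊕ ZMod 2) = Sum.inl 0 → g = 1 := by
    change ∀ g : ZMod 8, (Sum.inl (g + 0) : ZMod 8 ⊕ ZMod 4 ⊕ ZMod 2) = Sum.inl 0 → g = 0
    decide +kernel
  refine IsGoodPair.good (Γ := Γ) (v := .inl 0) (w := .inr (.inl 0))
    ⟨?_, hstab, ?_, ?_, ?_, ?_, ?_⟩
  · refine isAutAction_of_refines (adj := adjEight) (fun x y => Iff.rfl) (.inl 0) ?_ hstab ?_
      [.inr (.inr 0), .inr (.inl 0), .inl 1, .inl 2, .inl 3, .inl 4, .inl 5, .inl 6, .inl 7,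
        .inr (.inl 1), .inr (.inl 2), .inr (.inl 3), .inr (.inr 1)] ?_
    · change ∀ (g : ZMod 8) (x y : ZMod 8 ⊕ ZMod 4 ⊕ ZMod 2), adjEight x y = true →
        adjEight (Sum.map (g + ·) (Sum.map ((g.cast : ZMod 4) + ·) ((g.cast : ZMod 2) + ·)) x)
          (Sum.map (g + ·) (Sum.map ((g.cast : ZMod 4) + ·) ((g.cast : ZMod 2) + ·)) y) = true
      decide +kernel
    · change ∀ w : ZMod 8 ⊕ ZMod 4 ⊕ ZMod 2, _ → ∃ g : ZMod 8, Sum.inl (g + 0) = w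
      decide +kernel
    · decide +kernel
  · intro g
    have : g ∈ Subgroup.zpowers (Multiplicative.ofAdd (4 : ZMod 8)) ↔
        g.toAdd = 0 ∨ g.toAdd = 4 := by
      constructor
      · rintro ⟨k, rfl⟩
        have h : ∀ a : ZMod 8, a * 4 = 0 ∨ a * 4 = 4 := by decide
        have := h k
        rwa [← zsmul_eq_mul] at this
      · rintro (h | h)
        · rw [show g = 1 from h]
          exact one_mem _
        · rw [show g = Multiplicative.ofAdd 4 from h]
          exact Subgroup.mem_zpowers _
    rw [this]
    clear this
    revert g
    change ∀ g : ZMod 8, (Sum.inr (Sum.inl ((g.cast : ZMod 4) + 0)) :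
      ZMod 8 ⊕ ZMod 4 ⊕ ZMod 2) = Sum.inr (Sum.inl 0) ↔ g = 0 ∨ g = 4
    decide +kernel
  · intro g hg
    cases hg
  · simp
  · rw [hnc]
    simp only [Nat.card_eq_fintype_card]
    decide +kernel
  · have : orderOf (Multiplicative.ofAdd (4 : ZMod 8)) = 2 := by
      have : Fact (Nat.Prime 2) := ⟨Nat.prime_two⟩
      exact orderOf_eq_prime (by decide) (by decide)
    rw [hnc, Nat.card_zpowers, this]
    simp only [Nat.card_eq_fintype_card]
    decide +kernel

section Dicyclic

variable {M : Type*} [Group M] (Z K : Subgroup M) (s b : M)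

/-- Adjacency of the graph on `M`, `M ⧸ Z` and `M ⧸ K` realizing a dicyclic group. -/
def dicAdj : M ⊕ (M ⧸ Z) ⊕ (M ⧸ K) → M ⊕ (M ⧸ Z) ⊕ (M ⧸ K) → Prop
  | .inl x, .inl y => x ≠ y ∧ (x * b = y ∨ y * b = x)
  | .inl x, .inr (.inl q) => (x : M ⧸ Z) = q
  | .inr (.inl q), .inl x => (x : M ⧸ Z) = q
  | .inl x, .inr (.inr c) => (x : M ⧸ K) = c ∨ ((x * b : M) : M ⧸ K) = c
  | .inr (.inr c), .inl x => (x : M ⧸ K) = c ∨ ((x * b : M) : M ⧸ K) = c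
  | .inr (.inl q), .inr (.inr c) => ∃ g : M, (g : M ⧸ Z) = q ∧ (g : M ⧸ K) = c
  | .inr (.inr c), .inr (.inl q) => ∃ g : M, (g : M ⧸ Z) = q ∧ (g : M ⧸ K) = c
  | .inr (.inl q), .inr (.inl q') => q ≠ q' ∧ ∀ g : M,
      ((g : M ⧸ Z) = q → ((g * s * b : M) : M ⧸ Z) ≠ q') ∧
      ((g : M ⧸ Z) = q' → ((g * s * b : M) : M ⧸ Z) ≠ q)
  | .inr (.inr _), .inr (.inr _) => False

/-- The graph on `M`, `M ⧸ Z` and `M ⧸ K` realizing a dicyclic group. -/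
def dicGraph : SimpleGraph (M ⊕ (M ⧸ Z) ⊕ (M ⧸ K)) where
  Adj := dicAdj Z K s b
  symm := ⟨by
    rintro (a | q | q) (b | q' | q') <;> simp only [dicAdj] <;> grind⟩
  loopless := ⟨by rintro (a | q | q) <;> simp [dicAdj]⟩

/-- `s` and `b` generate a dicyclic group, `K` is generated by `s` and `Z` by `b * b`. -/
structure IsDicyclic : Prop where
  mem_Z : ∀ x, x ∈ Z ↔ x = 1 ∨ x = b * b
  s_mem : s ∈ K
  sq_ne : s * s ≠ 1
  b_notMem : b ∉ K
  z_notMem : b * b ∉ K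
  four : b * b * (b * b) = 1
  conj : b * s = s⁻¹ * b
  gen : Subgroup.closure {s, b} = ⊤

variable {Z K s b}

theorem length_le_ncard {X : Type*} [Finite X] {S : Set X} (l : List X) (hl : l.Nodup)
    (h : ∀ x ∈ l, x ∈ S) : l.length ≤ S.ncard := by
  classical
  rw [← List.toFinset_card_of_nodup hl, ← Set.ncard_coe_finset]
  exact Set.ncard_le_ncard fun x hx => h x (by simpa using hx)

namespace IsDicyclic

variable (h : IsDicyclic Z K s b)
include h

theorem z_comm (g : M) : b * b * g = g * (b * b) := by
  have : ∀ g ∈ (⊤ : Subgroup M), b * b * g = g * (b * b) := by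
    rw [← h.gen]
    intro g hg
    induction hg using Subgroup.closure_induction with
    | mem x hx =>
      rcases hx with rfl | rfl
      · have h2 : b * x⁻¹ = x * b := by
          rw [mul_inv_eq_iff_eq_mul, mul_assoc, h.conj, mul_inv_cancel_left]
        rw [mul_assoc, h.conj, ← mul_assoc, h2, mul_assoc]
      · simp [mul_assoc]
    | one => simp
    | mul x y _ _ hx hy => rw [← mul_assoc, hx, mul_assoc, hy, mul_assoc]
    | inv x _ hx => rw [eq_inv_mul_iff_mul_eq, ← mul_assoc, ← hx, mul_assoc, mul_inv_cancel, mul_one]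
  exact this g trivial

theorem mk_Z_eq {x y : M} : (x : M ⧸ Z) = y ↔ y = x ∨ y = x * (b * b) := by
  rw [QuotientGroup.eq, h.mem_Z, inv_mul_eq_one, inv_mul_eq_iff_eq_mul, eq_comm]

theorem sb_sq : s * b * (s * b) = b * b := by
  rw [mul_assoc, ← mul_assoc b, h.conj, mul_assoc, mul_inv_cancel_left]

theorem adj_BB {x y : M} : (dicGraph Z K s b).Adj (.inr (.inl (x : M ⧸ Z))) (.inr (.inl y)) ↔
    (x : M ⧸ Z) ≠ y ∧ ((x * (s * b) : M) : M ⧸ Z) ≠ y := by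
  have key : ∀ {x y : M}, ((x * (s * b) : M) : M ⧸ Z) = y → ((y * (s * b) : M) : M ⧸ Z) = x := by
    intro x y hxy
    rw [h.mk_Z_eq] at hxy ⊢
    rcases hxy with rfl | rfl
    · right
      rw [mul_assoc x, h.sb_sq, mul_assoc, h.four, mul_one]
    · left
      rw [mul_assoc, h.z_comm, mul_assoc x, ← mul_assoc (s * b) (s * b), h.sb_sq, h.four, mul_one]
  have cong : ∀ {x y : M}, (x : M ⧸ Z) = y →
      ((x * (s * b) : M) : M ⧸ Z) = ((y * (s * b) : M) : M ⧸ Z) := by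
    intro x y hxy
    rw [h.mk_Z_eq] at hxy ⊢
    rcases hxy with rfl | rfl
    · exact Or.inl rfl
    · right
      rw [mul_assoc, h.z_comm, ← mul_assoc]
  constructor
  · rintro ⟨h₁, h₂⟩
    exact ⟨h₁, by simpa [mul_assoc] using (h₂ x).1 rfl⟩
  · rintro ⟨h₁, h₂⟩
    refine ⟨h₁, fun g => ⟨fun hg e => h₂ ?_, fun hg e => h₂ ?_⟩⟩
    · rw [← cong hg, ← e, mul_assoc]
    · apply key
      rw [← cong hg, ← e, mul_assoc]

theorem adj_BC {x y : M} : (dicGraph Z K s b).Adj (.inr (.inl (x : M ⧸ Z))) (.inr (.inr y)) ↔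
    (x : M ⧸ K) = y ∨ ((x * (b * b) : M) : M ⧸ K) = y := by
  constructor
  · rintro ⟨g, h₁, h₂⟩
    rcases h.mk_Z_eq.1 h₁.symm with rfl | rfl
    · exact Or.inl h₂
    · exact Or.inr h₂
  · rintro (e | e)
    · exact ⟨x, rfl, e⟩
    · exact ⟨x * (b * b), (h.mk_Z_eq.2 (Or.inr rfl)).symm, e⟩

omit h in
theorem ncard_A [Finite M] (x : M) : ((dicGraph Z K s b).neighborSet (.inl x)).ncard ≤ 5 := by
  have hsub : (dicGraph Z K s b).neighborSet (.inl x) ⊆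
      {.inl (x * b), .inl (x * b⁻¹), .inr (.inl (x : M ⧸ Z)), .inr (.inr (x : M ⧸ K)),
        .inr (.inr ((x * b : M) : M ⧸ K))} := by
    rintro (y | q | c) h
    · rcases h with ⟨-, rfl | rfl⟩ <;> simp
    · rw [← show (x : M ⧸ Z) = q from h]; simp
    · rcases h with rfl | rfl <;> simp
  refine (Set.ncard_le_ncard hsub).trans ?_
  refine (Set.ncard_insert_le _ _).trans (Nat.succ_le_succ ?_)
  refine (Set.ncard_insert_le _ _).trans (Nat.succ_le_succ ?_)
  refine (Set.ncard_insert_le _ _).trans (Nat.succ_le_succ ?_)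
  exact (Set.ncard_insert_le _ _).trans (Nat.succ_le_succ (Set.ncard_singleton _).le)

theorem s_ne : s ≠ 1 := fun e => h.sq_ne (by simp [e])

theorem z_ne : b * b ≠ 1 := fun e => h.z_notMem (by rw [e]; exact one_mem _)

theorem cube_notMem : b * (b * b) ∉ K := fun e => by
  refine h.b_notMem ?_
  have := h.four
  rw [mul_assoc] at this
  rw [eq_inv_of_mul_eq_one_left this]
  exact K.inv_mem e

theorem six_le_B [Finite M] (x : M) :
    6 ≤ ((dicGraph Z K s b).neighborSet (.inr (.inl (x : M ⧸ Z)))).ncard := by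
  refine length_le_ncard [.inl x, .inl (x * (b * b)), .inr (.inr (x : M ⧸ K)),
    .inr (.inr ((x * (b * b) : M) : M ⧸ K)), .inr (.inl ((x * s : M) : M ⧸ Z)),
    .inr (.inl ((x * s⁻¹ : M) : M ⧸ Z))] ?_ ?_
  · have h₁ : ¬ s⁻¹ = s := fun e => h.sq_ne (inv_eq_iff_mul_eq_one.1 e)
    have h₂ : ¬ s⁻¹ = s * (b * b) := fun e => h.z_notMem (by
      rw [← inv_mul_eq_iff_eq_mul] at e
      rw [← e]
      exact K.mul_mem (K.inv_mem h.s_mem) (K.inv_mem h.s_mem))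
    simp [h.mk_Z_eq, QuotientGroup.eq, h.z_notMem, h.z_ne, mul_assoc, h₁, h₂]
  · have e₀ : ∀ k ∈ K, ¬ k = b * b := fun k hk e => h.z_notMem (e ▸ hk)
    have e₁ : ∀ k ∈ K, ¬ k = b := fun k hk e => h.b_notMem (e ▸ hk)
    have hs := h.s_mem
    have hs' := K.inv_mem hs
    intro y hy
    simp only [List.mem_cons, List.not_mem_nil, or_false] at hy
    rcases hy with rfl | rfl | rfl | rfl | rfl | rfl
    · rfl
    · exact (h.mk_Z_eq.2 (Or.inr rfl)).symm
    · exact h.adj_BC.2 (Or.inl rfl)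
    · exact h.adj_BC.2 (Or.inr rfl)
    · refine h.adj_BB.2 ⟨?_, ?_⟩
      · simp [h.mk_Z_eq, h.s_ne, e₀ _ hs]
      · rw [ne_eq, h.mk_Z_eq]
        rintro (e | e)
        · simp only [mul_right_inj, left_eq_mul] at e
          exact e₁ _ (one_mem _) e.symm
        · simp only [mul_assoc, mul_right_inj, left_eq_mul] at e
          exact h.cube_notMem (by rw [e]; exact one_mem _)
    · refine h.adj_BB.2 ⟨?_, ?_⟩
      · simp [h.mk_Z_eq, h.s_ne, e₀ _ hs']
      · rw [ne_eq, h.mk_Z_eq]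
        rintro (e | e)
        · simp only [mul_right_inj] at e
          refine e₁ _ (K.mul_mem hs' hs') ?_
          nth_rw 2 [e]
          rw [inv_mul_cancel_left]
        · simp only [mul_assoc, mul_right_inj] at e
          refine h.cube_notMem ?_
          rw [← inv_mul_eq_iff_eq_mul] at e
          rw [← e]
          exact K.mul_mem hs' hs'

theorem six_le_C [Finite M] (x : M) :
    6 ≤ ((dicGraph Z K s b).neighborSet (.inr (.inr (x : M ⧸ K)))).ncard := by
  have hs := h.s_mem
  have hs' := K.inv_mem hs
  have h₁ : ¬ s⁻¹ = s := fun e => h.sq_ne (inv_eq_iff_mul_eq_one.1 e)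
  have e₁ : ∀ k ∈ K, ∀ k' ∈ K, ¬ k = k' * b⁻¹ := fun k hk k' hk' e => h.b_notMem (by
    rw [eq_mul_inv_iff_mul_eq, ← eq_inv_mul_iff_mul_eq] at e
    rw [e]
    exact K.mul_mem (K.inv_mem hk) hk')
  have one := K.one_mem
  refine length_le_ncard [.inl (x * 1), .inl (x * s), .inl (x * s⁻¹), .inl (x * (1 * b⁻¹)),
    .inl (x * (s * b⁻¹)), .inl (x * (s⁻¹ * b⁻¹))] ?_ ?_
  · simp only [List.nodup_cons, List.mem_cons, Sum.inl.injEq, mul_right_inj, mul_left_inj,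
      e₁ _ one _ one, e₁ _ one _ hs, e₁ _ one _ hs', e₁ _ hs _ one, e₁ _ hs _ hs,
      e₁ _ hs _ hs', e₁ _ hs' _ one, e₁ _ hs' _ hs, e₁ _ hs' _ hs', h.s_ne.symm]
    simp [h.s_ne, Ne.symm h₁]
  · intro y hy
    simp only [List.mem_cons, List.not_mem_nil, or_false] at hy
    rcases hy with rfl | rfl | rfl | rfl | rfl | rfl
    · left; simp
    · left; simpa [QuotientGroup.eq]
    · left; simpa [QuotientGroup.eq]
    · right; simp
    · right; simpa [QuotientGroup.eq, mul_assoc]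
    · right; simpa [QuotientGroup.eq, mul_assoc]

theorem isAut [Finite M] : IsAutAction M (dicGraph Z K s b) := by
  have hb1 : b ≠ 1 := fun e => h.b_notMem (e ▸ one_mem _)
  refine ⟨?_, ?_, fun φ => ?_⟩
  · rintro g (x | q | c) (y | q' | c') hxy
    · refine ⟨fun e => hxy.1 (mul_left_cancel e), hxy.2.imp (fun e => ?_) (fun e => ?_)⟩
      · rw [← e]; exact mul_assoc _ _ _
      · rw [← e]; exact mul_assoc _ _ _
    · rw [← show (x : M ⧸ Z) = q' from hxy]; rfl
    · rcases hxy with rfl | rfl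
      · exact Or.inl rfl
      · refine Or.inr (congrArg QuotientGroup.mk (mul_assoc g x b))
    · rw [← show (y : M ⧸ Z) = q from hxy]; rfl
    · obtain ⟨x, rfl⟩ := QuotientGroup.mk_surjective q
      obtain ⟨y, rfl⟩ := QuotientGroup.mk_surjective q'
      rw [h.adj_BB] at hxy
      refine h.adj_BB.2 ⟨fun e => hxy.1 (MulAction.injective g e), fun e => hxy.2 ?_⟩
      refine MulAction.injective g (Eq.trans ?_ e)
      exact congrArg QuotientGroup.mk (mul_assoc g x (s * b)).symm
    · obtain ⟨x, rfl, rfl⟩ := hxy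
      exact ⟨g * x, rfl, rfl⟩
    · rcases hxy with rfl | rfl
      · exact Or.inl rfl
      · refine Or.inr (congrArg QuotientGroup.mk (mul_assoc g y b))
    · obtain ⟨x, rfl, rfl⟩ := hxy
      exact ⟨g * x, rfl, rfl⟩
    · exact hxy
  · intro g hg
    have := hg (.inl 1)
    simpa using this
  have hA : ∀ ψ : dicGraph Z K s b ≃g dicGraph Z K s b, ∀ x, ∃ y, ψ (.inl x) = .inl y := by
    intro ψ x
    have h₁ := ncard_A (Z := Z) (K := K) (s := s) (b := b) x
    rw [← ψ.ncard_neighborSet] at h₁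
    rcases e : ψ (.inl x) with y | q | c
    · exact ⟨y, rfl⟩
    · obtain ⟨y, rfl⟩ := QuotientGroup.mk_surjective q
      have := h.six_le_B y
      rw [e] at h₁
      omega
    · obtain ⟨y, rfl⟩ := QuotientGroup.mk_surjective c
      have := h.six_le_C y
      rw [e] at h₁
      omega
  have hB : ∀ ψ : dicGraph Z K s b ≃g dicGraph Z K s b, ∀ q, ∃ q',
      ψ (.inr (.inl q)) = .inr (.inl q') := by
    intro φ q
    rcases e : φ (.inr (.inl q)) with y | q' | c
    · obtain ⟨x, hx⟩ := hA φ.symm y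
      rw [← e, φ.symm_apply_apply] at hx
      simp at hx
    · exact ⟨q', rfl⟩
    · exfalso
      obtain ⟨x, rfl⟩ := QuotientGroup.mk_surjective q
      obtain ⟨y, rfl⟩ := QuotientGroup.mk_surjective c
      have key : ∀ k ∈ K, φ.symm (.inl (y * k)) = .inl x ∨
          φ.symm (.inl (y * k)) = .inl (x * (b * b)) := by
        intro k hk
        obtain ⟨u, hu⟩ := hA φ.symm (y * k)
        have : (dicGraph Z K s b).Adj (φ.symm (.inl (y * k))) (φ.symm (.inr (.inr (y : M ⧸ K)))) :=
          φ.symm.map_adj_iff.2 (Or.inl (by simpa [QuotientGroup.eq]))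
        rw [hu, ← e, φ.symm_apply_apply] at this
        rw [hu, Sum.inl.injEq, Sum.inl.injEq]
        exact h.mk_Z_eq.1 (Eq.symm this)
      have inj : ∀ k k', φ.symm (.inl (y * k)) = φ.symm (.inl (y * k')) → k = k' := by
        intro k k' e
        simpa using φ.symm.injective e
      have h₁ : s⁻¹ ≠ s := fun e => h.sq_ne (inv_eq_iff_mul_eq_one.1 e)
      have h₂ := h.s_ne
      have h₃ : s⁻¹ ≠ 1 := by simpa
      have i₁ := inj s⁻¹ s
      have i₂ := inj s 1
      have i₃ := inj s⁻¹ 1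
      rcases key 1 (one_mem _) with k₁ | k₁ <;> rcases key s h.s_mem with k₂ | k₂ <;>
      rcases key s⁻¹ (K.inv_mem h.s_mem) with k₃ | k₃ <;> rw [k₁, k₂] at i₂ <;>
      rw [k₂, k₃] at i₁ <;> rw [k₁, k₃] at i₃ <;> grind
  have hC : ∀ c, ∃ c', φ (.inr (.inr c)) = .inr (.inr c') := by
    intro c
    rcases e : φ (.inr (.inr c)) with y | q | c'
    · obtain ⟨x, hx⟩ := hA φ.symm y
      rw [← e, φ.symm_apply_apply] at hx
      simp at hx
    · obtain ⟨x, hx⟩ := hB φ.symm q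
      rw [← e, φ.symm_apply_apply] at hx
      simp at hx
    · exact ⟨c', rfl⟩
  choose f hf using hA φ
  choose fB hfB using hB φ
  choose fC hfC using hC
  have hfinj : Function.Injective f := fun a b e => by
    have : φ (.inl a) = φ (.inl b) := by rw [hf, hf, e]
    simpa using this
  have hfB' : ∀ a : M, fB a = f a := by
    intro a
    have h : (dicGraph Z K s b).Adj (φ (.inl a)) (φ (.inr (.inl (a : M ⧸ Z)))) :=
      φ.map_adj_iff.2 rfl
    rw [hf, hfB] at h
    exact (show (f a : M ⧸ Z) = _ from h).symm
  have hAC : ∀ a : M, ∀ c : M ⧸ K, ((a : M ⧸ K) = c ∨ ((a * b : M) : M ⧸ K) = c) →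
      (f a : M ⧸ K) = fC c ∨ ((f a * b : M) : M ⧸ K) = fC c := by
    intro a c hac
    have h : (dicGraph Z K s b).Adj (φ (.inl a)) (φ (.inr (.inr c))) := φ.map_adj_iff.2 hac
    rw [hf, hfC] at h
    exact h
  have hfC' : ∀ a : M, fC a = f a := by
    intro a
    have h₁ := hAC a a (Or.inl rfl)
    have h₂ : (dicGraph Z K s b).Adj (φ (.inr (.inl (a : M ⧸ Z)))) (φ (.inr (.inr (a : M ⧸ K)))) :=
      φ.map_adj_iff.2 ⟨a, rfl, rfl⟩
    obtain ⟨c, hc⟩ := QuotientGroup.mk_surjective (fC a)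
    rw [hfB, hfB', hfC, ← hc, h.adj_BC] at h₂
    rw [← hc] at h₁ ⊢
    rcases h₁ with h₁ | h₁
    · exact h₁.symm
    · rcases h₂ with h₂ | h₂
      · exact h₂.symm
      · rw [← h₂, QuotientGroup.eq] at h₁
        refine absurd h₁ ?_
        simpa [mul_assoc] using h.b_notMem
  refine ⟨f 1, ?_⟩
  have hmain := map_eq_mul_of_closure h.gen f (by
    have hb : ∀ x, f (x * b) = f x * b := by
      intro x
      have h₁ := hAC x ((x * b : M) : M ⧸ K) (Or.inr rfl)
      have h₂ : (dicGraph Z K s b).Adj (φ (.inl x)) (φ (.inl (x * b))) :=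
        φ.map_adj_iff.2 ⟨by simpa using hb1, Or.inl rfl⟩
      rw [hf, hf] at h₂
      rcases h₂.2 with h₂ | h₂
      · exact h₂.symm
      · exfalso
        rw [hfC', ← h₂, QuotientGroup.eq, QuotientGroup.eq] at h₁
        rcases h₁ with h₁ | h₁
        · refine h.b_notMem ?_
          rw [← inv_mem_iff]
          simpa using h₁
        · refine h.z_notMem ?_
          rw [← inv_mem_iff]
          simpa [mul_assoc] using h₁
    rintro y (rfl | rfl) x
    · have hK : (f x)⁻¹ * f (x * y) ∈ K := by
        rw [← QuotientGroup.eq, ← hfC', ← hfC', QuotientGroup.mk_mul_of_mem x h.s_mem]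
      have h₁ : ¬ (dicGraph Z K y b).Adj (φ (.inr (.inl (x : M ⧸ Z))))
          (φ (.inr (.inl ((x * (y * b) : M) : M ⧸ Z)))) := by
        rw [φ.map_adj_iff, h.adj_BB]
        simp
      rw [hfB, hfB, hfB', hfB', h.adj_BB, not_and_or, not_not, not_not, ← mul_assoc x, hb] at h₁
      rcases h₁ with h₁ | h₁
      · exfalso
        rw [← hb, ← hfB', ← hfB'] at h₁
        have : (x : M ⧸ Z) = ((x * y * b : M) : M ⧸ Z) := by
          have := φ.injective ((hfB _).trans ((congrArg (Sum.inr ∘ Sum.inl) h₁).trans (hfB _).symm))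
          simpa using this
        rw [h.mk_Z_eq] at this
        simp only [mul_assoc, mul_right_inj, mul_eq_left] at this
        refine h.b_notMem ?_
        rcases this with e | e
        · rw [eq_inv_of_mul_eq_one_right e]
          exact K.inv_mem h.s_mem
        · rw [mul_left_inj] at e
          rw [← e]
          exact h.s_mem
      · rw [h.mk_Z_eq] at h₁
        rcases h₁ with h₁ | h₁
        · rw [← mul_assoc, mul_left_inj] at h₁
          exact h₁
        · exfalso
          have h₂ : f (x * y) = f x * (y * (b * b)) := by
            rw [← mul_left_inj b, h₁]
            simp only [mul_assoc]
          rw [h₂, inv_mul_cancel_left] at hK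
          exact h.z_notMem ((K.mul_mem_cancel_left h.s_mem).1 hK)
    · exact hb x)
  rintro (a | q | c)
  · rw [hf, hmain]; rfl
  · obtain ⟨a, rfl⟩ := QuotientGroup.mk_surjective q
    rw [hfB, hfB', hmain]; rfl
  · obtain ⟨a, rfl⟩ := QuotientGroup.mk_surjective c
    rw [hfC, hfC', hmain]; rfl

theorem good [Finite M] (h3 : 3 ≤ Nat.card K) (hM : 4 * Nat.card K ≤ Nat.card M) : Good K := by
  have hZ : Nat.card Z = 2 := by
    have : (Z : Set M) = {1, b * b} := Set.ext h.mem_Z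
    change (Z : Set M).ncard = 2
    rw [this, Set.ncard_pair h.z_ne.symm]
  have h₁ := Z.card_mul_index
  have h₂ := K.card_mul_index
  rw [hZ] at h₁
  have hc : Nat.card (M ⊕ (M ⧸ Z) ⊕ (M ⧸ K)) = Nat.card M + (Z.index + K.index) := by
    rw [Nat.card_sum, Nat.card_sum]
    rfl
  have h₃ : 4 ≤ K.index := by
    by_contra hlt
    nlinarith
  refine IsGoodPair.good (Γ := dicGraph Z K s b) (v := .inl 1) (w := .inr (.inr (1 : M)))
    ⟨h.isAut, ?_, ?_, ?_, ?_, ?_, ?_⟩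
  · intro g hg
    simpa using hg
  · intro g
    have : g • (.inr (.inr (1 : M)) : M ⊕ (M ⧸ Z) ⊕ (M ⧸ K)) =
      .inr (.inr ((g * 1 : M) : M ⧸ K)) := rfl
    rw [this, mul_one, Sum.inr.injEq, Sum.inr.injEq, eq_comm, QuotientGroup.eq]
    simp
  · intro g hg
    simp at hg
  · rw [hc]
    nlinarith
  · rw [hc]
    have := ncard_A (Z := Z) (K := K) (s := s) (b := b) 1
    omega
  · have hsub : (dicGraph Z K s b).neighborSet (.inr (.inr ((1 : M) : M ⧸ K))) ⊆
        (fun k => .inl k) '' (K : Set M) ∪ (fun k => .inl (k * b⁻¹)) '' (K : Set M) ∪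
          (fun k => .inr (.inl ((k : M) : M ⧸ Z))) '' (K : Set M) := by
      rintro (x | q | c) hx
      · rcases hx with hx | hx
        · rw [eq_comm, QuotientGroup.eq] at hx
          exact Or.inl (Or.inl ⟨x, by simpa using hx, rfl⟩)
        · rw [eq_comm, QuotientGroup.eq] at hx
          exact Or.inl (Or.inr ⟨x * b, by simpa using hx, by simp⟩)
      · obtain ⟨g, rfl, hg⟩ := hx
        rw [eq_comm, QuotientGroup.eq] at hg
        exact Or.inr ⟨g, by simpa using hg, rfl⟩
      · exact hx.elim
    have hK : Nat.card K = (K : Set M).ncard := rfl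
    have e₁ := Set.ncard_le_ncard hsub
    have e₂ := e₁.trans ((Set.ncard_union_le _ _).trans
      (Nat.add_le_add_right (Set.ncard_union_le _ _) _))
    have i₁ := Set.ncard_image_le (s := (K : Set M))
      (f := fun k => (.inl k : M ⊕ (M ⧸ Z) ⊕ (M ⧸ K)))
    have i₂ := Set.ncard_image_le (s := (K : Set M))
      (f := fun k => (.inl (k * b⁻¹) : M ⊕ (M ⧸ Z) ⊕ (M ⧸ K)))
    have i₃ := Set.ncard_image_le (s := (K : Set M))
      (f := fun k => (.inr (.inl (k : M ⧸ Z)) : M ⊕ (M ⧸ Z) ⊕ (M ⧸ K)))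
    rw [hc]
    omega

end IsDicyclic

end Dicyclic

section CyclicDouble

variable {R : Type*} [CommRing R] [Finite R]

/-- Adjacency of the graph on two copies of a ring realizing a cyclic group. -/
def cycAdj (R : Type*) [CommRing R] : R × Bool → R × Bool → Prop
  | (x, false), (y, false) => y = x + 1 ∨ x = y + 1
  | (x, false), (y, true) => y = x ∨ y = x + 1 ∨ y = x + 3
  | (y, true), (x, false) => y = x ∨ y = x + 1 ∨ y = x + 3
  | (_, true), (_, true) => False

/-- The graph on two copies of a ring realizing a cyclic group. -/
def cycGraph (R : Type*) [CommRing R] (h : (1 : R) ≠ 0) : SimpleGraph (R × Bool) where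
  Adj := cycAdj R
  symm := ⟨by
    rintro ⟨x, _ | _⟩ ⟨y, _ | _⟩ <;> simp only [cycAdj] <;> tauto⟩
  loopless := ⟨by rintro ⟨x, _ | _⟩ <;> simp [cycAdj, h]⟩

theorem realizable_of_ring (hR : ∀ x : R, ∃ j : ℕ, x = j) (h1 : (1 : R) ≠ 0) (h2 : (2 : R) ≠ 0) (h3 : (3 : R) ≠ 0)
    (h4 : (4 : R) ≠ 0) (h5 : (5 : R) ≠ 0) :
    Realizable (Multiplicative (R)) (2 * Nat.card R) := by
  let _ := layerAction (R) Bool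
  set Γ := cycGraph R h1 with hΓ
  have adj₀ : ∀ x y, Γ.Adj (x, false) (y, false) ↔ y = x + 1 ∨ x = y + 1 := fun _ _ => Iff.rfl
  have adj₁ : ∀ x y, Γ.Adj (x, false) (y, true) ↔ y = x ∨ y = x + 1 ∨ y = x + 3 :=
    fun _ _ => Iff.rfl
  have : IsAutAction (Multiplicative (R)) Γ := by
    refine ⟨?_, ?_, fun φ => ?_⟩
    · intro g
      have hg : ∀ x : R × Bool, g • x = (g.toAdd + x.1, x.2) := fun _ => rfl
      rintro ⟨x, _ | _⟩ ⟨y, _ | _⟩ h <;> rw [hg, hg]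
      · rw [adj₀] at h ⊢
        grind
      · rw [adj₁] at h ⊢
        grind
      · rw [Γ.adj_comm, adj₁] at h ⊢
        grind
      · exact h
    · intro g hg
      have : (g.toAdd + 0, false) = ((0, false) : R × Bool) := hg (0, false)
      simpa using this
    have hB3 : ∀ x, (Γ.neighborSet (x, true)).ncard ≤ 3 := by
      intro x
      have : Γ.neighborSet (x, true) ⊆ {(x, false), (x - 1, false), (x - 3, false)} := by
        rintro ⟨y, _ | _⟩ h
        · have h : x = y ∨ x = y + 1 ∨ x = y + 3 := h
          simp only [Set.mem_insert_iff, Prod.mk.injEq, and_true, Set.mem_singleton_iff]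
          grind
        · exact h.elim
      refine (Set.ncard_le_ncard this).trans ?_
      refine (Set.ncard_insert_le _ _).trans (Nat.succ_le_succ ?_)
      exact (Set.ncard_insert_le _ _).trans (Nat.succ_le_succ (Set.ncard_singleton _).le)
    have hA5 : ∀ x, 4 ≤ (Γ.neighborSet (x, false)).ncard := by
      intro x
      refine length_le_ncard [(x + 1, false), (x, true), (x + 1, true), (x + 3, true)]
        ?_ ?_
      · have : ¬ (1 : R) = 3 := fun e => h2 (by linear_combination -e)
        simp [h1, h3, this]
      · intro y hy
        simp only [List.mem_cons, List.not_mem_nil, or_false] at hy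
        rcases hy with rfl | rfl | rfl | rfl
        · exact Or.inl rfl
        · exact Or.inl rfl
        · exact Or.inr (Or.inl rfl)
        · exact Or.inr (Or.inr rfl)
    have hA : ∀ x, ∃ y, φ (x, false) = (y, false) := by
      intro x
      have h₁ := hA5 x
      rw [← φ.ncard_neighborSet] at h₁
      rcases e : φ (x, false) with ⟨y, _ | _⟩
      · exact ⟨y, rfl⟩
      · have := hB3 y
        rw [e] at h₁
        omega
    have hB : ∀ x, ∃ y, φ (x, true) = (y, true) := by
      intro x
      have h₁ := hB3 x
      rw [← φ.ncard_neighborSet] at h₁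
      rcases e : φ (x, true) with ⟨y, _ | _⟩
      · have := hA5 y
        rw [e] at h₁
        omega
      · exact ⟨y, rfl⟩
    choose f hf using hA
    choose k hk using hB
    have inj : ∀ x y, f x = f y → x = y := fun x y e => by
      have : φ (x, false) = φ (y, false) := by rw [hf, hf, e]
      simpa using this
    have hAA : ∀ x, f (x + 1) = f x + 1 ∨ f x = f (x + 1) + 1 := by
      intro x
      have h : Γ.Adj (φ (x, false)) (φ (x + 1, false)) := φ.map_adj_iff.2 (Or.inl rfl)
      rwa [hf, hf] at h
    have hAB : ∀ x y, (k y = f x ∨ k y = f x + 1 ∨ k y = f x + 3) ↔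
        (y = x ∨ y = x + 1 ∨ y = x + 3) := by
      intro x y
      have h : Γ.Adj (φ (x, false)) (φ (y, true)) ↔ _ := φ.map_adj_iff
      rwa [hf, hk] at h
    have hstep : ∀ x, f (x + 1) = f x + 1 := by
      intro x
      refine (hAA x).resolve_right fun e => ?_
      have i₁ := inj (x + 1 + 1) x
      have i₂ := inj (x + 1 + 1 + 1) (x + 1)
      have e₁ : f (x + 1) = f (x + 1 + 1) + 1 := (hAA (x + 1)).resolve_left (by grind)
      have e₂ : f (x + 1 + 1) = f (x + 1 + 1 + 1) + 1 := (hAA (x + 1 + 1)).resolve_left (by grind)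
      have a₁ := (hAB x (x + 1 + 1 + 1)).2 (by grind)
      have a₂ := (hAB (x + 1 + 1) (x + 1 + 1 + 1)).2 (by grind)
      have a₃ := (hAB (x + 1 + 1 + 1) (x + 1 + 1 + 1)).2 (by grind)
      generalize f (x + 1 + 1 + 1) = u at *
      rw [e, e₁, e₂] at a₁
      rw [e₂] at a₂
      rcases a₁ with a₁ | a₁ | a₁ <;> rcases a₂ with a₂ | a₂ | a₂ <;>
      rcases a₃ with a₃ | a₃ | a₃ <;>
      first
      | exact h1 (by linear_combination a₃ - a₁)
      | exact h2 (by linear_combination a₃ - a₁)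
      | exact h3 (by linear_combination a₃ - a₁)
      | exact h4 (by linear_combination a₃ - a₁)
      | exact h5 (by linear_combination a₃ - a₁)
      | exact h1 (by linear_combination a₃ - a₂)
      | exact h1 (by linear_combination a₂ - a₃)
      | exact h2 (by linear_combination a₃ - a₂)
      | exact h2 (by linear_combination a₂ - a₃)
      | exact h4 (by linear_combination a₃ - a₂)
    have hmain : ∀ x : R, f x = f 0 + x := by
      intro x
      have : ∀ j : ℕ, f j = f 0 + j := by
        intro j
        induction j with
        | zero => simp
        | succ j ih => push_cast; rw [hstep, ih, add_assoc]
      obtain ⟨j, rfl⟩ := hR x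
      exact this j
    have hkmain : ∀ x, k x = f 0 + x := by
      intro x
      have a₁ := (hAB x x).2 (by grind)
      have a₂ := (hAB (x - 1) x).2 (by grind)
      have a₃ := (hAB (x - 3) x).2 (by grind)
      rw [hmain] at a₁ a₂ a₃
      rcases a₁ with a₁ | a₁ | a₁
      · exact a₁
      · exfalso
        rcases a₂ with a₂ | a₂ | a₂
        · exact h2 (by linear_combination a₂ - a₁)
        · exact h1 (by linear_combination a₂ - a₁)
        · exact h1 (by linear_combination a₁ - a₂)
      · exfalso
        rcases a₂ with a₂ | a₂ | a₂
        · exact h4 (by linear_combination a₂ - a₁)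
        · exact h3 (by linear_combination a₂ - a₁)
        · exact h1 (by linear_combination a₂ - a₁)
    refine ⟨Multiplicative.ofAdd (f 0), ?_⟩
    rintro ⟨x, _ | _⟩
    · rw [hf, hmain]; rfl
    · rw [hk, hkmain]; rfl
  have := this.realizable
  simpa [Nat.card_prod, mul_comm] using this

end CyclicDouble

section QuaternionDouble

variable {M : Type*} [Group M] (a b : M)

/-- Adjacency of the graph on two copies of a quaternion group. -/
def quatAdj : M ⊕ M → M ⊕ M → Prop
  | .inl x, .inl y => x ≠ y ∧ (y = x * a ∨ x = y * a)
  | .inl x, .inr y => y = x ∨ y = x * a ∨ y = x * b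
  | .inr y, .inl x => y = x ∨ y = x * a ∨ y = x * b
  | .inr x, .inr y => x ≠ y ∧ y ≠ x * b ∧ x ≠ y * b

/-- The graph on two copies of a quaternion group. -/
def quatGraph : SimpleGraph (M ⊕ M) where
  Adj := quatAdj a b
  symm := ⟨by
    rintro (x | x) (y | y) <;> simp only [quatAdj] <;> grind⟩
  loopless := ⟨by rintro (x | x) <;> simp [quatAdj]⟩

variable {a b}

theorem iff_one_of_closure {S : Set M} (hS : Subgroup.closure S = ⊤) (P : M → Prop)
    (h : ∀ s ∈ S, ∀ x, P (x * s) ↔ P x) (x : M) : P x ↔ P 1 := by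
  have : ∀ y ∈ Subgroup.closure S, ∀ x, P (x * y) ↔ P x := by
    intro y hy
    induction hy using Subgroup.closure_induction with
    | mem s hs => exact h s hs
    | one => simp
    | mul u v _ _ hu hv => intro x; rw [← mul_assoc, hv, hu]
    | inv u _ hu => intro x; rw [← hu, inv_mul_cancel_right]
  simpa using this x (hS ▸ trivial) 1

theorem realizable_of_conj_inv [Finite M] (hba : b * a = a⁻¹ * b) (haa : a * a ≠ 1)
    (hb : b ∉ Subgroup.zpowers a) (hgen : Subgroup.closure {a, b} = ⊤) (hcard : 6 ≤ Nat.card M) :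
    Realizable M (2 * Nat.card M) := by
  have ha : a ≠ 1 := by rintro rfl; simp at haa
  have hba' : b * a⁻¹ = a * b := by
    rw [mul_inv_eq_iff_eq_mul, mul_assoc, hba, mul_inv_cancel_left]
  have hab : b⁻¹ * a = a⁻¹ * b⁻¹ := by
    rw [inv_mul_eq_iff_eq_mul, ← mul_assoc, hba', mul_inv_cancel_right]
  have hab' : b⁻¹ * a⁻¹ = a * b⁻¹ := by
    rw [inv_mul_eq_iff_eq_mul, ← mul_assoc, hba, mul_assoc, mul_inv_cancel, mul_one]
  have hb1 : b ≠ 1 := fun e => hb (e ▸ one_mem _)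
  have hb2 : b ≠ a := fun e => hb (e ▸ Subgroup.mem_zpowers _)
  have hb3 : b ≠ a⁻¹ := fun e => hb (e ▸ inv_mem (Subgroup.mem_zpowers _))
  have hb4 : b ≠ a * a := fun e =>
    hb (e ▸ mul_mem (Subgroup.mem_zpowers _) (Subgroup.mem_zpowers _))
  set Γ := quatGraph a b with hΓ
  have : IsAutAction M Γ := by
    refine ⟨?_, ?_, fun φ => ?_⟩
    · rintro g (x | x) (y | y) h
      · refine ⟨fun e => h.1 (mul_left_cancel e), h.2.imp (fun e => ?_) (fun e => ?_)⟩
        · rw [e]; exact (mul_assoc _ _ _).symm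
        · rw [e]; exact (mul_assoc _ _ _).symm
      · rcases h with rfl | rfl | rfl
        · exact Or.inl rfl
        · exact Or.inr (Or.inl (mul_assoc _ _ _).symm)
        · exact Or.inr (Or.inr (mul_assoc _ _ _).symm)
      · rcases h with rfl | rfl | rfl
        · exact Or.inl rfl
        · exact Or.inr (Or.inl (mul_assoc _ _ _).symm)
        · exact Or.inr (Or.inr (mul_assoc _ _ _).symm)
      · refine ⟨fun e => h.1 (mul_left_cancel e), fun e => h.2.1 ?_, fun e => h.2.2 ?_⟩
        · exact mul_left_cancel (e.trans (mul_assoc g x b))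
        · exact mul_left_cancel (e.trans (mul_assoc g y b))
    · intro g hg
      have := hg (.inl 1)
      simpa using this
    have hA5 : ∀ x, (Γ.neighborSet (.inl x)).ncard ≤ 5 := by
      intro x
      have : Γ.neighborSet (.inl x) ⊆
          {.inl (x * a), .inl (x * a⁻¹), .inr x, .inr (x * a), .inr (x * b)} := by
        rintro (y | y) h
        · rcases h with ⟨-, rfl | rfl⟩ <;> simp
        · rcases h with rfl | rfl | rfl <;> simp
      refine (Set.ncard_le_ncard this).trans ?_
      refine (Set.ncard_insert_le _ _).trans (Nat.succ_le_succ ?_)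
      refine (Set.ncard_insert_le _ _).trans (Nat.succ_le_succ ?_)
      refine (Set.ncard_insert_le _ _).trans (Nat.succ_le_succ ?_)
      exact (Set.ncard_insert_le _ _).trans (Nat.succ_le_succ (Set.ncard_singleton _).le)
    have hB6 : ∀ x, 6 ≤ (Γ.neighborSet (.inr x)).ncard := by
      intro x
      have hsub : Sum.inl '' {x, x * a⁻¹, x * b⁻¹} ∪ Sum.inr '' {x, x * b, x * b⁻¹}ᶜ ⊆
          Γ.neighborSet (.inr x) := by
        rintro _ (⟨y, rfl | rfl | rfl, rfl⟩ | ⟨y, hy, rfl⟩)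
        · exact Or.inl rfl
        · exact Or.inr (Or.inl (by simp))
        · exact Or.inr (Or.inr (by simp))
        · simp only [Set.mem_compl_iff, Set.mem_insert_iff, Set.mem_singleton_iff, not_or] at hy
          exact ⟨Ne.symm hy.1, hy.2.1, fun e => hy.2.2 (eq_mul_inv_of_mul_eq e.symm)⟩
      have h₁ := Set.ncard_le_ncard hsub
      rw [Set.ncard_union_eq, Set.ncard_image_of_injective _ Sum.inl_injective,
        Set.ncard_image_of_injective _ Sum.inr_injective, Set.ncard_compl] at h₁
      · have h₂ : ({x, x * a⁻¹, x * b⁻¹} : Set M).ncard = 3 := by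
          refine Set.ncard_eq_three.2 ⟨_, _, _, ?_, ?_, ?_, rfl⟩
          · simpa using ha
          · simpa using hb1
          · simpa using hb2.symm
        have h₃ : ({x, x * b, x * b⁻¹} : Set M).ncard ≤ 3 := by
          refine (Set.ncard_insert_le _ _).trans (Nat.succ_le_succ ?_)
          exact (Set.ncard_insert_le _ _).trans (Nat.succ_le_succ (Set.ncard_singleton _).le)
        omega
      · rw [Set.disjoint_left]
        rintro _ ⟨y, -, rfl⟩ ⟨y', -, e⟩
        cases e
    have hA : ∀ x, ∃ y, φ (.inl x) = .inl y := by
      intro x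
      have h₁ := hA5 x
      rw [← φ.ncard_neighborSet] at h₁
      rcases e : φ (.inl x) with y | y
      · exact ⟨y, rfl⟩
      · have := hB6 y
        rw [e] at h₁
        omega
    have hB : ∀ x, ∃ y, φ (.inr x) = .inr y := by
      intro x
      have h₁ := hB6 x
      rw [← φ.ncard_neighborSet] at h₁
      rcases e : φ (.inr x) with y | y
      · have := hA5 y
        rw [e] at h₁
        omega
      · exact ⟨y, rfl⟩
    choose f hf using hA
    choose k hk using hB
    have inj : ∀ x y, f x = f y → x = y := fun x y e => by
      have : φ (.inl x) = φ (.inl y) := by rw [hf, hf, e]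
      simpa using this
    have injk : ∀ x y, k x = k y → x = y := fun x y e => by
      have : φ (.inr x) = φ (.inr y) := by rw [hk, hk, e]
      simpa using this
    have hAA : ∀ x, f (x * a) = f x * a ∨ f (x * a) = f x * a⁻¹ := by
      intro x
      have h : Γ.Adj (φ (.inl x)) (φ (.inl (x * a))) :=
        φ.map_adj_iff.2 ⟨by simpa using ha, Or.inl rfl⟩
      rw [hf, hf] at h
      exact h.2.imp id fun e => eq_mul_inv_of_mul_eq e.symm
    have hAB : ∀ x y, (y = x ∨ y = x * a ∨ y = x * b) → 
        (k y = f x ∨ k y = f x * a ∨ k y = f x * b) := by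
      intro x y hxy
      have h : Γ.Adj (φ (.inl x)) (φ (.inr y)) := φ.map_adj_iff.2 hxy
      rwa [hf, hk] at h
    have hBB : ∀ x, k (x * b⁻¹) = k x * b ∨ k (x * b⁻¹) = k x * b⁻¹ := by
      intro x
      have h : ¬ Γ.Adj (φ (.inr (x * b⁻¹))) (φ (.inr x)) := by
        rw [φ.map_adj_iff]
        exact fun e => e.2.1 (by simp)
      rw [hk, hk] at h
      have h₁ : k (x * b⁻¹) ≠ k x := fun e => hb1 (by simpa using injk _ _ e)
      have h₂ : ¬ (k (x * b⁻¹) ≠ k x ∧ k x ≠ k (x * b⁻¹) * b ∧ k (x * b⁻¹) ≠ k x * b) := h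
      by_cases h₃ : k x = k (x * b⁻¹) * b
      · exact Or.inr (eq_mul_inv_of_mul_eq h₃.symm)
      · exact Or.inl (by tauto)
    have hinj₁ : ∀ x, f (x * a * b⁻¹) ≠ f (x * a) := fun x e => hb1 (by simpa using inj _ _ e)
    have hinj₂ : ∀ x, f (x * a * b⁻¹) ≠ f x := fun x e => hb2 (by
      have := inj _ _ e
      rw [mul_assoc, mul_eq_left, mul_inv_eq_one] at this
      exact this.symm)
    have hP : ∀ x, f (x * a) = f x * a →
        k (x * a) = f x * a ∧ f (x * a * b⁻¹) = f x * a * b⁻¹ := by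
      intro x hx
      have c₁ := hAB x (x * a) (Or.inr (Or.inl rfl))
      have c₂ := hAB (x * a) (x * a) (Or.inl rfl)
      have c₃ := hAB (x * a * b⁻¹) (x * a) (Or.inr (Or.inr (by simp)))
      have hc : k (x * a) = f x * a := by
        rcases c₁ with c₁ | c₁ | c₁
        · rw [hx, c₁] at c₂
          simp only [mul_assoc, left_eq_mul, haa, ha, false_or] at c₂
          exact absurd (eq_inv_of_mul_eq_one_right c₂) hb3
        · exact c₁
        · rw [hx, c₁] at c₂
          simp only [mul_assoc, mul_right_inj, hb2, hb4, right_eq_mul, ha, false_or] at c₂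
      refine ⟨hc, ?_⟩
      rw [hc] at c₃
      rcases c₃ with c₃ | c₃ | c₃
      · exact absurd (c₃.symm.trans hx.symm) (hinj₁ x)
      · exact absurd (mul_right_cancel c₃).symm (hinj₂ x)
      · exact eq_mul_inv_of_mul_eq c₃.symm
    have hN : ∀ x, f (x * a) = f x * a⁻¹ →
        k (x * a) = f x ∧ f (x * a * b⁻¹) = f x * b⁻¹ := by
      intro x hx
      have c₁ := hAB x (x * a) (Or.inr (Or.inl rfl))
      have c₂ := hAB (x * a) (x * a) (Or.inl rfl)
      have c₃ := hAB (x * a * b⁻¹) (x * a) (Or.inr (Or.inr (by simp)))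
      have hc : k (x * a) = f x := by
        have haa' : a ≠ a⁻¹ := fun e => haa (eq_inv_iff_mul_eq_one.1 e)
        rcases c₁ with c₁ | c₁ | c₁
        · exact c₁
        · rw [hx, c₁] at c₂
          simp only [mul_assoc, mul_right_inj, inv_mul_cancel, mul_one, mul_eq_left, ha, haa',
            false_or] at c₂
          exact absurd (eq_inv_mul_iff_mul_eq.1 c₂).symm hb4
        · rw [hx, c₁] at c₂
          simp only [mul_assoc, mul_right_inj, inv_mul_cancel, mul_one, mul_eq_left, hb1, hb3,
            false_or, right_eq_mul, inv_eq_one, ha] at c₂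
      refine ⟨hc, ?_⟩
      rw [hc] at c₃
      rcases c₃ with c₃ | c₃ | c₃
      · exact absurd c₃.symm (hinj₂ x)
      · exact absurd ((eq_mul_inv_of_mul_eq c₃.symm).trans hx.symm) (hinj₁ x)
      · exact eq_mul_inv_of_mul_eq c₃.symm
    have hPs : ∀ x, f (x * a) = f x * a → f (x * a * a) = f (x * a) * a := by
      intro x hx
      refine (hAA _).resolve_right fun e => haa ?_
      rw [hx, mul_inv_cancel_right] at e
      simpa [mul_assoc] using inj _ _ e
    have hNs : ∀ x, f (x * a) = f x * a⁻¹ → f (x * a * a) = f (x * a) * a⁻¹ := by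
      intro x hx
      refine (hAA _).resolve_left fun e => haa ?_
      rw [hx, inv_mul_cancel_right] at e
      simpa [mul_assoc] using inj _ _ e
    have hne : ∀ x, f (x * a) = f x * a → f (x * a) ≠ f x * a⁻¹ := by
      intro x e₁ e₂
      rw [e₁, mul_right_inj, eq_inv_iff_mul_eq_one] at e₂
      exact haa e₂
    have hcomm : ∀ x, x * a * a * b⁻¹ * a = x * a * b⁻¹ := by
      intro x
      rw [mul_assoc _ b⁻¹, hab, ← mul_assoc, mul_inv_cancel_right]
    have hPb : ∀ x, f (x * a) = f x * a → f (x * a * a * b⁻¹ * a) = f (x * a * a * b⁻¹) * a := by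
      intro x hx
      rw [hcomm, (hP x hx).2, (hP _ (hPs x hx)).2, hx, mul_assoc _ b⁻¹, hab, ← mul_assoc,
        mul_inv_cancel_right]
    have hNb : ∀ x, f (x * a) = f x * a⁻¹ →
        f (x * a * a * b⁻¹ * a) = f (x * a * a * b⁻¹) * a⁻¹ := by
      intro x hx
      rw [hcomm, (hN x hx).2, (hN _ (hNs x hx)).2, hx, mul_assoc _ b⁻¹, hab', ← mul_assoc,
        inv_mul_cancel_right]
    have hiff₁ : ∀ x, f (x * a * a) = f (x * a) * a ↔ f (x * a) = f x * a := by
      intro x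
      refine ⟨fun h => ?_, hPs x⟩
      exact (hAA x).resolve_right fun e => hne _ h (hNs x e)
    have hiff₂ : ∀ x, f (x * b⁻¹ * a) = f (x * b⁻¹) * a ↔ f (x * a) = f x * a := by
      intro x
      have h₁ := hiff₁ (x * a⁻¹)
      have h₂ := hiff₁ (x * a⁻¹ * a⁻¹)
      have h₃ := hPb (x * a⁻¹ * a⁻¹)
      have h₄ := hNb (x * a⁻¹ * a⁻¹)
      simp only [inv_mul_cancel_right] at h₁ h₂ h₃ h₄
      rw [h₁, h₂]
      refine ⟨fun h => ?_, h₃⟩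
      rcases hAA (x * a⁻¹ * a⁻¹) with e | e
      · simpa using e
      · exact absurd (h₄ (by simpa using e)) (hne _ h)
    have hgen' : Subgroup.closure {a, b⁻¹} = ⊤ := by
      rw [eq_top_iff, ← hgen, Subgroup.closure_le]
      rintro x (rfl | rfl)
      · exact Subgroup.subset_closure (by simp)
      · exact inv_mem_iff.1 (Subgroup.subset_closure (by simp))
    have hall := iff_one_of_closure hgen' (fun x => f (x * a) = f x * a) (by
      rintro y (rfl | rfl) x
      · exact hiff₁ x
      · exact hiff₂ x)
    by_cases h1 : f (1 * a) = f 1 * a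
    · have ha' : ∀ x, f (x * a) = f x * a := fun x => (hall x).2 h1
      have hmain := map_eq_mul_of_closure hgen' f (by
        rintro y (rfl | rfl) x
        · exact ha' x
        · have := (hP _ (ha' (x * a⁻¹))).2
          rwa [← ha', inv_mul_cancel_right] at this)
      refine ⟨f 1, ?_⟩
      rintro (x | x)
      · rw [hf, hmain]; rfl
      · have := (hP _ (ha' (x * a⁻¹))).1
        rw [← ha', inv_mul_cancel_right] at this
        rw [hk, this, hmain]; rfl
    · exfalso
      have ha' : ∀ x, f (x * a) = f x * a⁻¹ := fun x =>
        (hAA x).resolve_left fun e => h1 ((hall x).1 e)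
      have hk' : ∀ x, k x = f x * a := by
        intro x
        have := (hN _ (ha' (x * a⁻¹))).1
        have h₂ := ha' (x * a⁻¹)
        rw [inv_mul_cancel_right] at this h₂
        rw [this, h₂, inv_mul_cancel_right]
      have hb' : f (1 * b⁻¹) = f 1 * a * b⁻¹ := by
        have := (hN _ (ha' (1 * a⁻¹))).2
        have h₂ := ha' (1 * a⁻¹)
        rw [inv_mul_cancel_right] at this h₂
        rw [this, h₂, inv_mul_cancel_right]
      have h := hBB 1
      rw [hk', hk', hb', mul_assoc _ b⁻¹, hab, ← mul_assoc, mul_inv_cancel_right] at h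
      rcases h with h | h
      · rw [mul_assoc, mul_right_inj] at h
        have h₂ : a = b⁻¹ * b⁻¹ := eq_mul_inv_of_mul_eq h.symm
        have h₃ : b * a = a * b := by rw [h₂]; group
        rw [hba, mul_left_inj, eq_comm, eq_inv_iff_mul_eq_one] at h₃
        exact haa h₃
      · rw [mul_left_inj, left_eq_mul] at h
        exact ha h
  have := this.realizable
  simpa [Nat.card_sum, two_mul] using this

end QuaternionDouble

section Reflections

variable {G V : Type*} {Γ : SimpleGraph V}

theorem IsAutAction.exists_smul_of_involutive [Group G] [MulAction G V] (h : IsAutAction G Γ)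
    (φ : V → V) (hφ : Function.Involutive φ) (hadj : ∀ x y, Γ.Adj x y → Γ.Adj (φ x) (φ y)) :
    ∃ g : G, ∀ x, φ x = g • x := by
  let ψ : Γ ≃g Γ := ⟨⟨φ, φ, hφ, hφ⟩, fun {x y} => ⟨fun e => by
    have := hadj _ _ e
    change Γ.Adj (φ (φ x)) (φ (φ y)) at this
    rwa [hφ, hφ] at this, hadj x y⟩⟩
  exact h.surj ψ

/-- Reflecting several orbits simultaneously. -/
theorem IsAutAction.sq_smul_eq [CommGroup G] [MulAction G V] (h : IsAutAction G Γ) {k : ℕ}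
    (w : Fin k → V) (hw : ∀ i j, ∀ g : G, g • w i = w j → i = j) (c : Fin k → G)
    (hadj : ∀ i j, i < j → ∀ t : G, Γ.Adj (w i) (t • w j) →
      Γ.Adj (w i) ((c j * (c i)⁻¹ * t⁻¹) • w j))
    (hout : ∀ y, (∀ i, ∀ g : G, g • w i ≠ y) → ∀ i, ∀ g g' : G, Γ.Adj (g • w i) y →
      Γ.Adj (g' • w i) y) (i : Fin k) (g : G) : (g * g) • w i = w i := by
  classical
  let φ : V → V := fun x =>
    if hx : ∃ a : Fin k × G, a.2 • w a.1 = x then (c hx.choose.1 * hx.choose.2⁻¹) • w hx.choose.1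
    else x
  have hφin : ∀ i, ∀ g : G, φ (g • w i) = (c i * g⁻¹) • w i := by
    intro i g
    have hx : ∃ a : Fin k × G, a.2 • w a.1 = g • w i := ⟨(i, g), rfl⟩
    have e := hx.choose_spec
    have hi : hx.choose.1 = i := by
      refine hw _ _ (g⁻¹ * hx.choose.2) ?_
      rw [mul_smul, e, inv_smul_smul]
    simp only [φ, dif_pos hx]
    generalize hx.choose = a at *
    obtain ⟨j, u⟩ := a
    subst hi
    rw [mul_smul, mul_smul]
    congr 1
    rw [inv_smul_eq_iff, smul_smul, mul_comm, mul_smul]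
    exact eq_inv_smul_iff.2 e.symm
  have hφout : ∀ y, (∀ i, ∀ g : G, g • w i ≠ y) → φ y = y := by
    intro y hy
    exact dif_neg fun ⟨a, ha⟩ => hy _ _ ha
  have hcases : ∀ x, (∃ i, ∃ g : G, g • w i = x) ∨ (∀ i, ∀ g : G, g • w i ≠ x) := by
    intro x
    by_contra! hx
    obtain ⟨i, g, e⟩ := hx.2
    exact hx.1 i g e
  have hmove : ∀ i j, ∀ g u : G, Γ.Adj (g • w i) (u • w j) ↔ Γ.Adj (w i) ((g⁻¹ * u) • w j) := by
    intro i j g u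
    rw [← h.adj_iff g⁻¹, inv_smul_smul, smul_smul]
  have hpair : ∀ i j, i ≤ j → ∀ g u : G, Γ.Adj (g • w i) (u • w j) →
      Γ.Adj (φ (g • w i)) (φ (u • w j)) := by
    intro i j hij g u hA
    rw [hφin, hφin, hmove]
    rcases hij.eq_or_lt with rfl | hij
    · rw [hmove, ← h.adj_iff (g⁻¹ * u)⁻¹, inv_smul_smul] at hA
      convert hA.symm using 2
      simp only [mul_inv, inv_inv]
      rw [mul_mul_mul_comm, inv_mul_cancel, one_mul]
    · rw [hmove] at hA
      convert hadj i j hij _ hA using 2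
      simp only [mul_inv, inv_inv]
      rw [mul_mul_mul_comm, mul_comm (c i)⁻¹]
  obtain ⟨g₀, hg₀⟩ := h.exists_smul_of_involutive φ (by
    intro x
    rcases hcases x with ⟨i, g, rfl⟩ | hx
    · rw [hφin, hφin, mul_inv, mul_inv_cancel_left, inv_inv]
    · rw [hφout x hx, hφout x hx]) (by
    intro x y hxy
    rcases hcases x with ⟨i, g, rfl⟩ | hx <;> rcases hcases y with ⟨j, u, rfl⟩ | hy
    · rcases le_total i j with hij | hij
      · exact hpair i j hij g u hxy
      · exact (hpair j i hij u g hxy.symm).symm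
    · rw [hφin, hφout y hy]
      exact hout y hy i _ _ hxy
    · rw [hφin, hφout x hx]
      exact (hout x hx j _ _ hxy.symm).symm
    · rwa [hφout x hx, hφout y hy])
  have h₁ := hg₀ (w i)
  have h₂ := hg₀ (g⁻¹ • w i)
  have h₃ := hφin i 1
  rw [one_smul, inv_one, mul_one, h₁] at h₃
  rw [hφin, inv_inv, smul_smul, mul_comm g₀, mul_smul g⁻¹, h₃, smul_smul, mul_comm g⁻¹, mul_smul,
    mul_smul] at h₂
  rw [mul_smul, smul_left_cancel _ h₂, smul_inv_smul]

/-- A commuting involution and the elements squaring to it. -/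
theorem IsAutAction.false_of_sq_eq [Group G] [MulAction G V] (h : IsAutAction G Γ) {z : G}
    (hz1 : z ≠ 1) (hzz : z * z = 1) (hzc : ∀ g, z * g = g * z) (hz : ∀ g : G, g ≠ 1 → z ∈ Subgroup.zpowers g)
    (A : Subgroup G) (hA : A ≠ ⊤) (hAz : ∀ t ∉ A, t * t = z) {v : V} (hv : z • v ≠ v)
    (hout : ∀ w, (∀ g : G, g • v ≠ w) → z • w = w) : False := by
  classical
  have hstab : ∀ g : G, g • v = v → g = 1 := by
    intro g hg
    by_contra hg1
    have : Subgroup.zpowers g ≤ MulAction.stabilizer G v := by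
      rw [Subgroup.zpowers_le]
      exact hg
    exact hv (this (hz g hg1))
  have hfree : ∀ g g' : G, g • v = g' • v → g = g' := by
    intro g g' e
    have := hstab (g'⁻¹ * g) (by rw [mul_smul, e, inv_smul_smul])
    exact (inv_mul_eq_one.1 this).symm
  obtain ⟨t, ht⟩ : ∃ t, t ∉ A := by
    by_contra! hall
    exact hA (eq_top_iff.2 fun x _ => hall x)
  have hzA : z ∈ A := by
    by_contra hzA
    exact hz1 ((hAz z hzA).symm.trans hzz)
  let φ : V → V := fun x => if ∃ g : G, g ∉ A ∧ g • v = x then z • x else x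
  have hφin : ∀ g : G, g ∉ A → φ (g • v) = (g * z) • v := by
    intro g hg
    rw [← hzc, mul_smul]
    exact if_pos ⟨g, hg, rfl⟩
  have hφA : ∀ g : G, g ∈ A → φ (g • v) = g • v := by
    intro g hg
    refine if_neg ?_
    rintro ⟨g', hg', e⟩
    exact hg' (hfree _ _ e ▸ hg)
  have hφout : ∀ w, (∀ g : G, g • v ≠ w) → φ w = w := fun w hw => if_neg fun ⟨g, _, e⟩ => hw g e
  have hcases : ∀ x, (∃ g : G, g ∈ A ∧ g • v = x) ∨ (∃ g : G, g ∉ A ∧ g • v = x) ∨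
      ∀ g : G, g • v ≠ x := by
    intro x
    by_contra! hx
    obtain ⟨g, e⟩ := hx.2.2
    by_cases hg : g ∈ A
    · exact hx.1 g hg e
    · exact hx.2.1 g hg e
  have hmove : ∀ g u : G, Γ.Adj (g • v) (u • v) ↔ Γ.Adj v ((g⁻¹ * u) • v) := by
    intro g u
    rw [← h.adj_iff g⁻¹, inv_smul_smul, smul_smul]
  have hAB : ∀ g u : G, g ∈ A → u ∉ A → Γ.Adj (g • v) (u • v) → Γ.Adj (g • v) ((u * z) • v) := by
    intro g u hg hu hadj
    rw [hmove] at hadj ⊢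
    have hgu : g⁻¹ * u ∉ A := fun e => hu ((A.mul_mem_cancel_left (A.inv_mem hg)).1 e)
    have e : (g⁻¹ * u)⁻¹ = g⁻¹ * (u * z) := by
      rw [← mul_assoc, inv_eq_iff_mul_eq_one, ← mul_assoc, hAz _ hgu, hzz]
    rw [← e]
    rw [← h.adj_iff (g⁻¹ * u)⁻¹, inv_smul_smul] at hadj
    exact hadj.symm
  have hO : ∀ (g : G) w, (∀ g : G, g • v ≠ w) → Γ.Adj (g • v) w → Γ.Adj ((g * z) • v) w := by
    intro g w hw hadj
    rw [← h.adj_iff z, hout w hw, smul_smul, hzc] at hadj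
    exact hadj
  obtain ⟨g₀, hg₀⟩ := h.exists_smul_of_involutive φ (by
    intro x
    rcases hcases x with ⟨g, hg, rfl⟩ | ⟨g, hg, rfl⟩ | hx
    · rw [hφA g hg, hφA g hg]
    · rw [hφin g hg, hφin _ fun e => hg ((A.mul_mem_cancel_right hzA).1 e), mul_assoc, hzz, mul_one]
    · rw [hφout x hx, hφout x hx]) (by
    intro x y hxy
    rcases hcases x with ⟨g, hg, rfl⟩ | ⟨g, hg, rfl⟩ | hx <;>
    rcases hcases y with ⟨u, hu, rfl⟩ | ⟨u, hu, rfl⟩ | hy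
    · rwa [hφA g hg, hφA u hu]
    · rw [hφA g hg, hφin u hu]
      exact hAB g u hg hu hxy
    · rwa [hφA g hg, hφout y hy]
    · rw [hφA u hu, hφin g hg]
      exact (hAB u g hu hg hxy.symm).symm
    · rw [hφin g hg, hφin u hu, ← hzc, ← hzc, mul_smul, mul_smul, h.adj_iff]
      exact hxy
    · rw [hφin g hg, hφout y hy]
      exact hO g y hy hxy
    · rwa [hφout x hx, hφA u hu]
    · rw [hφin u hu, hφout x hx]
      exact (hO u x hx hxy.symm).symm
    · rwa [hφout x hx, hφout y hy])
  have h₁ := hg₀ ((1 : G) • v)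
  have h₂ := hg₀ (t • v)
  rw [hφA 1 A.one_mem, one_smul] at h₁
  rw [hφin t ht, hstab g₀ h₁.symm, one_smul] at h₂
  exact hz1 (by simpa using hfree _ _ h₂)

end Reflections

section Reflections

variable {G V : Type*} {Γ : SimpleGraph V}

theorem smul_right_cancel_of_stabilizer [Group G] [MulAction G V] {v : V}
    (hv : ∀ g : G, g • v = v → g = 1) {g g' : G} (e : g • v = g' • v) : g = g' :=
  (inv_mul_eq_one.1 (hv (g'⁻¹ * g) (by rw [mul_smul, e, inv_smul_smul]))).symm

theorem injective_of_free_orbits [Group G] [MulAction G V] {v v' : V}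
    (hv : ∀ g : G, g • v = v → g = 1) (hv' : ∀ g : G, g • v' = v' → g = 1)
    (hvv : ∀ g : G, g • v ≠ v') :
    Function.Injective (Sum.elim (fun g : G => g • v) fun g : G => g • v') := by
  refine Function.Injective.sumElim (fun _ _ => smul_right_cancel_of_stabilizer hv)
    (fun _ _ => smul_right_cancel_of_stabilizer hv') fun a b e => hvv (b⁻¹ * a) ?_
  rw [mul_smul, e, inv_smul_smul]

theorem two_mul_card_le_of_free_orbits [Group G] [MulAction G V] [Finite G] [Finite V] {v v' : V}
    (hv : ∀ g : G, g • v = v → g = 1) (hv' : ∀ g : G, g • v' = v' → g = 1)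
    (hvv : ∀ g : G, g • v ≠ v') : 2 * Nat.card G ≤ Nat.card V := by
  have := Nat.card_le_card_of_injective _ (injective_of_free_orbits hv hv' hvv)
  rwa [Nat.card_sum, ← two_mul] at this

theorem exists_smul_eq_of_free_orbits [Group G] [MulAction G V] [Finite G] [Finite V] {v v' : V}
    (hV : Nat.card V ≤ 2 * Nat.card G)
    (hv : ∀ g : G, g • v = v → g = 1) (hv' : ∀ g : G, g • v' = v' → g = 1)
    (hvv : ∀ g : G, g • v ≠ v') (x : V) : (∃ g : G, g • v = x) ∨ ∃ g : G, g • v' = x := by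
  have := (injective_of_free_orbits hv hv' hvv).bijective_of_nat_card_le
    (by rwa [Nat.card_sum, ← two_mul])
  obtain ⟨g | g, hg⟩ := this.surjective x
  · exact Or.inl ⟨g, hg⟩
  · exact Or.inr ⟨g, hg⟩

theorem IsAutAction.adj_smul_of_factor [CommGroup G] [MulAction G V] (h : IsAutAction G Γ)
    {w y : V} (hst : ∀ g : G, ∃ s t : G, s • w = w ∧ t • y = y ∧ g = s * t) (g g' : G)
    (hA : Γ.Adj (g • w) y) : Γ.Adj (g' • w) y := by
  obtain ⟨s, t, hs, ht, e⟩ := hst (g' * g⁻¹)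
  rw [← h.adj_iff t, ht, smul_smul] at hA
  rw [mul_inv_eq_iff_eq_mul.1 e, mul_assoc, mul_comm, mul_smul, hs]
  exact hA

theorem IsAutAction.sq_smul_eq_of_fixed [CommGroup G] [MulAction G V] (h : IsAutAction G Γ)
    {v : V} (hout : ∀ y, (∀ g : G, g • v ≠ y) → ∀ g : G, ∃ s t : G, s • v = v ∧ t • y = y ∧ g = s * t)
    (g : G) : (g * g) • v = v :=
  h.sq_smul_eq (fun _ : Fin 1 => v) (fun i j _ _ => Subsingleton.elim i j) (fun _ => 1)
    (fun i j hij => absurd hij (by rw [Subsingleton.elim i j]; exact lt_irrefl j))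
    (fun y hy _ => h.adj_smul_of_factor (hout y (hy 0))) 0 g

theorem IsAutAction.sq_smul_eq_of_pair [CommGroup G] [MulAction G V] (h : IsAutAction G Γ)
    {v v' : V} (hvv : ∀ g : G, g • v ≠ v') {c : G}
    (hc : ∀ t : G, Γ.Adj v (t • v') → Γ.Adj v ((c * t⁻¹) • v'))
    (hout : ∀ y, (∀ g : G, g • v ≠ y) → (∀ g : G, g • v' ≠ y) → ∀ g : G,
      (∃ s t : G, s • v = v ∧ t • y = y ∧ g = s * t) ∧
      ∃ s t : G, s • v' = v' ∧ t • y = y ∧ g = s * t)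
    (g : G) : (g * g) • v = v := by
  have hvv' : ∀ g : G, g • v' ≠ v := fun g e => hvv g⁻¹ (by rw [← e, inv_smul_smul])
  refine h.sq_smul_eq ![v, v'] ?_ ![1, c] ?_ ?_ 0 g
  · intro i j g e
    fin_cases i <;> fin_cases j
    · rfl
    · exact absurd e (hvv g)
    · exact absurd e (hvv' g)
    · rfl
  · intro i j hij t ht
    fin_cases i <;> fin_cases j
    · exact absurd hij (lt_irrefl _)
    · simpa using hc t ht
    · exact absurd hij (by decide)
    · exact absurd hij (lt_irrefl _)
  · intro y hy i
    have := hout y (hy 0) (hy 1)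
    fin_cases i
    · exact h.adj_smul_of_factor fun g => (this g).1
    · exact h.adj_smul_of_factor fun g => (this g).2

theorem IsAutAction.false_of_free_orbits [CommGroup G] [MulAction G V] [Finite G] [Finite V]
    (h : IsAutAction G Γ) (hV : Nat.card V ≤ 2 * Nat.card G) {v v' : V}
    (hv : ∀ g : G, g • v = v → g = 1) (hv' : ∀ g : G, g • v' = v' → g = 1)
    (hvv : ∀ g : G, g • v ≠ v') (hG : ∃ g : G, g * g ≠ 1)
    (hT : ∀ T : G → Prop, ∃ c : G, ∀ t, T t → T (c * t⁻¹)) : False := by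
  obtain ⟨g, hg⟩ := hG
  obtain ⟨c, hc⟩ := hT fun t => Γ.Adj v (t • v')
  refine hg (hv _ (h.sq_smul_eq_of_pair hvv hc (fun y h₁ h₂ => ?_) g))
  rcases exists_smul_eq_of_free_orbits hV hv hv' hvv y with ⟨u, e⟩ | ⟨u, e⟩
  · exact absurd e (h₁ u)
  · exact absurd e (h₂ u)

theorem IsAutAction.exists_smul_ne [Group G] [MulAction G V] (h : IsAutAction G Γ) {g : G}
    (hg : g ≠ 1) : ∃ v : V, g • v ≠ v := by
  by_contra! hall
  exact hg (h.faithful g hall)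

theorem not_realizable_of_prime_card [CommGroup G] {p m : ℕ} (hp : p.Prime) (hp2 : p ≠ 2)
    (hG : Nat.card G = p)
    (hm : m < 2 * p ∨ m = 2 * p ∧ ∀ T : G → Prop, ∃ c : G, ∀ t, T t → T (c * t⁻¹)) :
    ¬ Realizable G m := by
  intro hR
  obtain ⟨Γ, _, h⟩ := hR.exists_action
  have := Fact.mk hp
  have : Finite G := Nat.finite_of_card_ne_zero (hG ▸ hp.ne_zero)
  have : Nontrivial G := Finite.one_lt_card_iff_nontrivial.1 (hG ▸ hp.one_lt)
  have hV : Nat.card (Fin m) = m := by simp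
  obtain ⟨g, hg⟩ := exists_ne (1 : G)
  have hgg : g * g ≠ 1 := by
    intro e
    have h₁ := orderOf_eq_prime (p := p) (by rw [← hG, pow_card_eq_one']) hg
    have h₂ := orderOf_dvd_of_pow_eq_one ((sq g).trans e)
    rw [h₁] at h₂
    exact hp2 ((Nat.prime_dvd_prime_iff_eq hp Nat.prime_two).1 h₂)
  have hfree : ∀ v : Fin m, ∀ u : G, u • v ≠ v → ∀ g : G, g • v = v → g = 1 := by
    intro v u hu g hg
    by_contra hg1
    have hz : Subgroup.zpowers g ≤ MulAction.stabilizer G v := by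
      rw [Subgroup.zpowers_le]
      exact hg
    rw [zpowers_eq_top_of_prime_card hG hg1] at hz
    exact hu (hz (Subgroup.mem_top u))
  obtain ⟨v, hv⟩ := h.exists_smul_ne hg
  by_cases h2 : ∃ v' : Fin m, (∀ g : G, g • v ≠ v') ∧ ∃ u : G, u • v' ≠ v'
  · obtain ⟨v', hvv, u, hu⟩ := h2
    have hle := two_mul_card_le_of_free_orbits (hfree v g hv) (hfree v' u hu) hvv
    rw [hV, hG] at hle
    rcases hm with hm | ⟨hm, hT⟩
    · omega
    · exact h.false_of_free_orbits (by rw [hV, hG, hm]) (hfree v g hv) (hfree v' u hu) hvv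
        ⟨g, hgg⟩ hT
  · push Not at h2
    exact hgg (hfree v g hv _ (h.sq_smul_eq_of_fixed
      (fun y hy u => ⟨1, u, one_smul G v, h2 y hy u, (one_mul u).symm⟩) g))

end Reflections

theorem exists_reflection_zmod {k : ℕ} (hk : k = 3 ∨ k = 4 ∨ k = 5)
    (T : Multiplicative (ZMod k) → Prop) : ∃ c, ∀ t, T t → T (c * t⁻¹) := by
  classical
  have h3 : ∀ T : Fin 3 → Bool, ∃ c, ∀ t, T t → T (c - t) := by decide
  have h4 : ∀ T : Fin 4 → Bool, ∃ c, ∀ t, T t → T (c - t) := by decide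
  have h5 : ∀ T : Fin 5 → Bool, ∃ c, ∀ t, T t → T (c - t) := by decide +kernel
  have key : ∃ c : ZMod k, ∀ t, decide (T (Multiplicative.ofAdd t)) = true →
      decide (T (Multiplicative.ofAdd (c - t))) = true := by
    rcases hk with rfl | rfl | rfl
    · exact h3 fun t => decide (T (Multiplicative.ofAdd t))
    · exact h4 fun t => decide (T (Multiplicative.ofAdd t))
    · exact h5 fun t => decide (T (Multiplicative.ofAdd t))
  obtain ⟨c, hc⟩ := key
  refine ⟨Multiplicative.ofAdd c, fun t ht => ?_⟩
  have := of_decide_eq_true (hc (Multiplicative.toAdd t) (decide_eq_true ht))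
  rwa [sub_eq_add_neg] at this

theorem not_realizable_small_prime {p : ℕ} (hp : p = 3 ∨ p = 5) :
    ¬ Realizable (Multiplicative (ZMod p)) (2 * p) := by
  refine not_realizable_of_prime_card (p := p) ?_ ?_ ?_
    (Or.inr ⟨rfl, exists_reflection_zmod (by tauto)⟩)
  · rcases hp with rfl | rfl <;> norm_num
  · rcases hp with rfl | rfl <;> norm_num
  · exact Nat.card_zmod p

theorem not_realizable_four : ¬ Realizable (Multiplicative (ZMod 4)) 8 := by
  intro hR
  obtain ⟨Γ, _, h⟩ := hR.exists_action
  let z : Multiplicative (ZMod 4) := Multiplicative.ofAdd 2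
  have hz1 : z ≠ 1 := by decide
  have hV : Nat.card (Fin 8) ≤ 2 * Nat.card (Multiplicative (ZMod 4)) := by
    rw [show Nat.card (Multiplicative (ZMod 4)) = 4 from Nat.card_zmod 4]
    simp
  have hpow : ∀ g : Multiplicative (ZMod 4), g ≠ 1 → z ∈ Subgroup.zpowers g := by
    have : ∀ g : Multiplicative (ZMod 4), g ≠ 1 → z = g ∨ z = g ^ 2 := by decide
    intro g hg
    rcases this g hg with e | e <;> rw [e]
    · exact Subgroup.mem_zpowers g
    · exact Subgroup.npow_mem_zpowers g 2
  have hfree : ∀ v : Fin 8, z • v ≠ v → ∀ g : Multiplicative (ZMod 4), g • v = v → g = 1 := by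
    intro v hv g hg
    by_contra hg1
    have : Subgroup.zpowers g ≤ MulAction.stabilizer _ v := by
      rw [Subgroup.zpowers_le]
      exact hg
    exact hv (this (hpow g hg1))
  obtain ⟨v, hv⟩ := h.exists_smul_ne hz1
  by_cases h2 : ∃ v' : Fin 8, (∀ g : Multiplicative (ZMod 4), g • v ≠ v') ∧ z • v' ≠ v'
  · obtain ⟨v', hvv, hv'⟩ := h2
    exact h.false_of_free_orbits hV (hfree v hv) (hfree v' hv') hvv
      ⟨Multiplicative.ofAdd 1, by decide⟩ (exists_reflection_zmod (by tauto))
  · push Not at h2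
    refine h.false_of_sq_eq hz1 (by decide) (fun g => mul_comm z g) hpow
      (powMonoidHom 2 : Multiplicative (ZMod 4) →* _).ker ?_ ?_ hv h2
    · intro e
      have := MonoidHom.mem_ker.1 (e ▸ Subgroup.mem_top (Multiplicative.ofAdd (1 : ZMod 4)))
      revert this
      decide
    · intro t ht
      rw [MonoidHom.mem_ker] at ht
      revert ht
      revert t
      decide

section UniqueInvolution

variable {G : Type*} [Group G] {z : G}

theorem mul_comm_of_unique_involution (hz1 : z ≠ 1) (hz : ∀ t : G, t * t = 1 ↔ t = 1 ∨ t = z)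
    (g : G) : z * g = g * z := by
  have hzz := (hz z).2 (Or.inr rfl)
  rcases (hz (g * z * g⁻¹)).1 (by
    rw [show g * z * g⁻¹ * (g * z * g⁻¹) = g * (z * z) * g⁻¹ by group, hzz]; simp) with e | e
  · exact absurd (conj_eq_one_iff.1 e) hz1
  · rw [mul_inv_eq_iff_eq_mul] at e
    exact e.symm

theorem mem_zpowers_of_unique_involution (hz : ∀ t : G, t * t = 1 ↔ t = 1 ∨ t = z)
    {g : G} (hg : ∃ a : ℕ, orderOf g = 2 ^ a) (hg1 : g ≠ 1) : z ∈ Subgroup.zpowers g := by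
  obtain ⟨a, ha⟩ := hg
  obtain _ | a := a
  · exact absurd (orderOf_eq_one_iff.1 ha) hg1
  · rcases (hz (g ^ 2 ^ a)).1 (by rw [← pow_add, ← two_mul, ← pow_succ', ← ha, pow_orderOf_eq_one])
      with e | e
    · have := orderOf_dvd_of_pow_eq_one e
      rw [ha, Nat.pow_dvd_pow_iff_le_right (by norm_num)] at this
      omega
    · rw [← e]
      exact Subgroup.npow_mem_zpowers g _

theorem exists_orderOf_eq_two_pow {k : ℕ} (hG : Nat.card G = 2 ^ k) (g : G) :
    ∃ a : ℕ, orderOf g = 2 ^ a := by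
  obtain ⟨a, -, ha⟩ := (Nat.dvd_prime_pow Nat.prime_two).1 (hG ▸ orderOf_dvd_natCard g)
  exact ⟨a, ha⟩

theorem not_realizable_of_sq_eq [Finite G] (hG : ∀ g : G, ∃ a : ℕ, orderOf g = 2 ^ a)
    (hz1 : z ≠ 1) (hz : ∀ t : G, t * t = 1 ↔ t = 1 ∨ t = z) (A : Subgroup G) (hA : A ≠ ⊤)
    (hAz : ∀ t ∉ A, t * t = z) {m : ℕ} (hm : m < 2 * Nat.card G) : ¬ Realizable G m := by
  intro hR
  obtain ⟨Γ, _, h⟩ := hR.exists_action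
  have hpow : ∀ g : G, g ≠ 1 → z ∈ Subgroup.zpowers g := fun g =>
    mem_zpowers_of_unique_involution hz (hG g)
  have hfree : ∀ v : Fin m, z • v ≠ v → ∀ g : G, g • v = v → g = 1 := by
    intro v hv g hg
    by_contra hg1
    have : Subgroup.zpowers g ≤ MulAction.stabilizer _ v := by
      rw [Subgroup.zpowers_le]
      exact hg
    exact hv (this (hpow g hg1))
  obtain ⟨v, hv⟩ := h.exists_smul_ne hz1
  refine h.false_of_sq_eq hz1 ((hz z).2 (Or.inr rfl)) (mul_comm_of_unique_involution hz1 hz) hpow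
    A hA hAz hv fun w hw => ?_
  by_contra hzw
  have := two_mul_card_le_of_free_orbits (hfree v hv) (hfree w hzw) hw
  rw [Nat.card_fin] at this
  omega

end UniqueInvolution

section Quaternion

open QuaternionGroup

theorem quaternionGroup_mem_zpowers {n : ℕ} (i : ZMod (2 * n)) :
    (a i : QuaternionGroup n) ∈ Subgroup.zpowers (a 1) := by
  obtain ⟨k, rfl⟩ := ZMod.intCast_surjective i
  refine ⟨k, ?_⟩
  induction k using Int.induction_on with
  | zero => simp
  | succ k ih => simp_all [zpow_add_one]
  | pred k ih =>
    simp only [zpow_sub_one, ih]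
    rw [mul_inv_eq_iff_eq_mul, a_mul_a]
    simp

theorem quaternionGroup_xa_notMem {n : ℕ} (i : ZMod (2 * n)) :
    (xa i : QuaternionGroup n) ∉ Subgroup.zpowers (a 1) := by
  have h : ∀ k : ℕ, (a 1 : QuaternionGroup n) ^ (-(k : ℤ)) = a (-k) := by
    intro k
    rw [zpow_neg, zpow_natCast, a_one_pow, inv_eq_iff_mul_eq_one, a_mul_a]
    simp
  rintro ⟨k, hk⟩
  obtain ⟨k, rfl | rfl⟩ := k.eq_nat_or_neg
  · simp at hk
  · simp [h] at hk

theorem not_realizable_quaternionGroup {k m : ℕ} (hm : m < 8 * 2 ^ k) :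
    ¬ Realizable (QuaternionGroup (2 ^ k)) m := by
  have hcard : Nat.card (QuaternionGroup (2 ^ k)) = 4 * 2 ^ k := by
    rw [Nat.card_eq_fintype_card, QuaternionGroup.card]
  have : NeZero (2 * 2 ^ k) := ⟨by positivity⟩
  have hne : ((2 ^ k : ℕ) : ZMod (2 * 2 ^ k)) ≠ 0 := by
    rw [Ne, ZMod.natCast_eq_zero_iff]
    intro h
    have := Nat.le_of_dvd (by positivity) h
    have : 0 < 2 ^ k := by positivity
    omega
  refine not_realizable_of_sq_eq (z := a ((2 ^ k : ℕ) : ZMod (2 * 2 ^ k)))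
    (exists_orderOf_eq_two_pow (k := k + 2) (by rw [hcard]; ring)) ?_ ?_
    (Subgroup.zpowers (a 1)) ?_ ?_ (by rw [hcard]; omega)
  · rw [one_def]
    exact fun h => hne (a.inj h)
  · rintro (i | i)
    · rw [a_mul_a, one_def, a.injEq, a.injEq, a.injEq]
      obtain ⟨i, hi, rfl⟩ : ∃ j : ℕ, j < 2 * 2 ^ k ∧ i = j :=
        ⟨i.val, i.val_lt, (ZMod.natCast_zmod_val i).symm⟩
      rw [← Nat.cast_add, ZMod.natCast_eq_zero_iff]
      constructor
      · rintro ⟨c, hc⟩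
        have : c < 2 := by
          by_contra! h
          have := Nat.mul_le_mul_left (2 * 2 ^ k) h
          omega
        interval_cases c
        · left
          rw [show i = 0 by omega, Nat.cast_zero]
        · right
          rw [show i = 2 ^ k by omega]
      · rintro (h | h)
        · rw [ZMod.natCast_eq_zero_iff] at h
          exact dvd_add h h
        · rw [← ZMod.natCast_eq_zero_iff, Nat.cast_add, h, ← Nat.cast_add, ← two_mul,
            ZMod.natCast_self]
    · rw [xa_mul_xa, one_def, add_sub_cancel_right, a.injEq]
      simp only [hne, reduceCtorEq, or_self]
  · intro e
    exact quaternionGroup_xa_notMem (0 : ZMod (2 * 2 ^ k)) (e ▸ Subgroup.mem_top _)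
  · rintro (i | i) hi
    · exact absurd (quaternionGroup_mem_zpowers i) hi
    · rw [xa_mul_xa]
      simp

theorem realizable_quaternionGroup {m : ℕ} (hm : 2 ≤ m) :
    Realizable (QuaternionGroup m) (2 * Nat.card (QuaternionGroup m)) := by
  have : NeZero m := ⟨by omega⟩
  have hcard : Nat.card (QuaternionGroup m) = 4 * m := by
    rw [Nat.card_eq_fintype_card, QuaternionGroup.card]
  refine realizable_of_conj_inv (a := a 1) (b := xa 0) ?_ ?_ (quaternionGroup_xa_notMem 0) ?_
    (by omega)
  · rw [eq_inv_mul_iff_mul_eq]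
    simp
  · intro e
    have := orderOf_dvd_of_pow_eq_one ((sq (a 1 : QuaternionGroup m)).trans e)
    rw [orderOf_a_one] at this
    have := Nat.le_of_dvd (by norm_num) this
    omega
  · rw [eq_top_iff]
    have ha : ∀ i, a i ∈ Subgroup.closure {a 1, (xa 0 : QuaternionGroup m)} := fun i =>
      (Subgroup.zpowers_le.2 (Subgroup.subset_closure (by simp))) (quaternionGroup_mem_zpowers i)
    rintro (i | i) -
    · exact ha i
    · rw [show (xa i : QuaternionGroup m) = xa 0 * a i by simp]
      exact mul_mem (Subgroup.subset_closure (by simp)) (ha i)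

end Quaternion

section NineFacts

theorem zmod_three_prod_span : ∀ h₁ h₂ : ZMod 3 × ZMod 3, h₁ ≠ 0 → (∀ i : Fin 3, h₂ ≠ i.val • h₁) →
    ∀ t, ∃ i j : Fin 3, t = i.val • h₁ + j.val • h₂ := by
  decide +kernel

theorem zmod_three_prod_compl : ∀ h : ZMod 3 × ZMod 3, h ≠ 0 → ∃ u : ZMod 3 × ZMod 3,
    ∀ i : Fin 3, u ≠ i.val • h := by
  decide +kernel

theorem zmod_three_prod_transvection : ∀ h : ZMod 3 × ZMod 3, h ≠ 0 → ∀ s₁ s₂ s₃ s₄ : Bool,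
    ∃ a b : ZMod 3, a * h.1 + b * h.2 = 1 ∧ ∀ e ∈ [((1, 0), s₁), ((0, 1), s₂), ((1, 1), s₃), ((1, 2), s₄)],
      e.2 = true → ∃ e' ∈ [((1, 0), s₁), ((0, 1), s₂), ((1, 1), s₃), ((1, 2), s₄)], e'.2 = true ∧
        (e.1 + (a * e.1.1 + b * e.1.2) • h = e'.1 ∨ e.1 + (a * e.1.1 + b * e.1.2) • h = -e'.1) := by
  decide +kernel

theorem zmod_three_prod_sign : ∀ s : ZMod 3 × ZMod 3, s ≠ 0 →
    ∃ e ∈ [((1 : ZMod 3), (0 : ZMod 3)), (0, 1), (1, 1), (1, 2)], s = e ∨ s = -e := by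
  decide

end NineFacts

section Nine

/-- The elementary abelian group of order nine. -/
abbrev NineGroup := Multiplicative (ZMod 3 × ZMod 3)

open Multiplicative

theorem NineGroup.exists_involution {h : NineGroup} (hh : h ≠ 1) (S : NineGroup → Prop)
    (hS : ∀ s, S s → S s⁻¹) : ∃ θ : NineGroup →* NineGroup, (∀ x, θ (θ x) = x) ∧ θ h ≠ h ∧
      (∀ x, ∃ i : ℕ, θ x = x * h ^ i) ∧ ∀ s, S s → S (θ s) := by
  classical
  obtain ⟨a, b, hab, key⟩ := zmod_three_prod_transvection (toAdd h) hh (decide (S (ofAdd (1, 0))))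
    (decide (S (ofAdd (0, 1)))) (decide (S (ofAdd (1, 1)))) (decide (S (ofAdd (1, 2))))
  let F : ZMod 3 × ZMod 3 →+ ZMod 3 × ZMod 3 := AddMonoidHom.mk'
    (fun x => x + (a * x.1 + b * x.2) • toAdd h) (by
      intro x y
      ext <;> simp <;> ring)
  have hF : ∀ x, F x = x + (a * x.1 + b * x.2) • toAdd h := fun x => rfl
  have hS' : ∀ s : ZMod 3 × ZMod 3, S (ofAdd s) ↔ S (ofAdd (-s)) := fun s =>
    ⟨hS (ofAdd s), fun e => by simpa using hS (ofAdd (-s)) e⟩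
  set L : List ((ZMod 3 × ZMod 3) × Bool) := [((1, 0), decide (S (ofAdd (1, 0)))),
    ((0, 1), decide (S (ofAdd (0, 1)))), ((1, 1), decide (S (ofAdd (1, 1)))),
    ((1, 2), decide (S (ofAdd (1, 2))))] with hL
  have hLS : ∀ e ∈ L, e.2 = true → S (ofAdd e.1) := by
    intro e he
    simp only [hL, List.mem_cons, List.not_mem_nil, or_false] at he
    rcases he with rfl | rfl | rfl | rfl <;> exact of_decide_eq_true
  have hLe : ∀ e ∈ [((1 : ZMod 3), (0 : ZMod 3)), (0, 1), (1, 1), (1, 2)],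
      (e, decide (S (ofAdd e))) ∈ L := by
    intro e he
    simp only [List.mem_cons, List.not_mem_nil, or_false] at he
    rcases he with rfl | rfl | rfl | rfl <;> simp [hL]
  have hFS : ∀ e ∈ [((1 : ZMod 3), (0 : ZMod 3)), (0, 1), (1, 1), (1, 2)], S (ofAdd e) →
      S (ofAdd (F e)) := by
    intro e he hSe
    obtain ⟨e', he', h₂, h₃ | h₃⟩ := key _ (hLe e he) (decide_eq_true hSe)
    · rw [hF, h₃]
      exact hLS e' he' h₂
    · rw [hF, h₃, ← hS']
      exact hLS e' he' h₂
  refine ⟨AddMonoidHom.toMultiplicative F, fun x => ?_, fun e => ?_, fun x => ?_, fun s hs => ?_⟩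
  · change F (F (toAdd x)) = toAdd x
    have h3 : ∀ x : ZMod 3, x + x + x = 0 := by decide
    generalize toAdd x = y
    obtain ⟨y₁, y₂⟩ := y
    ext
    · simp only [hF, Prod.fst_add, Prod.snd_add, Prod.smul_fst, Prod.smul_snd, smul_eq_mul]
      linear_combination (a * y₁ + b * y₂) * (toAdd h).1 * hab + h3 ((a * y₁ + b * y₂) * (toAdd h).1)
    · simp only [hF, Prod.fst_add, Prod.snd_add, Prod.smul_fst, Prod.smul_snd, smul_eq_mul]
      linear_combination (a * y₁ + b * y₂) * (toAdd h).2 * hab + h3 ((a * y₁ + b * y₂) * (toAdd h).2)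
  · have : F (toAdd h) = toAdd h := e
    rw [hF, hab, one_smul, add_eq_left] at this
    exact hh this
  · refine ⟨(a * (toAdd x).1 + b * (toAdd x).2).val, ?_⟩
    change F (toAdd x) = toAdd x + (a * (toAdd x).1 + b * (toAdd x).2).val • toAdd h
    rw [hF, ← Nat.cast_smul_eq_nsmul (ZMod 3), ZMod.natCast_zmod_val]
  · change S (ofAdd (F (toAdd s)))
    by_cases hs0 : toAdd s = 0
    · rw [hs0, map_zero, ← hs0]
      exact hs
    · obtain ⟨e, he, h₁ | h₁⟩ := zmod_three_prod_sign _ hs0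
      · rw [h₁]
        exact hFS e he (h₁ ▸ hs)
      · rw [h₁, map_neg, ← hS']
        exact hFS e he ((hS' e).2 (h₁ ▸ hs))

theorem NineGroup.exists_eq_pow_mul_pow {h₁ h₂ : NineGroup} (hh : h₁ ≠ 1) (hne : ∀ i : ℕ, h₂ ≠ h₁ ^ i)
    (t : NineGroup) : ∃ i j : ℕ, t = h₁ ^ i * h₂ ^ j := by
  obtain ⟨i, j, e⟩ := zmod_three_prod_span (toAdd h₁) (toAdd h₂) hh (fun i => hne i) (toAdd t)
  exact ⟨i, j, e⟩

theorem NineGroup.exists_reflection {h : NineGroup} (hh : h ≠ 1) (T : NineGroup → Prop)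
    (hT : ∀ t, T t → T (t * h)) : ∃ c, ∀ t, T t → T (c * t⁻¹) := by
  obtain ⟨u, hu⟩ := zmod_three_prod_compl (toAdd h) hh
  have hT' : ∀ t, ∀ i : ℕ, T t → T (t * h ^ i) := by
    intro t i ht
    induction i with
    | zero => simpa using ht
    | succ i ih =>
      rw [pow_succ, ← mul_assoc]
      exact hT _ ih
  have h3 : ∀ g : NineGroup, g ^ 3 = 1 := by decide
  have h9 : ∀ g : NineGroup, g⁻¹ = g ^ 2 := by decide
  obtain ⟨c, hc⟩ := exists_reflection_zmod (k := 3) (Or.inl rfl) fun i =>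
    T (ofAdd u ^ (toAdd i).val)
  refine ⟨ofAdd u ^ (toAdd c).val, fun t ht => ?_⟩
  obtain ⟨i, j, e⟩ := zmod_three_prod_span (toAdd h) u hh hu (toAdd t)
  have e' : t = h ^ i.val * ofAdd u ^ j.val := e
  have h₁ : T (ofAdd u ^ j.val) := by
    have := hT' t (2 * i.val) ht
    rwa [e', mul_right_comm, ← pow_add, show i.val + 2 * i.val = 3 * i.val by ring, pow_mul, h3,
      one_pow, one_mul] at this
  have h₄ : ∀ (u : NineGroup) (c j : ZMod 3),
      u ^ (toAdd (ofAdd c * (ofAdd j)⁻¹)).val = u ^ c.val * (u ^ j.val)⁻¹ := by decide +kernel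
  have h₂ := hc (ofAdd (show ZMod 3 from j)) h₁
  have h₅ : ofAdd u ^ (toAdd c).val * (ofAdd u ^ j.val)⁻¹ = _ := (h₄ (ofAdd u) (toAdd c) j).symm
  have h₆ : T (ofAdd u ^ (toAdd c).val * (ofAdd u ^ j.val)⁻¹) := by
    rw [h₅]
    exact h₂
  have h₇ := hT' _ (2 * i.val) h₆
  rwa [e', mul_inv, h9 (h ^ i.val), ← pow_mul, mul_comm i.val, mul_comm (h ^ _), ← mul_assoc]

theorem NineGroup.exists_factor {V : Type*} [MulAction NineGroup V]
    {w y : V} {h₁ h₂ : NineGroup} (hh : h₂ ≠ 1) (h₂y : h₂ • y = y) (h₁y : h₁ • y ≠ y)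
    (h₁w : h₁ • w = w) (g : NineGroup) : ∃ s t : NineGroup, s • w = w ∧ t • y = y ∧ g = s * t := by
  have key : ∀ (x : V) (h : NineGroup) (i : ℕ), h • x = x → h ^ i • x = x := fun x h i hx =>
    pow_mem (show h ∈ MulAction.stabilizer NineGroup x from hx) i
  obtain ⟨i, j, e⟩ := NineGroup.exists_eq_pow_mul_pow hh (h₂ := h₁)
    (fun i e => h₁y (by rw [e]; exact key _ _ _ h₂y)) g
  exact ⟨h₁ ^ j, h₂ ^ i, key _ _ _ h₁w, key _ _ _ h₂y, by rw [e, mul_comm]⟩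

end Nine

section NineVertices

variable {V : Type*} [MulAction NineGroup V] {Γ : SimpleGraph V}

theorem card_nineGroup : Nat.card NineGroup = 9 := by
  rw [show Nat.card NineGroup = Nat.card (ZMod 3 × ZMod 3) from rfl, Nat.card_prod, Nat.card_zmod]

theorem NineGroup.three_le_ncard_orbit {x : V} {g : NineGroup} (hx : g • x ≠ x) :
    3 ≤ (MulAction.orbit NineGroup x).ncard := by
  have hd : (MulAction.orbit NineGroup x).ncard ∣ 3 ^ 2 := by
    rw [← MulAction.index_stabilizer]
    refine (Subgroup.index_dvd_card _).trans ?_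
    rw [card_nineGroup]
    norm_num
  obtain ⟨k, hk, e⟩ := (Nat.dvd_prime_pow Nat.prime_three).1 hd
  rw [e]
  interval_cases k
  · obtain ⟨y, hy⟩ := Set.ncard_eq_one.1 e
    have h₁ : x ∈ MulAction.orbit NineGroup x := MulAction.mem_orbit_self x
    have h₂ : g • x ∈ MulAction.orbit NineGroup x := MulAction.mem_orbit x g
    rw [hy] at h₁ h₂
    exact absurd (h₂.trans h₁.symm) hx
  · norm_num
  · norm_num

theorem NineGroup.nine_le_ncard [Finite V] {S : Set V} (hS : ∀ x ∈ S, ∀ g : NineGroup, g • x ∈ S)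
    {x y z : V} (hx : x ∈ S) (hy : y ∈ S) (hz : z ∈ S) (hxy : ∀ g : NineGroup, g • x ≠ y)
    (hxz : ∀ g : NineGroup, g • x ≠ z) (hyz : ∀ g : NineGroup, g • y ≠ z)
    (hx' : ∃ g : NineGroup, g • x ≠ x) (hy' : ∃ g : NineGroup, g • y ≠ y)
    (hz' : ∃ g : NineGroup, g • z ≠ z) : 9 ≤ S.ncard := by
  have hdisj : ∀ a b : V, (∀ g : NineGroup, g • a ≠ b) →
      Disjoint (MulAction.orbit NineGroup a) (MulAction.orbit NineGroup b) := by
    intro a b hab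
    rw [Set.disjoint_left]
    rintro _ ⟨g, rfl⟩ ⟨u, hu⟩
    refine hab (u⁻¹ * g) ?_
    rw [mul_smul, inv_smul_eq_iff]
    exact hu.symm
  have h₁ := Set.ncard_union_eq (hdisj y z hyz) (Set.toFinite _) (Set.toFinite _)
  have h₂ := Set.ncard_union_eq (Set.disjoint_union_right.2 ⟨hdisj x y hxy, hdisj x z hxz⟩)
    (Set.toFinite _) (Set.toFinite _)
  obtain ⟨_, hx'⟩ := hx'
  obtain ⟨_, hy'⟩ := hy'
  obtain ⟨_, hz'⟩ := hz'
  have h₃ := three_le_ncard_orbit hx'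
  have h₄ := three_le_ncard_orbit hy'
  have h₅ := three_le_ncard_orbit hz'
  have h₆ := Set.ncard_le_ncard (s := MulAction.orbit NineGroup x ∪ (MulAction.orbit NineGroup y ∪
    MulAction.orbit NineGroup z)) (t := S) (by
      rintro _ (⟨g, rfl⟩ | ⟨g, rfl⟩ | ⟨g, rfl⟩)
      · exact hS x hx g
      · exact hS y hy g
      · exact hS z hz g) (Set.toFinite _)
  omega

/-- All points outside a regular orbit are fixed by a nontrivial element. -/
theorem IsAutAction.false_of_fixed_outside (h : IsAutAction NineGroup Γ) {v : V}
    (hv : ∀ g : NineGroup, g • v = v → g = 1) {k : NineGroup} (hk : k ≠ 1)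
    (hout : ∀ y, (∀ g : NineGroup, g • v ≠ y) → k • y = y) : False := by
  classical
  obtain ⟨θ, hθθ, hθk, hθ, hS⟩ := NineGroup.exists_involution hk (fun s => Γ.Adj v (s • v)) (by
    intro s hs
    rw [← h.adj_iff s, smul_inv_smul]
    exact hs.symm)
  let φ : V → V := fun x => if hx : ∃ g : NineGroup, g • v = x then θ hx.choose • v else x
  have hφin : ∀ g : NineGroup, φ (g • v) = θ g • v := by
    intro g
    have hx : ∃ u : NineGroup, u • v = g • v := ⟨g, rfl⟩
    have e := smul_right_cancel_of_stabilizer hv hx.choose_spec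
    simp only [φ, dif_pos hx, e]
  have hφout : ∀ y, (∀ g : NineGroup, g • v ≠ y) → φ y = y := fun y hy =>
    dif_neg fun ⟨g, hg⟩ => hy g hg
  have hcases : ∀ x, (∃ g : NineGroup, g • v = x) ∨ ∀ g : NineGroup, g • v ≠ x := by
    intro x
    by_contra! hx
    obtain ⟨g, e⟩ := hx.2
    exact hx.1 g e
  have hmove : ∀ g u : NineGroup, Γ.Adj (g • v) (u • v) ↔ Γ.Adj v ((g⁻¹ * u) • v) := by
    intro g u
    rw [← h.adj_iff g⁻¹, inv_smul_smul, smul_smul]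
  have hio : ∀ g : NineGroup, ∀ y, (∀ g : NineGroup, g • v ≠ y) → Γ.Adj (g • v) y →
      Γ.Adj (θ g • v) y := by
    intro g y hy hA
    obtain ⟨i, e⟩ := hθ g
    have hky : k ^ i • y = y :=
      pow_mem (show k ∈ MulAction.stabilizer NineGroup y from hout y hy) i
    rw [← h.adj_iff (k ^ i), hky, smul_smul, mul_comm] at hA
    rwa [e]
  have hid := h.eq_of_fixed hv φ (by
    intro x
    rcases hcases x with ⟨g, rfl⟩ | hx
    · rw [hφin, hφin, hθθ]
    · rw [hφout x hx, hφout x hx]) (by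
    intro x y hxy
    rcases hcases x with ⟨g, rfl⟩ | hx <;> rcases hcases y with ⟨u, rfl⟩ | hy
    · rw [hmove] at hxy
      rw [hφin, hφin, hmove, ← map_inv, ← map_mul]
      exact hS _ hxy
    · rw [hφin, hφout y hy]
      exact hio g y hy hxy
    · rw [hφin, hφout x hx]
      exact (hio u x hx hxy.symm).symm
    · rwa [hφout x hx, hφout y hy]) (by
    have := hφin 1
    rwa [map_one, one_smul] at this) (k • v)
  rw [hφin] at hid
  exact hθk (smul_right_cancel_of_stabilizer hv hid)

theorem IsAutAction.adj_inv_smul_iff {G W : Type*} [Group G] [MulAction G W] {Γ : SimpleGraph W}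
    (h : IsAutAction G Γ) {g : G} {a b : W} : Γ.Adj (g⁻¹ • a) b ↔ Γ.Adj a (g • b) := by
  rw [← h.adj_iff g, smul_inv_smul]

theorem NineGroup.exists_mul_self_ne : ∃ g : NineGroup, g * g ≠ 1 := by decide

theorem NineGroup.exists_reflection_of_fixed (Γ : SimpleGraph V) {v w : V}
    {k : NineGroup} (hk : k ≠ 1) (hkw : k • w = w) :
    ∃ c : NineGroup, ∀ t : NineGroup, Γ.Adj v (t • w) → Γ.Adj v ((c * t⁻¹) • w) :=
  NineGroup.exists_reflection hk (fun t => Γ.Adj v (t • w)) (by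
    intro t ht
    rwa [mul_smul, hkw])

theorem IsAutAction.false_of_free_nine [Finite V] (h : IsAutAction NineGroup Γ) (hV : Nat.card V < 18) {v : V}
    (hv : ∀ g : NineGroup, g • v = v → g = 1) : False := by
  have hnf : ∀ y, (∀ g : NineGroup, g • v ≠ y) → ∃ k : NineGroup, k ≠ 1 ∧ k • y = y := by
    intro y hy
    by_contra! hall
    have := two_mul_card_le_of_free_orbits hv (fun g hg => by_contra fun e => hall g e hg) hy
    rw [card_nineGroup] at this
    omega
  have hmv : ∀ k : NineGroup, k ≠ 1 → ∃ y, (∀ g : NineGroup, g • v ≠ y) ∧ k • y ≠ y := by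
    intro k hk
    by_contra! hall
    exact h.false_of_fixed_outside hv hk hall
  obtain ⟨k, hk⟩ := exists_ne (1 : NineGroup)
  obtain ⟨w₁, hvw₁, hkw₁⟩ := hmv k hk
  obtain ⟨h₁, hh₁, hw₁⟩ := hnf w₁ hvw₁
  obtain ⟨w₂, hvw₂, hh₁w₂⟩ := hmv h₁ hh₁
  obtain ⟨h₂, hh₂, hw₂⟩ := hnf w₂ hvw₂
  have hww : ∀ g : NineGroup, g • w₁ ≠ w₂ := by
    rintro g rfl
    rw [smul_smul, mul_comm, mul_smul, hw₁] at hh₁w₂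
    exact hh₁w₂ rfl
  have hfix : ∀ y, (∀ g : NineGroup, g • v ≠ y) → (∀ g : NineGroup, g • w₁ ≠ y) →
      (∀ g : NineGroup, g • w₂ ≠ y) → ∀ g : NineGroup, g • y = y := by
    intro y h₀ h₁ h₂
    by_contra hy
    push Not at hy
    have h₉ := NineGroup.nine_le_ncard (S := (MulAction.orbit NineGroup v)ᶜ) (by
      rintro x hx g ⟨u, hu⟩
      refine hx ⟨g⁻¹ * u, ?_⟩
      change (g⁻¹ * u) • v = x
      rw [mul_smul, inv_smul_eq_iff]
      exact hu) (fun ⟨g, hg⟩ => hvw₁ g hg) (fun ⟨g, hg⟩ => hvw₂ g hg) (fun ⟨g, hg⟩ => h₀ g hg)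
      hww h₁ h₂ ⟨k, hkw₁⟩ ⟨_, hh₁w₂⟩ hy
    have h₈ := Set.ncard_add_ncard_compl (MulAction.orbit NineGroup v)
    have h₇ : (MulAction.orbit NineGroup v).ncard = 9 := by
      rw [← MulAction.index_stabilizer, ← card_nineGroup, ← Subgroup.index_bot]
      congr 1
      rw [eq_bot_iff]
      exact fun g hg => hv g hg
    omega
  obtain ⟨c₁, hc₁⟩ := NineGroup.exists_reflection_of_fixed Γ (v := v) hh₁ hw₁
  obtain ⟨c₂, hc₂⟩ := NineGroup.exists_reflection_of_fixed Γ (v := v) hh₂ hw₂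
  have hinv : ∀ a b : V, (∀ g : NineGroup, g • a ≠ b) → ∀ g : NineGroup, g • b ≠ a :=
    fun a b hab g e => hab g⁻¹ (by rw [← e, inv_smul_smul])
  obtain ⟨g, hg⟩ := NineGroup.exists_mul_self_ne
  refine hg (hv _ (h.sq_smul_eq ![v, w₁, w₂] ?_ ![1, c₁, c₂] ?_ ?_ 0 g))
  · intro i j g e
    fin_cases i <;> fin_cases j
    · rfl
    · exact absurd e (hvw₁ g)
    · exact absurd e (hvw₂ g)
    · exact absurd e (hinv _ _ hvw₁ g)
    · rfl
    · exact absurd e (hww g)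
    · exact absurd e (hinv _ _ hvw₂ g)
    · exact absurd e (hinv _ _ hww g)
    · rfl
  · intro i j hij t ht
    fin_cases i <;> fin_cases j
    · exact absurd hij (lt_irrefl _)
    · simpa using hc₁ t ht
    · simpa using hc₂ t ht
    · exact absurd hij (by decide)
    · exact absurd hij (lt_irrefl _)
    · exact h.adj_inv_smul_iff.1 (h.adj_smul_of_factor
        (NineGroup.exists_factor hh₂ hw₂ hh₁w₂ hw₁) _ _ (h.adj_inv_smul_iff.2 ht))
    · exact absurd hij (by decide)
    · exact absurd hij (by decide)
    · exact absurd hij (lt_irrefl _)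
  · intro y hy i
    have := hfix y (hy 0) (hy 1) (hy 2)
    exact h.adj_smul_of_factor fun g => ⟨1, g, one_smul _ _, this g, (one_mul g).symm⟩

theorem IsAutAction.false_of_two_orbits (h : IsAutAction NineGroup Γ) {k : NineGroup} {x y : V}
    (hk : k ≠ 1) (hx : k • x = x) (hy : k • y = y) (hx' : ∃ g : NineGroup, g • x ≠ x)
    (hout : ∀ z, k • z = z → (∃ g : NineGroup, g • z ≠ z) → (∃ g : NineGroup, g • x = z) ∨
      ∃ g : NineGroup, g • y = z)
    (hfix : ∀ z : V, ∃ u : NineGroup, u ≠ 1 ∧ u • z = z) : False := by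
  have key : ∀ z, (∀ g : NineGroup, g • x ≠ z) → (∀ g : NineGroup, g • y ≠ z) →
      ∀ w : V, k • w = w → ∀ g : NineGroup, ∃ s t : NineGroup, s • w = w ∧ t • z = z ∧ g = s * t := by
    intro z hxz hyz w hw g
    by_cases hz : ∃ g : NineGroup, g • z ≠ z
    · by_cases hkz : k • z = z
      · rcases hout z hkz hz with ⟨g, e⟩ | ⟨g, e⟩
        · exact absurd e (hxz g)
        · exact absurd e (hyz g)
      · obtain ⟨u, hu, huz⟩ := hfix z
        exact NineGroup.exists_factor hu huz hkz hw g
    · push Not at hz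
      exact ⟨1, g, one_smul _ _, hz g, (one_mul g).symm⟩
  have hsq : ∀ g : NineGroup, (g * g) • x = x := by
    by_cases hxy : ∃ g : NineGroup, g • x = y
    · obtain ⟨u, rfl⟩ := hxy
      refine fun g => h.sq_smul_eq_of_fixed (fun z hz => key z hz (fun g e => ?_) x hx) g
      exact hz (g * u) (by rw [mul_smul, e])
    · push Not at hxy
      obtain ⟨c, hc⟩ := NineGroup.exists_reflection_of_fixed Γ (v := x) hk hy
      exact fun g => h.sq_smul_eq_of_pair hxy hc
        (fun z hz hz' u => ⟨key z hz hz' x hx u, key z hz hz' y hy u⟩) g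
  have h4 : ∀ g : NineGroup, g * g * (g * g) = g := by decide
  obtain ⟨g, hg⟩ := hx'
  exact hg (by rw [← h4 g]; exact hsq (g * g))

theorem not_realizable_nineGroup {m : ℕ} (hm : m < 18) : ¬ Realizable NineGroup m := by
  intro hR
  obtain ⟨Γ, _, h⟩ := hR.exists_action
  have hV : Nat.card (Fin m) = m := Nat.card_fin m
  have hfix : ∀ z : Fin m, ∃ u : NineGroup, u ≠ 1 ∧ u • z = z := by
    intro z
    by_contra! hall
    exact h.false_of_free_nine (by rwa [hV]) (v := z) fun g hg => by_contra fun e => hall g e hg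
  let N : NineGroup → Set (Fin m) := fun k => {z | k • z = z ∧ ∃ g : NineGroup, g • z ≠ z}
  have hN : ∀ k x, x ∈ N k → ∀ g : NineGroup, g • x ∈ N k := by
    rintro k x ⟨hx, u, hu⟩ g
    refine ⟨by rw [smul_smul, mul_comm, mul_smul, hx], u, fun e => hu ?_⟩
    rw [smul_smul, mul_comm, mul_smul] at e
    exact smul_left_cancel g e
  have hnine : ∀ k : NineGroup, k ≠ 1 → (N k).Nonempty → 9 ≤ (N k).ncard := by
    rintro k hk ⟨x, hx⟩
    by_contra hlt
    by_cases hy : ∃ y ∈ N k, ∀ g : NineGroup, g • x ≠ y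
    · obtain ⟨y, hy, hxy⟩ := hy
      refine h.false_of_two_orbits hk hx.1 hy.1 hx.2 (fun z hz hz' => ?_) hfix
      by_contra! hxyz
      exact hlt (NineGroup.nine_le_ncard (hN k) hx hy ⟨hz, hz'⟩ hxy hxyz.1 hxyz.2 hx.2 hy.2 hz')
    · push Not at hy
      exact h.false_of_two_orbits hk hx.1 hx.1 hx.2 (fun z hz hz' => Or.inl (hy z ⟨hz, hz'⟩)) hfix
  obtain ⟨k, hk⟩ := exists_ne (1 : NineGroup)
  obtain ⟨w₁, hkw₁⟩ := h.exists_smul_ne hk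
  obtain ⟨h₁, hh₁, hw₁⟩ := hfix w₁
  obtain ⟨w₂, hh₁w₂⟩ := h.exists_smul_ne hh₁
  obtain ⟨h₂, hh₂, hw₂⟩ := hfix w₂
  have hd : Disjoint (N h₁) (N h₂) := by
    rw [Set.disjoint_left]
    rintro y ⟨h₁y, u, hu⟩ ⟨h₂y, -⟩
    have hpow : ∀ (x : Fin m) (g : NineGroup) (i : ℕ), g • x = x → g ^ i • x = x := fun x g i hx =>
      pow_mem (show g ∈ MulAction.stabilizer NineGroup x from hx) i
    obtain ⟨i, j, rfl⟩ := NineGroup.exists_eq_pow_mul_pow hh₂ (h₂ := h₁)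
      (fun i e => hh₁w₂ (by rw [e]; exact hpow _ _ _ hw₂)) u
    exact hu (by rw [mul_smul, hpow _ _ _ h₁y, hpow _ _ _ h₂y])
  have h₃ := hnine h₁ hh₁ ⟨w₁, hw₁, k, hkw₁⟩
  have h₄ := hnine h₂ hh₂ ⟨w₂, hw₂, h₁, hh₁w₂⟩
  have h₅ := Set.ncard_union_eq hd
  have h₆ := Set.ncard_le_card (N h₁ ∪ N h₂)
  omega

end NineVertices

section Elementary

variable {p : ℕ}

theorem realizable_three_mul_prime (hp : p.Prime) (hp2 : p ≠ 2) :
    Realizable (Multiplicative (ZMod p)) (3 * p) := by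
  have : NeZero p := ⟨hp.ne_zero⟩
  have := hp.two_le
  by_cases h3 : p = 3
  · subst h3
    exact realizable_three
  · have h4 : p ≠ 4 := by
      rintro rfl
      norm_num at hp
    have hcard : Nat.card (Multiplicative (ZMod p)) = p := Nat.card_zmod p
    have := realizable_of_isCyclic (M := Multiplicative (ZMod p)) (by omega)
    rwa [hcard] at this

theorem realizable_elementary_one (hp : p.Prime) (hp2 : p ≠ 2) :
    Realizable (Multiplicative (Fin 1 → ZMod p)) (3 * p) :=
  (realizable_three_mul_prime hp hp2).congr
    { toFun := fun x => Multiplicative.ofAdd fun _ => x.toAdd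
      invFun := fun x => Multiplicative.ofAdd (x.toAdd 0)
      left_inv := fun _ => rfl
      right_inv := fun x => congrArg Multiplicative.ofAdd
        (funext fun i => congrArg x.toAdd (Subsingleton.elim 0 i))
      map_mul' := fun _ _ => rfl }

theorem realizable_elementary (hp : p.Prime) (hp2 : p ≠ 2) {k : ℕ} (hk : 2 ≤ k) :
    Realizable (Multiplicative (Fin k → ZMod p)) (3 * p * k + 1) := by
  have h2 := hp.two_le
  have hR := realizable_three_mul_prime hp hp2
  let e : ∀ k : ℕ, Multiplicative (Fin k → ZMod p) × Multiplicative (ZMod p) ≃*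
      Multiplicative (Fin (k + 1) → ZMod p) := fun k =>
    { toFun := fun x => Multiplicative.ofAdd (Fin.snoc (α := fun _ => ZMod p) x.1.toAdd x.2.toAdd)
      invFun := fun x => (Multiplicative.ofAdd fun i => x.toAdd i.castSucc,
        Multiplicative.ofAdd (x.toAdd (Fin.last k)))
      left_inv := fun x => by ext <;> simp
      right_inv := fun x => Fin.snoc_init_self x.toAdd
      map_mul' := fun x y => by
        refine congrArg Multiplicative.ofAdd (funext fun i => ?_)
        refine Fin.lastCases ?_ (fun i => ?_) i <;> simp }
  induction k, hk using Nat.le_induction with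
  | base =>
    have := ((realizable_elementary_one hp hp2).succ (by omega)).prod hR (by omega) (by omega) (by omega)
    convert this.congr (e 1) using 1
    ring
  | succ k hk ih =>
    have hne : 3 * p * k + 1 ≠ 3 * p := by
      have := Nat.mul_le_mul_left (3 * p) hk
      omega
    convert (ih.prod hR (by omega) (by omega) hne).congr (e k) using 1
    ring

theorem exists_elementary_mulEquiv (hp : p.Prime) {A : Type*} [CommGroup A] [Finite A]
    (hA : ∀ x : A, x ^ p = 1) : ∃ k, Nonempty (A ≃* Multiplicative (Fin k → ZMod p)) := by
  have := Fact.mk hp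
  let _ : Module (ZMod p) (Additive A) := AddCommGroup.zmodModule (n := p) (G := Additive A) hA
  let b := Module.finBasis (ZMod p) (Additive A)
  exact ⟨_, ⟨AddEquiv.toMultiplicativeRight b.equivFun.toAddEquiv⟩⟩

theorem mul_add_one_lt_pow (hp : 5 ≤ p) {k : ℕ} (hk : 2 ≤ k) : 3 * p * k + 1 < 2 * p ^ k := by
  induction k, hk using Nat.le_induction with
  | base => nlinarith
  | succ k hk ih =>
    rw [pow_succ]
    nlinarith [Nat.mul_le_mul_left p hk]

theorem nine_mul_add_one_lt_pow {k : ℕ} (hk : 3 ≤ k) : 9 * k + 1 < 2 * 3 ^ k := by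
  induction k, hk using Nat.le_induction with
  | base => norm_num
  | succ k hk ih =>
    rw [pow_succ]
    omega

theorem mul_add_three_lt_pow (hp : 3 ≤ p) {k : ℕ} (hk : 2 ≤ k) : 3 * p * k + 3 < 4 * p ^ k := by
  induction k, hk using Nat.le_induction with
  | base => nlinarith
  | succ k hk ih =>
    rw [pow_succ]
    nlinarith [Nat.mul_le_mul_left p hk]

theorem card_elementary (k : ℕ) : Nat.card (Multiplicative (Fin k → ZMod p)) = p ^ k := by
  rw [show Nat.card (Multiplicative (Fin k → ZMod p)) = Nat.card (Fin k → ZMod p) from rfl,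
    Nat.card_pi]
  simp

/-- Small graphs for direct products of an elementary abelian group with a group of order two. -/
theorem realizable_two_prod (hp : p.Prime) (hp2 : p ≠ 2) {k : ℕ} (hk : k ≠ 0) :
    ∃ m < 4 * p ^ k, Realizable (Multiplicative (Fin k → ZMod p) × Multiplicative (ZMod 2)) m := by
  have h2 := hp.two_le
  obtain rfl | hk1 := eq_or_ne k 1
  · exact ⟨3 * p + 2, by rw [pow_one]; omega,
      (realizable_elementary_one hp hp2).prod realizable_two (by omega) (by omega) (by omega)⟩
  · have hm := mul_add_three_lt_pow (p := p) (by omega) (k := k) (by omega)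
    have hpos : 3 * p * k + 1 ≠ 2 := by nlinarith [Nat.mul_le_mul_left p (show 1 ≤ k by omega)]
    exact ⟨3 * p * k + 1 + 2, by linarith, (realizable_elementary hp hp2 (by omega)).prod
      realizable_two (by omega) (by omega) hpos⟩

theorem realizable_or_of_pow_eq_one (hp : p.Prime) (hp2 : p ≠ 2) {A : Type*} [CommGroup A] [Finite A]
    [Nontrivial A] (hA : ∀ x : A, x ^ p = 1) : (∃ m < 2 * Nat.card A, Realizable A m) ∨
      (IsCyclic A ∧ Nat.card A = p) ∨ Nonempty (A ≃* NineGroup) := by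
  have h2 := hp.two_le
  obtain ⟨k, ⟨e⟩⟩ := exists_elementary_mulEquiv hp hA
  have hcard : Nat.card A = p ^ k := by rw [Nat.card_congr e.toEquiv, card_elementary]
  have hlt : ∀ (_ : 2 ≤ k) (_ : 3 * p * k + 1 < 2 * p ^ k), ∃ m < 2 * Nat.card A, Realizable A m :=
    fun hk h => ⟨_, by rwa [hcard], (realizable_elementary hp hp2 hk).congr e.symm⟩
  have h1 : 1 < Nat.card A := Finite.one_lt_card
  obtain rfl | rfl | hk : k = 0 ∨ k = 1 ∨ 2 ≤ k := by omega
  · rw [hcard, pow_zero] at h1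
    exact absurd h1 (lt_irrefl 1)
  · rw [pow_one] at hcard
    have := Fact.mk hp
    exact Or.inr (Or.inl ⟨isCyclic_of_prime_card hcard, hcard⟩)
  · by_cases h5 : 5 ≤ p
    · exact Or.inl (hlt hk (mul_add_one_lt_pow h5 hk))
    · have h4 : p ≠ 4 := by
        rintro rfl
        norm_num at hp
      obtain rfl : p = 3 := by omega
      obtain rfl | hk := hk.eq_or_lt
      · refine Or.inr (Or.inr ⟨e.trans ?_⟩)
        exact AddEquiv.toMultiplicative
          { toFun := fun x => (x 0, x 1)
            invFun := fun x => ![x.1, x.2]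
            left_inv := fun x => by ext i; fin_cases i <;> rfl
            right_inv := fun _ => rfl
            map_add' := fun _ _ => rfl }
      · exact Or.inl (hlt (by omega) (nine_mul_add_one_lt_pow hk))

theorem realizable_of_comm_of_involution (hp : p.Prime) (hp2 : p ≠ 2) {A : Type*} [CommGroup A]
    [Finite A] (hpA : p ∣ Nat.card A) (hA : ∀ x : A, x ^ (2 * p) = 1) {z : A} (hz1 : z ≠ 1)
    (hz : ∀ t : A, t * t = 1 ↔ t = 1 ∨ t = z) : ∃ m < 2 * Nat.card A, Realizable A m := by
  have hzz := (hz z).2 (Or.inr rfl)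
  obtain ⟨q, hq⟩ := hp.odd_of_ne_two hp2
  let O : Subgroup A := (powMonoidHom p : A →* A).ker
  have hO : ∀ x, x ∈ O ↔ x ^ p = 1 := fun x => Iff.rfl
  have hZ : ∀ x, x ∈ Subgroup.zpowers z ↔ x = 1 ∨ x = z := by
    intro x
    constructor
    · rintro ⟨k, rfl⟩
      rw [← hz, ← mul_zpow, hzz, one_zpow]
    · rintro (rfl | rfl)
      · exact one_mem _
      · exact Subgroup.mem_zpowers _
  have hbij : Function.Bijective (O.subtype.coprod (Subgroup.zpowers z).subtype) := by
    constructor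
    · rw [injective_iff_map_eq_one]
      rintro ⟨⟨x, hx⟩, ⟨y, hy⟩⟩ e
      have e : x * y = 1 := e
      have hyy := (hz y).2 ((hZ y).1 hy)
      rw [hO] at hx
      have hy1 : y = 1 := by
        have : (x * y) ^ p = 1 := by rw [e, one_pow]
        rwa [mul_pow, hx, one_mul, hq, pow_succ, pow_mul, sq, hyy, one_pow, one_mul] at this
      subst hy1
      rw [mul_one] at e
      subst e
      rfl
    · intro g
      have h₁ : g ^ (p + 1) ∈ O := by
        rw [hO, ← pow_mul, show (p + 1) * p = 2 * p * (q + 1) by rw [hq]; ring, pow_mul, hA, one_pow]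
      have h₂ : g ^ p ∈ Subgroup.zpowers z := by
        rw [hZ, ← hz, ← pow_add, ← two_mul, hA]
      refine ⟨(⟨_, h₁⟩, ⟨_, inv_mem h₂⟩), ?_⟩
      change g ^ (p + 1) * (g ^ p)⁻¹ = g
      rw [pow_succ', mul_inv_cancel_right]
  let e := MulEquiv.ofBijective _ hbij
  obtain ⟨k, ⟨f⟩⟩ := exists_elementary_mulEquiv hp (A := O) fun x => Subtype.ext x.2
  have hcz : Nat.card (Subgroup.zpowers z) = 2 := by
    rw [Nat.card_zpowers]
    exact orderOf_eq_prime ((sq z).trans hzz) hz1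
  have hcA : Nat.card A = p ^ k * 2 := by
    rw [← Nat.card_congr e.toEquiv, Nat.card_prod, hcz, Nat.card_congr f.toEquiv, card_elementary]
  have hk : k ≠ 0 := by
    rintro rfl
    rw [hcA, pow_zero, one_mul] at hpA
    exact hp2 ((Nat.prime_dvd_prime_iff_eq hp Nat.prime_two).1 hpA)
  have f₂ : Subgroup.zpowers z ≃* Multiplicative (ZMod 2) :=
    (zmodCyclicMulEquiv (inferInstance : IsCyclic (Subgroup.zpowers z))).symm.trans
      (by rw [hcz])
  obtain ⟨m, hm, hR⟩ := realizable_two_prod hp hp2 hk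
  exact ⟨m, by omega, hR.congr ((MulEquiv.prodCongr f f₂).symm.trans e)⟩

end Elementary

section OddPrime

variable {G : Type*} [Group G]

theorem closure_pair_subtype_eq_top (s b : G) :
    Subgroup.closure {(⟨s, Subgroup.subset_closure (by simp)⟩ : Subgroup.closure {s, b}),
      ⟨b, Subgroup.subset_closure (by simp)⟩} = ⊤ := by
  convert Subgroup.closure_closure_coe_preimage (k := {s, b}) using 2
  ext x
  simp [Subtype.ext_iff]

theorem card_zpowers_subgroupOf {x : G} {M : Subgroup G} (hx : x ∈ M) :
    Nat.card ((Subgroup.zpowers x).subgroupOf M) = orderOf x := by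
  rw [Nat.card_congr (Subgroup.subgroupOfEquivOfLe (Subgroup.zpowers_le.2 hx)).toEquiv,
    Nat.card_zpowers]

variable [Finite G]

theorem realizable_of_conj_notMem {x t : G} (hp : (orderOf x).Prime) (h2 : orderOf x ≠ 2)
    (h : t⁻¹ * x * t ∉ Subgroup.zpowers x) : ∃ m < 2 * Nat.card G, Realizable G m := by
  have hx : x ∈ Subgroup.closure {x, t} := Subgroup.subset_closure (by simp)
  have ht : t ∈ Subgroup.closure {x, t} := Subgroup.subset_closure (by simp)
  have hcard := card_zpowers_subgroupOf hx
  refine Good.realizable_of_odd (K := Subgroup.zpowers x)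
    (by rw [Nat.card_zpowers]; exact hp.odd_of_ne_two h2) (Subgroup.closure {x, t})
    (Subgroup.zpowers_le.2 hx) ?_
  refine good_of_conj_notMem (t := ⟨t, ht⟩) (hcard ▸ hp) ?_
    ⟨⟨x, hx⟩, Subgroup.mem_zpowers x, h⟩ ?_
  · have := hp.two_le
    omega
  · rw [eq_top_iff, ← closure_pair_subtype_eq_top x t, Subgroup.closure_le]
    rintro y (rfl | rfl)
    · exact Subgroup.mem_sup_left (Subgroup.mem_zpowers x)
    · exact Subgroup.mem_sup_right (Subgroup.mem_zpowers _)

theorem realizable_of_orderOf_eq_mul {t : G} {k j : ℕ} (hk : Odd k) (hk3 : 3 ≤ k) (hj : 3 ≤ j)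
    (h : orderOf t = k * j) : ∃ m < 2 * Nat.card G, Realizable G m := by
  have hord : orderOf (t ^ j) = k := by
    rw [orderOf_pow, h, Nat.gcd_mul_left_left, Nat.mul_div_cancel _ (by omega)]
  have hle : t ^ j ∈ Subgroup.zpowers t := (Subgroup.zpowers t).pow_mem (Subgroup.mem_zpowers t) j
  have hcard := card_zpowers_subgroupOf hle
  refine Good.realizable_of_odd (K := Subgroup.zpowers (t ^ j))
    (by rwa [Nat.card_zpowers, hord]) (Subgroup.zpowers t) (Subgroup.zpowers_le.2 hle) ?_
  refine good_of_cyclic (t := ⟨t, Subgroup.mem_zpowers t⟩) ?_ _ (by omega) ?_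
  · rw [eq_top_iff]
    rintro ⟨_, i, rfl⟩ -
    exact ⟨i, rfl⟩
  · have := ((Subgroup.zpowers (t ^ j)).subgroupOf (Subgroup.zpowers t)).card_mul_index
    rw [hcard, hord, Nat.card_zpowers, h] at this
    rw [Nat.eq_of_mul_eq_mul_left (by omega) this]
    exact hj

theorem realizable_of_inverted {x b : G} (hp : (orderOf x).Prime) (h2 : orderOf x ≠ 2)
    (hb : orderOf b = 4) (h : b * x = x⁻¹ * b) : ∃ m < 2 * Nat.card G, Realizable G m := by
  have hxM : x ∈ Subgroup.closure {x, b} := Subgroup.subset_closure (by simp)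
  have hbM : b ∈ Subgroup.closure {x, b} := Subgroup.subset_closure (by simp)
  have hcard := card_zpowers_subgroupOf hxM
  have hodd := hp.odd_of_ne_two h2
  have hb4 : b * b * (b * b) = 1 := by
    have := pow_orderOf_eq_one b
    rw [hb] at this
    rw [← this]
    simp only [pow_succ, pow_zero, one_mul, mul_assoc]
  have hb2 : b * b ≠ 1 := fun e => by
    have := orderOf_dvd_of_pow_eq_one ((sq b).trans e)
    rw [hb] at this
    norm_num at this
  have hzx : b * b ∉ Subgroup.zpowers x := fun hm => by
    have h₁ := (orderOf_dvd_natCard (⟨b * b, hm⟩ : Subgroup.zpowers x))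
    rw [Nat.card_zpowers, Subgroup.orderOf_mk] at h₁
    have h₃ : orderOf (b * b) ∣ 2 := orderOf_dvd_of_pow_eq_one (by rw [sq, hb4])
    rcases (Nat.dvd_prime Nat.prime_two).1 h₃ with h₄ | h₄
    · exact hb2 (orderOf_eq_one_iff.1 h₄)
    · rw [h₄] at h₁
      exact (Nat.not_even_iff_odd.2 hodd) (even_iff_two_dvd.2 h₁)
  have hD : IsDicyclic (Subgroup.zpowers (⟨b, hbM⟩ * ⟨b, hbM⟩ : Subgroup.closure {x, b}))
      ((Subgroup.zpowers x).subgroupOf (Subgroup.closure {x, b})) ⟨x, hxM⟩ ⟨b, hbM⟩ :=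
    { mem_Z := fun y => by
        constructor
        · rintro ⟨i, rfl⟩
          have hz : (⟨b, hbM⟩ * ⟨b, hbM⟩ : Subgroup.closure {x, b}) * (⟨b, hbM⟩ * ⟨b, hbM⟩) = 1 :=
            Subtype.ext hb4
          rcases Int.even_or_odd' i with ⟨l, rfl | rfl⟩
          · left
            simp only [zpow_mul, zpow_two, hz, one_zpow]
          · right
            simp only [zpow_add, zpow_mul, zpow_two, hz, one_zpow, one_mul, zpow_one]
        · rintro (rfl | rfl)
          · exact Subgroup.one_mem _
          · exact Subgroup.mem_zpowers _
      s_mem := Subgroup.mem_zpowers x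
      sq_ne := fun e => by
        have e : x * x = 1 := congrArg Subtype.val e
        have := Nat.le_of_dvd (by norm_num) (orderOf_dvd_of_pow_eq_one ((sq x).trans e))
        have := hp.two_le
        omega
      b_notMem := fun hm => hzx ((Subgroup.zpowers x).mul_mem hm hm)
      z_notMem := fun hm => hzx hm
      four := Subtype.ext hb4
      conj := Subtype.ext h
      gen := closure_pair_subtype_eq_top x b }
  refine Good.realizable_of_odd (K := Subgroup.zpowers x)
    (by rwa [Nat.card_zpowers]) (Subgroup.closure {x, b}) (Subgroup.zpowers_le.2 hxM) ?_
  have := hp.two_le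
  refine hD.good (by omega) (Nat.le_of_dvd Nat.card_pos ?_)
  rw [hcard]
  refine Nat.Coprime.mul_dvd_of_dvd_of_dvd ?_ ?_ ?_
  · exact (Nat.Coprime.pow_left 2 (Nat.coprime_two_left.2 hodd) :)
  · rw [← hb, ← Subgroup.orderOf_mk b hbM]
    exact orderOf_dvd_natCard _
  · rw [← Subgroup.orderOf_mk x hxM]
    exact orderOf_dvd_natCard _

theorem realizable_of_two_involutions {s t : G} (hs : s ≠ 1) (hss : s * s = 1) (ht : t ≠ 1)
    (htt : t * t = 1) (hst : s ≠ t) (hE : Subgroup.closure {g : G | g * g ≠ s} = ⊤) :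
    ∃ m < 2 * Nat.card G, Realizable G m := by
  have hsM : s ∈ Subgroup.closure {s, t} := Subgroup.subset_closure (by simp)
  have htM : t ∈ Subgroup.closure {s, t} := Subgroup.subset_closure (by simp)
  refine Good.realizable_of_involution hss hE (Subgroup.closure {s, t}) hsM ?_
  refine good_of_involutions (s := ⟨s, hsM⟩) (t := ⟨t, htM⟩) ?_ ?_ ?_ (Subtype.ext htt) ?_
    (closure_pair_subtype_eq_top s t)
  · rintro ⟨y, hy⟩
    simp only [Subgroup.mem_subgroupOf, Subtype.ext_iff, Subgroup.coe_one]
    constructor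
    · rintro ⟨i, rfl⟩
      rcases Int.even_or_odd' i with ⟨l, rfl | rfl⟩
      · left
        simp only [zpow_mul, zpow_two, hss, one_zpow]
      · right
        simp only [zpow_add, zpow_mul, zpow_two, hss, one_zpow, one_mul, zpow_one]
    · rintro (rfl | rfl)
      · exact Subgroup.one_mem _
      · exact Subgroup.mem_zpowers _
  · exact fun e => hs (congrArg Subtype.val e)
  · exact fun e => ht (congrArg Subtype.val e)
  · exact fun e => hst (congrArg Subtype.val e)

/-- A group is not the union of two proper subgroups, so one of the two involutions `s`, `s'` is
not the square of all the elements outside some proper subgroup. -/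
theorem realizable_of_ne_involution {s s' : G} (hs : s ≠ 1) (hss : s * s = 1) (hs' : s' ≠ 1)
    (hss' : s' * s' = 1) (hne : s ≠ s') : ∃ m < 2 * Nat.card G, Realizable G m := by
  by_cases h : Subgroup.closure {g : G | g * g ≠ s} = ⊤
  · exact realizable_of_two_involutions hs hss hs' hss' hne h
  by_cases h' : Subgroup.closure {g : G | g * g ≠ s'} = ⊤
  · exact realizable_of_two_involutions hs' hss' hs hss hne.symm h'
  exfalso
  have hmem : ∀ g : G, g ∈ Subgroup.closure {g : G | g * g ≠ s} ∨
      g ∈ Subgroup.closure {g : G | g * g ≠ s'} := fun g => by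
    by_cases hg : g * g = s
    · exact Or.inr (Subgroup.subset_closure fun e : g * g = s' => hne (hg.symm.trans e))
    · exact Or.inl (Subgroup.subset_closure hg)
  obtain ⟨x, hx⟩ : ∃ x, x ∉ Subgroup.closure {g : G | g * g ≠ s} := by
    by_contra! e
    exact h (Subgroup.ext fun y => by simp [e y])
  obtain ⟨y, hy⟩ : ∃ x, x ∉ Subgroup.closure {g : G | g * g ≠ s'} := by
    by_contra! e
    exact h' (Subgroup.ext fun y => by simp [e y])
  rcases hmem (x * y) with hxy | hxy
  · exact hx ((Subgroup.mul_mem_cancel_right _ ((hmem y).resolve_right hy)).1 hxy)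
  · exact hy ((Subgroup.mul_mem_cancel_left _ ((hmem x).resolve_left hx)).1 hxy)

end OddPrime

section TwoGroup

open QuaternionGroup

theorem nonempty_quaternionGroup_equiv {G : Type*} [Group G] [Finite G] {m : ℕ} (hm : m ≠ 0)
    {g x : G} (hg : orderOf g = 2 * m) (hx : x ∉ Subgroup.zpowers g) (hxx : x * x = g ^ m)
    (hconj : ∀ y ∈ Subgroup.zpowers g, y * x = x * y⁻¹) (hcard : Nat.card G = 4 * m) :
    Nonempty (G ≃* QuaternionGroup m) := by
  have : NeZero m := ⟨hm⟩
  have hmod : ∀ i : ℕ, g ^ (i % (2 * m)) = g ^ i := fun i => by rw [← hg, pow_mod_orderOf]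
  have hadd : ∀ i j : ZMod (2 * m), g ^ (i + j).val = g ^ i.val * g ^ j.val := fun i j => by
    rw [ZMod.val_add, hmod, pow_add]
  have hsub : ∀ i j : ZMod (2 * m), g ^ (i - j).val = (g ^ j.val)⁻¹ * g ^ i.val := fun i j => by
    rw [eq_inv_mul_iff_mul_eq, ← hadd, add_sub_cancel]
  have hnat : g ^ ((m : ZMod (2 * m))).val = g ^ m := by
    rw [ZMod.val_natCast, hmod]
  have hz : ∀ i : ZMod (2 * m), g ^ i.val ∈ Subgroup.zpowers g := fun i =>
    (Subgroup.zpowers g).pow_mem (Subgroup.mem_zpowers g) _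
  have hinj : ∀ i j : ZMod (2 * m), g ^ i.val = g ^ j.val → i = j := fun i j h =>
    ZMod.val_injective _ (pow_injOn_Iio_orderOf (by simpa [hg] using ZMod.val_lt i)
      (by simpa [hg] using ZMod.val_lt j) h)
  let f : QuaternionGroup m →* G :=
    { toFun := fun q => match q with
        | a i => g ^ i.val
        | xa i => x * g ^ i.val
      map_one' := by
        change g ^ (0 : ZMod (2 * m)).val = 1
        simp
      map_mul' := by
        rintro (i | i) (j | j)
        · exact hadd i j
        · change x * g ^ (j - i).val = g ^ i.val * (x * g ^ j.val)
          rw [← mul_assoc, hconj _ (hz i), hsub, mul_assoc]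
        · change x * g ^ (i + j).val = x * g ^ i.val * g ^ j.val
          rw [hadd, mul_assoc]
        · change g ^ ((m : ZMod (2 * m)) + j - i).val = x * g ^ i.val * (x * g ^ j.val)
          rw [add_sub_assoc, hadd, hnat, hsub, mul_assoc x, ← mul_assoc (g ^ i.val),
            hconj _ (hz i), ← hxx]
          simp only [mul_assoc] }
  have hf : Function.Injective f := by
    have hne : ∀ i j : ZMod (2 * m), g ^ i.val ≠ x * g ^ j.val := fun i j h =>
      hx ((Subgroup.mul_mem_cancel_right _ (hz j)).1 (h ▸ hz i))
    rintro (i | i) (j | j) h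
    · exact congrArg a (hinj i j h)
    · exact absurd h (hne i j)
    · exact absurd h.symm (hne j i)
    · exact congrArg xa (hinj i j (mul_left_cancel h))
  have hb : Function.Bijective f := hf.bijective_of_nat_card_le (by
    rw [hcard, Nat.card_eq_fintype_card, QuaternionGroup.card])
  exact ⟨(MulEquiv.ofBijective f hb).symm⟩

variable {G : Type*} [Group G] [Finite G] {z : G}

theorem realizable_of_closure_eq_top {k : ℕ} (hG : Nat.card G = 2 ^ k) (hz1 : z ≠ 1)
    (hz : ∀ t : G, t * t = 1 ↔ t = 1 ∨ t = z)
    (hE : Subgroup.closure {g : G | g * g ≠ z} = ⊤) :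
    ∃ m < 2 * Nat.card G, Realizable G m := by
  have hzz : z * z = 1 := (hz z).2 (Or.inr rfl)
  by_cases h4 : ∀ t : G, t ^ 4 = 1
  · have hmem : ∀ x : G, x ∈ Subgroup.zpowers z := by
      have : Subgroup.closure {g : G | g * g ≠ z} ≤ Subgroup.zpowers z := by
        refine (Subgroup.closure_le _).2 fun t (ht : t * t ≠ z) => ?_
        have h : t * t * (t * t) = 1 := by
          rw [← h4 t]
          simp only [pow_succ, pow_zero, one_mul, mul_assoc]
        rcases (hz t).1 (((hz _).1 h).resolve_right ht) with rfl | rfl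
        · exact Subgroup.one_mem _
        · exact Subgroup.mem_zpowers _
      exact fun x => this (hE ▸ Subgroup.mem_top x)
    have hcard : Nat.card G = 2 := by
      rw [← orderOf_eq_card_of_forall_mem_zpowers hmem]
      exact orderOf_eq_prime (by rw [sq, hzz]) hz1
    have : Fact (Nat.Prime 2) := ⟨Nat.prime_two⟩
    exact ⟨2, by omega, realizable_two.congr (mulEquivOfPrimeCardEq (p := 2)
      (Nat.card_zmod 2) hcard)⟩
  · push Not at h4
    obtain ⟨t, ht⟩ := h4
    obtain ⟨j, hj⟩ := exists_orderOf_eq_two_pow hG t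
    have hj3 : 3 ≤ j := by
      by_contra! h
      exact ht (orderOf_dvd_iff_pow_eq_one.1 (hj ▸ pow_dvd_pow 2 (by omega : j ≤ 2)))
    obtain ⟨y, hy⟩ : ∃ y : G, orderOf y = 8 := by
      refine ⟨t ^ 2 ^ (j - 3), ?_⟩
      have e : orderOf t = 2 ^ (j - 3) * 8 := by
        rw [hj, show (8 : ℕ) = 2 ^ 3 by norm_num, ← pow_add]
        congr 1
        omega
      rw [orderOf_pow, e, Nat.gcd_mul_right_left, Nat.mul_div_cancel_left _ (by positivity)]
    have hzy : z ∈ Subgroup.zpowers y := mem_zpowers_of_unique_involution hz ⟨3, hy⟩ (by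
      rintro rfl
      simp at hy)
    refine Good.realizable_of_involution hzz hE (Subgroup.zpowers y) hzy ?_
    have hc : 8 = Nat.card (Subgroup.zpowers y) := by rw [Nat.card_zpowers, hy]
    let e : Multiplicative (ZMod 8) ≃* Subgroup.zpowers y :=
      mulEquivOfCyclicCardEq (by rw [← hc]; exact Nat.card_zmod 8)
    have he : e (Multiplicative.ofAdd (4 : ZMod 8)) = ⟨z, hzy⟩ := by
      have h₁ : e (Multiplicative.ofAdd (4 : ZMod 8)) * e (Multiplicative.ofAdd (4 : ZMod 8)) = 1 := by
        rw [← map_mul, ← map_one e]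
        rfl
      have h₂ : e (Multiplicative.ofAdd (4 : ZMod 8)) ≠ 1 := by
        rw [← map_one e]
        exact fun h => absurd (e.injective h) (by decide)
      exact Subtype.ext (((hz _).1 (congrArg Subtype.val h₁)).resolve_left
        fun h => h₂ (Subtype.ext h))
    convert good_eight.congr e
    rw [MonoidHom.map_zpowers]
    change _ = Subgroup.zpowers (e (Multiplicative.ofAdd (4 : ZMod 8)))
    rw [he]
    ext ⟨w, hw⟩
    simp only [Subgroup.mem_subgroupOf, Subgroup.mem_zpowers_iff, Subtype.ext_iff]
    rfl

theorem exists_zpowers_eq_of_comm {k : ℕ} (hG : Nat.card G = 2 ^ k)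
    (hz : ∀ t : G, t * t = 1 ↔ t = 1 ∨ t = z) {E : Subgroup G} (hE : E ≠ ⊥)
    (hcomm : ∀ x ∈ E, ∀ y ∈ E, x * y = y * x) : ∃ g, Subgroup.zpowers g = E := by
  obtain ⟨g, hgE, hg⟩ := Set.Finite.exists_maximalFor (orderOf : G → ℕ) (E : Set G)
    (Set.toFinite _) ⟨1, E.one_mem⟩
  have hmax : ∀ x ∈ E, orderOf x ≤ orderOf g := fun x hx => by
    rcases le_total (orderOf x) (orderOf g) with h | h
    · exact h
    · exact hg hx h
  have hg1 : g ≠ 1 := by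
    rintro rfl
    refine hE ((Subgroup.eq_bot_iff_forall _).2 fun x hx => ?_)
    have := hmax x hx
    rw [orderOf_one] at this
    exact orderOf_eq_one_iff.1 (le_antisymm this (orderOf_pos x))
  obtain ⟨c, hc⟩ := exists_orderOf_eq_two_pow hG g
  have hzg : z ∈ Subgroup.zpowers g := mem_zpowers_of_unique_involution hz ⟨c, hc⟩ hg1
  refine ⟨g, le_antisymm (Subgroup.zpowers_le.2 hgE) fun x hx => ?_⟩
  obtain ⟨i, hi⟩ := exists_orderOf_eq_two_pow hG x
  induction i generalizing x with
  | zero =>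
    rw [orderOf_eq_one_iff.1 hi]
    exact Subgroup.one_mem _
  | succ i ih =>
    have hord : orderOf (x * x) = 2 ^ i := by
      rw [← sq, orderOf_pow, hi, pow_succ, Nat.gcd_mul_left_left, Nat.mul_div_cancel _ two_pos]
    obtain ⟨l, hl⟩ := mem_powers_iff_mem_zpowers.2 (ih (x * x) (E.mul_mem hx hx) hord)
    have hl : g ^ l = x * x := hl
    rcases Nat.even_or_odd' l with ⟨l', rfl | rfl⟩
    · have hgl := E.pow_mem hgE l'
      have h1 : x * (g ^ l')⁻¹ * (x * (g ^ l')⁻¹) = 1 := by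
        rw [mul_assoc, ← mul_assoc _ x, ← hcomm x hx _ (E.inv_mem hgl), mul_assoc x,
          ← mul_assoc x, ← hl, two_mul, pow_add]
        group
      have h2 : x * (g ^ l')⁻¹ ∈ Subgroup.zpowers g := by
        rcases (hz _).1 h1 with h | h <;> rw [h]
        · exact Subgroup.one_mem _
        · exact hzg
      exact (Subgroup.mul_mem_cancel_right _ (Subgroup.inv_mem _
        (Subgroup.pow_mem _ (Subgroup.mem_zpowers g) l'))).1 h2
    · exfalso
      have h1 : orderOf (g ^ (2 * l' + 1)) = orderOf g := by
        refine Nat.Coprime.orderOf_pow ?_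
        rw [hc]
        exact Nat.Coprime.pow_left _ (Nat.coprime_two_left.2 (by simp))
      have h2 := hmax x hx
      rw [← h1, hl, hord, hi, pow_succ] at h2
      have := Nat.two_pow_pos i
      omega

theorem two_group_cases {k : ℕ} (hG : Nat.card G = 2 ^ k) (hz1 : z ≠ 1)
    (hz : ∀ t : G, t * t = 1 ↔ t = 1 ∨ t = z) :
    (∃ m < 2 * Nat.card G, Realizable G m) ∨
      (∃ r : ℕ, 3 ≤ r ∧ Nonempty (G ≃* QuaternionGroup (2 ^ (r - 2)))) ∨
      Nonempty (G ≃* Multiplicative (ZMod 4)) := by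
  have hzz : z * z = 1 := (hz z).2 (Or.inr rfl)
  set E := Subgroup.closure {g : G | g * g ≠ z} with hEdef
  have hEmem : ∀ t : G, t ∉ E → t * t = z := fun t ht => by
    by_contra h
    exact ht (Subgroup.subset_closure h)
  by_cases hE : E = ⊤
  · exact Or.inl (realizable_of_closure_eq_top hG hz1 hz hE)
  right
  obtain ⟨x, hx⟩ : ∃ x, x ∉ E := by
    by_contra! e
    exact hE (Subgroup.ext fun y => by simp [e y])
  have hinv : ∀ x ∉ E, ∀ y ∈ E, y * x = x * y⁻¹ := fun x hx y hy => by
    have h := hEmem (x * y) fun h => hx ((Subgroup.mul_mem_cancel_right _ hy).1 h)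
    rw [← hEmem x hx, mul_assoc] at h
    have h := mul_left_cancel h
    rw [← mul_assoc] at h
    exact eq_mul_inv_of_mul_eq h
  have hzE : z ∈ E := by
    by_contra h
    exact hz1 (by rw [← hEmem z h, hzz])
  have hpow : ∀ {g y : G} (j : ℕ), orderOf g = 2 ^ j → 2 ≤ j → y ∉ Subgroup.zpowers g →
      y * y = z → (∀ w ∈ Subgroup.zpowers g, w * y = y * w⁻¹) →
      (Subgroup.zpowers g).index = 2 →
      ∃ r : ℕ, 3 ≤ r ∧ Nonempty (G ≃* QuaternionGroup (2 ^ (r - 2))) :=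
      fun {g y} j hj hj2 hyg hyy hw hi => by
    obtain ⟨c, rfl⟩ := Nat.exists_eq_add_of_le' hj2
    refine ⟨c + 3, by omega, ?_⟩
    have hcard := (Subgroup.zpowers g).card_mul_index
    rw [hi, Nat.card_zpowers, hj] at hcard
    refine nonempty_quaternionGroup_equiv (by positivity) (g := g) (x := y)
      (by rw [hj, show c + 3 - 2 = c + 1 by omega]; ring) hyg ?_ hw
      (by rw [← hcard, show c + 3 - 2 = c + 1 by omega]; ring)
    rw [hyy, show c + 3 - 2 = c + 1 by omega]
    refine (((hz (g ^ 2 ^ (c + 1))).1 ?_).resolve_left fun h => ?_).symm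
    · rw [← pow_add, ← two_mul, ← pow_succ', ← hj, pow_orderOf_eq_one]
    · have := orderOf_dvd_of_pow_eq_one h
      rw [hj, Nat.pow_dvd_pow_iff_le_right (by norm_num)] at this
      omega
  by_cases hsmall : ∀ y ∈ E, y * y = 1
  · have hord : ∀ t : G, t * t = z → orderOf t = 4 := fun t ht => by
      have h1 : t ^ 2 ^ (1 + 1) = 1 := by
        rw [pow_succ, pow_mul, pow_one, sq t, ht, sq, hzz]
      have h2 : ¬ t ^ 2 ^ 1 = 1 := by
        rw [pow_one, sq, ht]
        exact hz1
      have : Fact (Nat.Prime 2) := ⟨Nat.prime_two⟩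
      simpa using orderOf_eq_prime_pow h2 h1
    have hxx := hEmem x hx
    have hxo := hord x hxx
    have hzx : z ∈ Subgroup.zpowers x :=
      hxx ▸ Subgroup.mul_mem _ (Subgroup.mem_zpowers x) (Subgroup.mem_zpowers x)
    have hout : ∀ t ∉ Subgroup.zpowers x, t * t = z := fun t ht => hEmem t fun h => by
      rcases (hz t).1 (hsmall t h) with rfl | rfl
      · exact ht (Subgroup.one_mem _)
      · exact ht hzx
    by_cases hcyc : ∀ t, t ∈ Subgroup.zpowers x
    · right
      have : IsCyclic G := ⟨x, hcyc⟩
      exact ⟨mulEquivOfCyclicCardEq (by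
        rw [← orderOf_eq_card_of_forall_mem_zpowers hcyc, hxo]
        exact (Nat.card_zmod 4).symm)⟩
    · left
      push Not at hcyc
      obtain ⟨y, hy⟩ := hcyc
      have hyinv : ∀ y ∉ Subgroup.zpowers x, ∀ w ∈ Subgroup.zpowers x, w * y = y * w⁻¹ :=
          fun y hy w hw => by
        have h := hout (y * w) fun h => hy ((Subgroup.mul_mem_cancel_right _ hw).1 h)
        rw [← hout y hy, mul_assoc] at h
        have h := mul_left_cancel h
        rw [← mul_assoc] at h
        exact eq_mul_inv_of_mul_eq h
      refine hpow 2 hxo le_rfl hy (hout y hy) (hyinv y hy) ?_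
      rw [Subgroup.index_eq_two_iff]
      refine ⟨y, fun b => ?_⟩
      by_cases hb : b ∈ Subgroup.zpowers x
      · exact Or.inr ⟨hb, fun h => hy ((Subgroup.mul_mem_cancel_left _ hb).1 h)⟩
      · refine Or.inl ⟨?_, hb⟩
        by_contra hby
        have h1 := hyinv _ hby x (Subgroup.mem_zpowers x)
        rw [← mul_assoc, hyinv b hb x (Subgroup.mem_zpowers x), mul_assoc,
          hyinv y hy _ (Subgroup.inv_mem _ (Subgroup.mem_zpowers x)), inv_inv, ← mul_assoc] at h1
        have h1 := mul_left_cancel h1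
        refine hz1 ?_
        rw [← hxx]
        nth_rw 1 [h1]
        exact inv_mul_cancel x
  · left
    push Not at hsmall
    obtain ⟨u, hu, huu⟩ := hsmall
    obtain ⟨g, hg⟩ := exists_zpowers_eq_of_comm hG hz (E := E)
      (fun h => hz1 (Subgroup.mem_bot.1 (h ▸ hzE))) fun a ha b hb => by
        have h1 := hinv x hx (a * b) (E.mul_mem ha hb)
        rw [mul_assoc, hinv x hx b hb, ← mul_assoc, hinv x hx a ha, mul_assoc] at h1
        have h1 := congrArg (·⁻¹) (mul_left_cancel h1)
        simpa using h1.symm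
    obtain ⟨j, hj⟩ := exists_orderOf_eq_two_pow hG g
    rw [← hg] at hx hinv hu
    refine hpow j hj ?_ hx (hEmem x (hg ▸ hx)) (hinv x hx) ?_
    · by_contra! h
      refine huu ?_
      obtain ⟨i, rfl⟩ := hu
      have hgg : g * g = 1 := by
        rw [← sq]
        exact orderOf_dvd_iff_pow_eq_one.1 (hj ▸ pow_dvd_pow 2 (by omega : j ≤ 1))
      change g ^ i * g ^ i = 1
      rw [← (Commute.refl g).mul_zpow, hgg, one_zpow]
    · rw [Subgroup.index_eq_two_iff]
      refine ⟨x, fun b => ?_⟩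
      by_cases hb : b ∈ Subgroup.zpowers g
      · exact Or.inr ⟨hb, fun h => hx ((Subgroup.mul_mem_cancel_left _ hb).1 h)⟩
      · refine Or.inl ⟨?_, hb⟩
        by_contra hbx
        have h1 := hinv _ hbx u hu
        rw [← mul_assoc, hinv b hb u hu, mul_assoc,
          hinv x hx _ (Subgroup.inv_mem _ hu), inv_inv, ← mul_assoc] at h1
        have h1 := mul_left_cancel h1
        refine huu ?_
        nth_rw 1 [h1]
        exact inv_mul_cancel u

end TwoGroup

section Cases

variable {G : Type*} [Group G] [Finite G]

theorem commute_of_orderOf_prime {x y : G} (hx : (orderOf x).Prime) (hx2 : orderOf x ≠ 2)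
    (hy : (orderOf y).Prime) (hy2 : orderOf y ≠ 2)
    (hS : ¬ ∃ m < 2 * Nat.card G, Realizable G m) : Commute x y := by
  by_cases hw : x * (y * x⁻¹ * y⁻¹) = 1
  · rw [← mul_assoc, ← mul_assoc, mul_inv_eq_one, mul_inv_eq_iff_eq_mul] at hw
    exact hw
  have hnx : y * x * y⁻¹ ∈ Subgroup.zpowers x := by
    by_contra h
    exact hS (realizable_of_conj_notMem (t := y⁻¹) hx hx2 (by rwa [inv_inv]))
  have hny : x * y * x⁻¹ ∈ Subgroup.zpowers y := by
    by_contra h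
    exact hS (realizable_of_conj_notMem (t := x⁻¹) hy hy2 (by rwa [inv_inv]))
  have h₁ : x * (y * x⁻¹ * y⁻¹) ∈ Subgroup.zpowers x :=
    Subgroup.mul_mem _ (Subgroup.mem_zpowers x) (by simpa [mul_assoc] using Subgroup.inv_mem _ hnx)
  have h₂ : x * (y * x⁻¹ * y⁻¹) ∈ Subgroup.zpowers y := by
    have := Subgroup.mul_mem _ hny (Subgroup.inv_mem _ (Subgroup.mem_zpowers y))
    simpa only [mul_assoc] using this
  obtain ⟨i, rfl⟩ := mem_of_prime_card (by rwa [Nat.card_zpowers]) h₁ hw h₂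
    (Subgroup.mem_zpowers x)
  exact (Commute.refl y).zpow_left i

theorem realizable_of_orderOf_four {x b : G} (hx : (orderOf x).Prime) (hx2 : orderOf x ≠ 2)
    (hb : orderOf b = 4) (hbz : b * b * x = x * (b * b)) :
    ∃ m < 2 * Nat.card G, Realizable G m := by
  by_contra hS
  have hodd := hx.odd_of_ne_two hx2
  have hn : b * x * b⁻¹ ∈ Subgroup.zpowers x := by
    by_contra h
    exact hS (realizable_of_conj_notMem (t := b⁻¹) hx hx2 (by rwa [inv_inv]))
  obtain ⟨i, hi⟩ := hn
  have hi : x ^ i = b * x * b⁻¹ := hi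
  have hii : x ^ (i * i - 1) = 1 := by
    rw [zpow_sub, zpow_one, zpow_mul, hi, conj_zpow, hi, mul_inv_eq_one]
    calc b * (b * x * b⁻¹) * b⁻¹ = b * b * x * (b * b)⁻¹ := by group
      _ = x := by rw [hbz, mul_inv_cancel_right]
  rw [← orderOf_dvd_iff_zpow_eq_one,
    show i * i - 1 = (i - 1) * (i + 1) by ring] at hii
  rcases (Nat.prime_iff_prime_int.1 hx).dvd_or_dvd hii with h | h
  · rw [orderOf_dvd_iff_zpow_eq_one, zpow_sub, zpow_one, mul_inv_eq_one, hi,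
      mul_inv_eq_iff_eq_mul] at h
    have hc : Commute x b := h.symm
    refine hS (realizable_of_orderOf_eq_mul (t := x * b) hodd ?_ (by norm_num : 3 ≤ 4) ?_)
    · have := hx.two_le
      omega
    · rw [hc.orderOf_mul_eq_mul_orderOf_of_coprime, hb]
      rw [hb]
      exact (Nat.Coprime.pow_right 2 (Nat.coprime_two_right.2 hodd) :)
  · rw [orderOf_dvd_iff_zpow_eq_one, zpow_add, zpow_one, mul_eq_one_iff_eq_inv, hi,
      mul_inv_eq_iff_eq_mul] at h
    exact hS (realizable_of_inverted hx hx2 hb h)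

theorem pow_two_mul_eq_one {p : ℕ} (hp : p.Prime) (hp2 : p ≠ 2) {x : G} (hx : orderOf x = p)
    (hS : ¬ ∃ m < 2 * Nat.card G, Realizable G m) (h4 : ∀ b : G, orderOf b ≠ 4) (t : G) :
    t ^ (2 * p) = 1 := by
  have h3 : 3 ≤ p := by
    have := hp.two_le
    omega
  have hodd := hp.odd_of_ne_two hp2
  rw [← orderOf_dvd_iff_pow_eq_one]
  by_cases hpt : p ∣ orderOf t
  · obtain ⟨j, hj⟩ := hpt
    have hj3 : j < 3 := by
      by_contra! h
      exact hS (realizable_of_orderOf_eq_mul hodd h3 h hj)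
    have := orderOf_pos t
    interval_cases j
    · omega
    · exact ⟨2, by rw [hj]; ring⟩
    · exact ⟨1, by rw [hj]; ring⟩
  · rcases Nat.eq_two_pow_or_exists_odd_prime_and_dvd (orderOf t) with ⟨c, hc⟩ | ⟨q, hq, hqt, hqo⟩
    · have hc2 : c < 2 := by
        by_contra! h
        obtain ⟨d, rfl⟩ := Nat.exists_eq_add_of_le' h
        refine h4 (t ^ 2 ^ d) ?_
        rw [orderOf_pow, hc, pow_add, Nat.gcd_mul_right_left,
          Nat.mul_div_cancel_left _ (by positivity)]
        norm_num
      rw [hc]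
      exact (pow_dvd_pow 2 (by omega : c ≤ 1)).trans ⟨p, by ring⟩
    · exfalso
      have hqp : q ≠ p := fun h => hpt (h ▸ hqt)
      have hy : orderOf (t ^ (orderOf t / q)) = q := orderOf_pow_orderOf_div (orderOf_pos t).ne' hqt
      have hq2 : q ≠ 2 := by
        rintro rfl
        exact absurd hqo (by decide)
      have hc := commute_of_orderOf_prime (hx ▸ hp) (hx ▸ hp2) (hy ▸ hq) (by rwa [hy]) hS
      refine hS (realizable_of_orderOf_eq_mul (t := x * t ^ (orderOf t / q)) (k := p) (j := q)
        hodd h3 ?_ ?_)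
      · have := hq.two_le
        omega
      · rw [hc.orderOf_mul_eq_mul_orderOf_of_coprime, hx, hy]
        rw [hx, hy]
        exact (Nat.coprime_primes hp hq).2 hqp.symm

theorem realizable_cases [Nontrivial G] :
    (∃ m < 2 * Nat.card G, Realizable G m) ∨
      (∃ r : ℕ, 3 ≤ r ∧ Nonempty (G ≃* QuaternionGroup (2 ^ (r - 2)))) ∨
      Nonempty (G ≃* Multiplicative (ZMod 4)) ∨
      (IsCyclic G ∧ (Nat.card G).Prime ∧ Nat.card G ≠ 2) ∨
      Nonempty (G ≃* Multiplicative (ZMod 3 × ZMod 3)) := by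
  by_cases hS : ∃ m < 2 * Nat.card G, Realizable G m
  · exact Or.inl hS
  have huniq : ∀ z : G, z ≠ 1 → z * z = 1 → ∀ t : G, t * t = 1 ↔ t = 1 ∨ t = z :=
      fun z hz hzz t => by
    constructor
    · intro htt
      by_contra! h
      exact hS (realizable_of_ne_involution hz hzz h.1 htt h.2.symm)
    · rintro (rfl | rfl)
      · exact one_mul 1
      · exact hzz
  have hcent : ∀ z : G, z * z = 1 → ∀ g, z * g = g * z := fun z hzz g => by
    by_cases hz : z = 1
    · rw [hz, one_mul, mul_one]
    · exact mul_comm_of_unique_involution hz (huniq z hz hzz) g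
  rcases Nat.eq_two_pow_or_exists_odd_prime_and_dvd (Nat.card G) with ⟨k, hk⟩ | ⟨p, hp, hpG, hpo⟩
  · have : Fact (Nat.Prime 2) := ⟨Nat.prime_two⟩
    have hdvd : 2 ∣ Nat.card G := by
      have := Finite.one_lt_card (α := G)
      rw [hk] at this ⊢
      exact dvd_pow_self 2 (by rintro rfl; simp at this)
    obtain ⟨z, hz⟩ := exists_prime_orderOf_dvd_card' 2 hdvd
    have hz1 : z ≠ 1 := by
      rintro rfl
      simp at hz
    have hzz : z * z = 1 := by rw [← sq, ← hz, pow_orderOf_eq_one]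
    rcases two_group_cases hk hz1 (huniq z hz1 hzz) with h | h | h
    · exact Or.inl h
    · exact Or.inr (Or.inl h)
    · exact Or.inr (Or.inr (Or.inl h))
  · have hp2 : p ≠ 2 := by
      rintro rfl
      exact absurd hpo (by decide)
    have : Fact p.Prime := ⟨hp⟩
    obtain ⟨x, hx⟩ := exists_prime_orderOf_dvd_card' p hpG
    have h4 : ∀ b : G, orderOf b ≠ 4 := fun b hb => by
      refine hS (realizable_of_orderOf_four (hx ▸ hp) (hx ▸ hp2) hb (hcent _ ?_ x))
      have := pow_orderOf_eq_one b
      rw [hb] at this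
      rw [← this]
      simp only [pow_succ, pow_zero, one_mul, mul_assoc]
    have hpow := pow_two_mul_eq_one hp hp2 hx hS h4
    have hcomm : ∀ a b : G, a * b = b * a := by
      have hinv : ∀ t : G, t ^ p * t ^ p = 1 := fun t => by
        rw [← pow_add, ← two_mul, hpow]
      have hpr : ∀ t : G, t ^ p = 1 → t ≠ 1 → orderOf t = p := fun t ht h1 =>
        orderOf_eq_prime ht h1
      have hc : ∀ a b : G, a ^ p = 1 → b ^ p = 1 → Commute a b := fun a b ha hb => by
        by_cases ha1 : a = 1
        · rw [ha1]
          exact Commute.one_left b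
        by_cases hb1 : b = 1
        · rw [hb1]
          exact Commute.one_right a
        have h1 := hpr a ha ha1
        have h2 := hpr b hb hb1
        exact commute_of_orderOf_prime (h1 ▸ hp) (by rwa [h1]) (h2 ▸ hp) (by rwa [h2]) hS
      have hodd : ∀ t : G, (t ^ (p + 1)) ^ p = 1 := fun t => by
        obtain ⟨l, hl⟩ := hpo
        rw [← pow_mul, show (p + 1) * p = 2 * p * (l + 1) by rw [hl]; ring, pow_mul, hpow, one_pow]
      have hsplit : ∀ t : G, t = t ^ (p + 1) * t ^ p := fun t => by
        rw [pow_succ', mul_assoc, hinv, mul_one]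
      intro a b
      have h1 : ∀ t g : G, Commute (t ^ p) g := fun t g => hcent _ (hinv t) g
      rw [hsplit a, hsplit b]
      exact ((hc _ _ (hodd a) (hodd b)).mul_right (h1 b _).symm).mul_left (h1 a _)
    let _ : CommGroup G := { ‹Group G› with mul_comm := hcomm }
    by_cases hz : ∃ z : G, z ≠ 1 ∧ z * z = 1
    · obtain ⟨z, hz1, hzz⟩ := hz
      exact Or.inl (realizable_of_comm_of_involution hp hp2 hpG hpow hz1 (huniq z hz1 hzz))
    · have hpow' : ∀ t : G, t ^ p = 1 := fun t => by
        by_contra h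
        exact hz ⟨t ^ p, h, by rw [← pow_add, ← two_mul, hpow]⟩
      rcases realizable_or_of_pow_eq_one hp hp2 hpow' with h | ⟨h₁, h₂⟩ | h
      · exact Or.inl h
      · exact Or.inr (Or.inr (Or.inr (Or.inl ⟨h₁, h₂ ▸ hp, by rwa [h₂]⟩)))
      · exact Or.inr (Or.inr (Or.inr (Or.inr h)))

end Cases

theorem not_realizable_prime {p m : ℕ} (hp : p.Prime) (hp2 : p ≠ 2) {G : Type*} [Group G]
    (hG : Nat.card G = p) (hm : m < 2 * p) : ¬ Realizable G m := by
  have : Fact p.Prime := ⟨hp⟩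
  have : IsCyclic G := isCyclic_of_prime_card hG
  let _ : CommGroup G := IsCyclic.commGroup
  exact not_realizable_of_prime_card hp hp2 hG (Or.inl hm)

theorem realizable_of_prime_card {p : ℕ} (hp : p.Prime) (hp7 : 7 ≤ p) {G : Type*} [Group G]
    (hG : Nat.card G = p) : Realizable G (2 * p) := by
  have : Fact p.Prime := ⟨hp⟩
  have hne : ∀ i : ℕ, i ≠ 0 → i < 7 → (i : ZMod p) ≠ 0 := fun i hi hi7 h => by
    rw [ZMod.natCast_eq_zero_iff] at h
    have := Nat.le_of_dvd (Nat.pos_of_ne_zero hi) h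
    omega
  have h := realizable_of_ring (R := ZMod p) (fun x => ⟨x.val, (ZMod.natCast_zmod_val x).symm⟩)
    (by simp) (by simpa using hne 2) (by simpa using hne 3) (by simpa using hne 4)
    (by simpa using hne 5)
  rw [Nat.card_zmod] at h
  exact h.congr (mulEquivOfPrimeCardEq (p := p) (Nat.card_zmod p) hG)

theorem graphAlpha_eq_of_realizable {G : Type*} [Group G] {m : ℕ} (h : Realizable G m)
    (hmin : ∀ k < m, ¬ Realizable G k) : graphAlpha G = m := by
  refine le_antisymm (Nat.sInf_le h) ?_
  by_contra! hlt
  exact hmin _ hlt (Nat.sInf_mem (s := {n | Realizable G n}) ⟨m, h⟩)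

/-- Corollary: equality in Babai's bound `α(G) ≤ 2|G|` holds exactly for the
generalised quaternion groups `Q_{2^r}` (`r ≥ 3`), the cyclic groups of prime
order `p ≥ 7`, and `C₃ × C₃`. -/
theorem alpha_eq_two_mul_card_iff (G : Type*) [Group G] [Finite G] :
    graphAlpha G = 2 * Nat.card G ↔
      ((∃ r : ℕ, 3 ≤ r ∧ Nonempty (G ≃* QuaternionGroup (2 ^ (r - 2)))) ∨
        (IsCyclic G ∧ ∃ p : ℕ, p.Prime ∧ 7 ≤ p ∧ Nat.card G = p) ∨
        Nonempty (G ≃* Multiplicative (ZMod 3 × ZMod 3))) := by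
  constructor
  · intro h
    have hsmall : ¬ ∃ m < 2 * Nat.card G, Realizable G m := fun ⟨m, hm, hr⟩ => by
      have : graphAlpha G ≤ m := Nat.sInf_le hr
      omega
    have hreal : Realizable G (2 * Nat.card G) := by
      have hpos : 0 < graphAlpha G := by
        have := Nat.card_pos (α := G)
        omega
      exact h ▸ Nat.sInf_mem (s := {n | Realizable G n}) (Nat.nonempty_of_pos_sInf hpos)
    cases subsingleton_or_nontrivial G with
    | inl hsub =>
      exact absurd ⟨0, by have := Nat.card_pos (α := G); omega,
        realizable_of_subsingleton (by norm_num)⟩ hsmall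
    | inr hnt =>
      rcases realizable_cases (G := G) with h | h | ⟨⟨e⟩⟩ | ⟨hc, hp, hp2⟩ | h
      · exact absurd h hsmall
      · exact Or.inl h
      · have hcard : Nat.card G = 4 := (Nat.card_congr e.toEquiv).trans (Nat.card_zmod 4)
        rw [hcard] at hreal
        exact absurd (hreal.congr e) not_realizable_four
      · refine Or.inr (Or.inl ⟨hc, _, hp, ?_, rfl⟩)
        by_contra! hlt
        have h35 : Nat.card G = 3 ∨ Nat.card G = 5 := by
          have := hp.two_le
          generalize Nat.card G = q at *
          interval_cases q
          · exact absurd rfl hp2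
          · exact Or.inl rfl
          · norm_num at hp
          · exact Or.inr rfl
          · norm_num at hp
        have := Fact.mk hp
        exact not_realizable_small_prime h35 (hreal.congr
          (mulEquivOfPrimeCardEq (p := Nat.card G) rfl (Nat.card_zmod _)))
      · exact Or.inr (Or.inr h)
  · rintro (⟨r, hr, ⟨e⟩⟩ | ⟨-, p, hp, hp7, hcard⟩ | ⟨⟨e⟩⟩)
    · obtain ⟨k, rfl⟩ := Nat.exists_eq_add_of_le' hr
      rw [show k + 3 - 2 = k + 1 by omega] at e
      have hcard := Nat.card_congr e.toEquiv
      have hlt : 2 ≤ 2 ^ (k + 1) := by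
        have := Nat.two_pow_pos k
        rw [pow_succ]
        omega
      rw [hcard]
      refine graphAlpha_eq_of_realizable ((realizable_quaternionGroup hlt).congr e.symm)
        fun m hm hr => not_realizable_quaternionGroup ?_ (hr.congr e)
      have : NeZero (2 ^ (k + 1)) := ⟨by positivity⟩
      rw [Nat.card_eq_fintype_card, QuaternionGroup.card] at hm
      omega
    · rw [hcard]
      exact graphAlpha_eq_of_realizable (realizable_of_prime_card hp hp7 hcard)
        fun m hm => not_realizable_prime hp (by omega) hcard hm
    · rw [(Nat.card_congr e.toEquiv).trans card_nineGroup]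
      exact graphAlpha_eq_of_realizable (realizable_nine.congr e.symm)
        fun m hm hr => not_realizable_nineGroup hm (hr.congr e)
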